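/- arXiv:2108.08917 — 4 statements merged into one kernel-verified Lean document; each statement's English description precedes it below -/
import Mathlib

section
/- (Gromov) Let n > 1 be odd and let B ⊂ ℝ^{n+2} be a convex body that is symmetric about the origin (B = -B) and contains the origin in its interior. If all sections of B by n-dimensional linear subspaces are linearly equivalent to one another (for any two n-dimensional linear subspaces W₁, W₂ of ℝ^{n+2} there is a bijective linear map of ℝ^{n+2} carrying B ∩ W₁ onto B ∩ W₂), then B is an ellipsoid. -/
open Metric

/-- A subset of a real vector space is an ellipsoid if it is the image of the closed
Euclidean unit ball under a bijective affine map. -/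
def IsEllipsoid {E : Type*} [NormedAddCommGroup E] [InnerProductSpace ℝ E]
    (K : Set E) : Prop :=
  ∃ g : E ≃ᵃ[ℝ] E, K = g '' closedBall (0 : E) 1

section

open Filter Topology Set

section InfinitesimalIsometry

variable {F : Type*} [NormedAddCommGroup F] [NormedSpace ℝ F]

/-- A linear map generating a one-parameter group of isometries, expressed by the condition that
`Z w` is Birkhoff orthogonal to `w` for all `w`. -/
def IsInfinitesimalIsometry (Z : F →L[ℝ] F) : Prop :=
  ∀ (w : F) (s : ℝ), ‖w‖ ≤ ‖w + s • Z w‖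

theorem IsInfinitesimalIsometry.neg {Z : F →L[ℝ] F} (hZ : IsInfinitesimalIsometry Z) :
    IsInfinitesimalIsometry (-Z) := fun w s => by
  simpa using hZ w (-s)

theorem norm_le_norm_add_smul_of_norm_sub_le {t ε : ℕ → ℝ} {z : ℕ → F} {w z₀ : F}
    (ht : ∀ j, 0 < t j) (hz : Tendsto z atTop (𝓝 z₀)) (hε : Tendsto ε atTop (𝓝 0))
    (h : ∀ j, ‖w - t j • z j‖ ≤ ‖w‖ + t j * ε j) {s : ℝ} (hs : 0 ≤ s) :
    ‖w‖ ≤ ‖w + s • z₀‖ := by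
  have key : ∀ j, ‖w‖ ≤ ‖w + s • z j‖ + s * ε j := fun j => by
    have htj := ht j
    have h1 : (s + t j) • w = s • (w - t j • z j) + t j • (w + s • z j) := by module
    have h2 : (s + t j) * ‖w‖ ≤ s * ‖w - t j • z j‖ + t j * ‖w + s • z j‖ := by
      have := congrArg norm h1
      rw [norm_smul, Real.norm_of_nonneg (by positivity)] at this
      rw [this]
      refine (norm_add_le _ _).trans (le_of_eq ?_)
      rw [norm_smul, norm_smul, Real.norm_of_nonneg hs, Real.norm_of_nonneg htj.le]
    have h3 : t j * ‖w‖ ≤ t j * (‖w + s • z j‖ + s * ε j) := by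
      nlinarith [mul_le_mul_of_nonneg_left (h j) hs]
    exact le_of_mul_le_mul_left h3 htj
  refine ge_of_tendsto' (?_ : Tendsto (fun j => ‖w + s • z j‖ + s * ε j) atTop _) key
  simpa using ((hz.const_smul s).const_add w).norm.add (hε.const_mul s)

theorem norm_le_norm_add_smul_of_le_norm_add {t ε : ℕ → ℝ} {z : ℕ → F} {w z₀ : F}
    (ht : ∀ j, 0 < t j) (ht0 : Tendsto t atTop (𝓝 0)) (hz : Tendsto z atTop (𝓝 z₀))
    (hε : Tendsto ε atTop (𝓝 0))
    (h : ∀ j, ‖w‖ ≤ ‖w + t j • z j‖ + t j * ε j) {s : ℝ} (hs : 0 < s) :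
    ‖w‖ ≤ ‖w + s • z₀‖ := by
  have key : ∀ᶠ j in atTop, ‖w‖ ≤ ‖w + s • z j‖ + s * ε j := by
    filter_upwards [ht0.eventually_lt_const hs] with j hj
    have htj := ht j
    have h1 : s • (w + t j • z j) = (s - t j) • w + t j • (w + s • z j) := by module
    have h2 : s * ‖w + t j • z j‖ ≤ (s - t j) * ‖w‖ + t j * ‖w + s • z j‖ := by
      have := congrArg norm h1
      rw [norm_smul, Real.norm_of_nonneg hs.le] at this
      rw [this]
      refine (norm_add_le _ _).trans (le_of_eq ?_)
      rw [norm_smul, norm_smul, Real.norm_of_nonneg (sub_pos.2 hj).le, Real.norm_of_nonneg htj.le]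
    have h3 : t j * ‖w‖ ≤ t j * (‖w + s • z j‖ + s * ε j) := by
      nlinarith [mul_le_mul_of_nonneg_left (h j) hs.le]
    exact le_of_mul_le_mul_left h3 htj
  refine ge_of_tendsto (?_ : Tendsto (fun j => ‖w + s • z j‖ + s * ε j) atTop _) key
  simpa using ((hz.const_smul s).const_add w).norm.add (hε.const_mul s)

theorem norm_le_norm_add_smul_of_tendsto {t ε : ℕ → ℝ} {z z' : ℕ → F} {w z₀ : F}
    (ht : ∀ j, 0 < t j) (ht0 : Tendsto t atTop (𝓝 0)) (hz : Tendsto z atTop (𝓝 z₀))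
    (hz' : Tendsto z' atTop (𝓝 z₀)) (hε : Tendsto ε atTop (𝓝 0))
    (h : ∀ j, ‖w + t j • z j‖ ≤ ‖w‖ + t j * ε j)
    (h' : ∀ j, ‖w‖ ≤ ‖w + t j • z' j‖ + t j * ε j) (s : ℝ) :
    ‖w‖ ≤ ‖w + s • z₀‖ := by
  rcases lt_or_ge 0 s with hs | hs
  · exact norm_le_norm_add_smul_of_le_norm_add ht ht0 hz' hε h' hs
  · have := norm_le_norm_add_smul_of_norm_sub_le (w := w) ht hz.neg hε
      (by simpa [sub_neg_eq_add] using h) (neg_nonneg.2 hs)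
    simpa using this

theorem IsInfinitesimalIsometry.norm_le_of_hasDerivAt {Z : F →L[ℝ] F}
    (hZ : IsInfinitesimalIsometry Z) {c : ℝ → F} (hc : ∀ t, HasDerivAt c (Z (c t)) t)
    {t : ℝ} (ht : 0 ≤ t) : ‖c 0‖ ≤ ‖c t‖ := by
  have hcont : Continuous c := continuous_iff_continuousAt.2 fun t => (hc t).continuousAt
  have := image_le_of_liminf_slope_right_le_deriv_boundary (f := fun x => -‖c x‖) (a := 0)
    (b := t) (B := fun _ => -‖c 0‖) (B' := fun _ => 0) hcont.norm.neg.continuousOn le_rfl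
    continuousOn_const (fun x _ => hasDerivWithinAt_const ..) ?_ (right_mem_Icc.2 ht)
  · linarith
  intro x _ r hr
  refine Eventually.frequently ?_
  have h1 : ∀ᶠ z in 𝓝[>] x, ‖c z - c x - (z - x) • Z (c x)‖ ≤ r / 2 * ‖z - x‖ :=
    nhdsWithin_le_nhds ((hasDerivAt_iff_isLittleO.1 (hc x)).def (half_pos hr))
  filter_upwards [h1, self_mem_nhdsWithin] with z hz hxz
  have hxz' : 0 < z - x := sub_pos.2 hxz
  rw [slope_def_field, div_lt_iff₀ hxz']
  rw [Real.norm_of_nonneg hxz'.le] at hz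
  have h2 := hZ (c x) (z - x)
  have h3 : ‖c x + (z - x) • Z (c x)‖ ≤ ‖c z‖ + ‖c z - c x - (z - x) • Z (c x)‖ := by
    refine le_trans (le_of_eq ?_) (norm_sub_le _ _)
    congr 1
    abel
  nlinarith

theorem IsInfinitesimalIsometry.norm_eq_of_hasDerivAt {Z : F →L[ℝ] F}
    (hZ : IsInfinitesimalIsometry Z) {c : ℝ → F} (hc : ∀ t, HasDerivAt c (Z (c t)) t)
    {t : ℝ} (ht : 0 ≤ t) : ‖c t‖ = ‖c 0‖ := by
  refine le_antisymm ?_ (hZ.norm_le_of_hasDerivAt hc ht)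
  have := hZ.neg.norm_le_of_hasDerivAt (c := fun s => c (t - s)) (fun s => ?_) ht
  · simpa using this
  · simpa using (hc (t - s)).comp_const_sub t s

theorem IsInfinitesimalIsometry.norm_exp_apply [CompleteSpace F] {Z : F →L[ℝ] F}
    (hZ : IsInfinitesimalIsometry Z) {t : ℝ} (ht : 0 ≤ t) (w : F) :
    ‖NormedSpace.exp (t • Z) w‖ = ‖w‖ := by
  have := hZ.norm_eq_of_hasDerivAt (c := fun s => NormedSpace.exp (s • Z) w) (fun s => ?_) ht
  · simpa using this
  · exact (hasDerivAt_exp_smul_const' (𝕂 := ℝ) Z s).clm_apply (hasDerivAt_const s w) |>.congr_deriv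
      (by simp)

end InfinitesimalIsometry

section ModelsSections

variable {F E : Type*} [NormedAddCommGroup F] [NormedSpace ℝ F]
  [NormedAddCommGroup E] [NormedSpace ℝ E]

theorem tendsto_clm_apply {ι : Type*} {l : Filter ι} {A : ι → F →L[ℝ] E} {A₀ : F →L[ℝ] E}
    {v : ι → F} {v₀ : F} (hA : Tendsto A l (𝓝 A₀)) (hv : Tendsto v l (𝓝 v₀)) :
    Tendsto (fun j => A j (v j)) l (𝓝 (A₀ v₀)) :=
  (isBoundedBilinearMap_apply.continuous.tendsto (A₀, v₀)).comp (hA.prodMk_nhds hv)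

variable (F E) in
/-- Every injective linear image of `F` in `E`, with the norm induced from `E`, is linearly
isometric to `F`. -/
def ModelsSections : Prop :=
  ∀ S : F →L[ℝ] E, Function.Injective S → ∃ A : F →L[ℝ] F, ∀ w, ‖A w‖ = ‖S w‖

theorem injective_of_norm_eq {T : F →L[ℝ] E} (hT : ∀ w, ‖T w‖ = ‖w‖) : Function.Injective T :=
  (injective_iff_map_eq_zero T).2 fun w hw => by
    rw [← norm_eq_zero, ← hT, hw, norm_zero]

theorem isClosed_setOf_norm_eq (S : F →L[ℝ] E) :
    IsClosed {A : F →L[ℝ] F | ∀ w, ‖A w‖ = ‖S w‖} := by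
  simp only [ofPred_forall]
  exact isClosed_iInter fun w => isClosed_eq (by fun_prop) continuous_const

variable [FiniteDimensional ℝ F]

theorem exists_inverse_of_injective {A : F →L[ℝ] F} (hA : Function.Injective A) :
    ∃ B : F →L[ℝ] F, B * A = 1 ∧ A * B = 1 := by
  let e := (LinearEquiv.ofInjectiveEndo (A : F →ₗ[ℝ] F) hA).toContinuousLinearEquiv
  have he : ∀ x, e x = A x := fun x => rfl
  refine ⟨e.symm, ?_, ?_⟩ <;> ext x
  · simp [← he]
  · simp [← he]

theorem exists_isometric_inverse {A : F →L[ℝ] F} (hA : ∀ w, ‖A w‖ = ‖w‖) :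
    ∃ B : F →L[ℝ] F, B * A = 1 ∧ A * B = 1 ∧ ∀ w, ‖B w‖ = ‖w‖ := by
  obtain ⟨B, h1, h2⟩ := exists_inverse_of_injective (injective_of_norm_eq hA)
  refine ⟨B, h1, h2, fun w => ?_⟩
  rw [← hA (B w), ← mul_apply_eq_comp, h2, one_apply_eq_self]

theorem exists_subseq_tendsto_of_norm_eq {S : ℕ → F →L[ℝ] E} {S₀ : F →L[ℝ] E}
    (hS : Tendsto S atTop (𝓝 S₀)) {A : ℕ → F →L[ℝ] F} (hA : ∀ j w, ‖A j w‖ = ‖S j w‖) :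
    ∃ (A₀ : F →L[ℝ] F) (φ : ℕ → ℕ), StrictMono φ ∧ Tendsto (A ∘ φ) atTop (𝓝 A₀) ∧
      ∀ w, ‖A₀ w‖ = ‖S₀ w‖ := by
  obtain ⟨C, hC⟩ := hS.norm.bddAbove_range
  have hA' : ∀ j, A j ∈ closedBall (0 : F →L[ℝ] F) C := fun j => by
    rw [mem_closedBall_zero_iff]
    refine le_trans (ContinuousLinearMap.opNorm_le_bound _ (norm_nonneg (S j)) fun w => ?_)
      (hC (mem_range_self j))
    rw [hA]
    exact (S j).le_opNorm w
  have : ProperSpace (F →L[ℝ] F) := FiniteDimensional.proper_real _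
  obtain ⟨A₀, -, φ, hφ, hlim⟩ := tendsto_subseq_of_bounded isBounded_closedBall hA'
  refine ⟨A₀, φ, hφ, hlim, fun w => ?_⟩
  refine tendsto_nhds_unique (f := fun j => ‖(A ∘ φ) j w‖)
    (tendsto_clm_apply hlim tendsto_const_nhds).norm ?_
  simpa [hA] using (tendsto_clm_apply (hS.comp hφ.tendsto_atTop) (tendsto_const_nhds (x := w))).norm

theorem exists_tendsto_one_of_modelsSections (hM : ModelsSections F E) (T X : F →L[ℝ] E)
    (hT : ∀ w, ‖T w‖ = ‖w‖) :
    ∃ (t : ℕ → ℝ) (A : ℕ → F →L[ℝ] F), (∀ j, 0 < t j) ∧ Tendsto t atTop (𝓝 0) ∧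
      (∀ j w, ‖A j w‖ = ‖(T + t j • X) w‖) ∧ Tendsto A atTop (𝓝 1) ∧
      ∀ j (B : F →L[ℝ] F), (∀ w, ‖B w‖ = ‖(T + t j • X) w‖) → ‖A j - 1‖ ≤ ‖B - 1‖ := by
  have hlim : Tendsto (fun t : ℝ => T + t • X) (𝓝 0) (𝓝 T) := by
    have : Continuous (fun t : ℝ => T + t • X) := by fun_prop
    simpa using this.tendsto 0
  have hinj : ∀ᶠ t : ℝ in 𝓝 0, Function.Injective (T + t • X) :=
    hlim.eventually (ContinuousLinearMap.isOpen_injective.mem_nhds (injective_of_norm_eq hT))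
  obtain ⟨δ, hδ, hδ'⟩ := Metric.eventually_nhds_iff.1 hinj
  let s : ℕ → ℝ := fun j => δ / 2 * (1 / ((j : ℝ) + 1))
  have hs : ∀ j, 0 < s j := fun j => by positivity
  have hs0 : Tendsto s atTop (𝓝 0) := by
    have := (tendsto_one_div_add_atTop_nhds_zero_nat (𝕜 := ℝ)).const_mul (δ / 2)
    rwa [mul_zero] at this
  have hsinj : ∀ j, Function.Injective (T + s j • X) := fun j => by
    refine hδ' ?_
    rw [dist_zero_right, Real.norm_of_nonneg (hs j).le]
    have : 1 / ((j : ℝ) + 1) ≤ 1 := by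
      rw [div_le_one (by positivity)]
      linarith [j.cast_nonneg (α := ℝ)]
    have : s j ≤ δ / 2 * 1 := mul_le_mul_of_nonneg_left this (by positivity)
    linarith
  have : ProperSpace (F →L[ℝ] F) := FiniteDimensional.proper_real _
  have hex : ∀ j, ∃ A : F →L[ℝ] F, (∀ w, ‖A w‖ = ‖(T + s j • X) w‖) ∧
      ∀ B : F →L[ℝ] F, (∀ w, ‖B w‖ = ‖(T + s j • X) w‖) → ‖A - 1‖ ≤ ‖B - 1‖ := fun j => by
    obtain ⟨A, hA, hA'⟩ := (isClosed_setOf_norm_eq (T + s j • X)).exists_infDist_eq_dist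
      (hM _ (hsinj j)) 1
    refine ⟨A, hA, fun B hB => ?_⟩
    rw [← dist_eq_norm, ← dist_eq_norm, dist_comm, dist_comm B, ← hA']
    exact infDist_le_dist_of_mem hB
  choose A hA hmin using hex
  obtain ⟨A₀, φ, hφ, hlimA, hA₀⟩ := exists_subseq_tendsto_of_norm_eq (hlim.comp hs0) hA
  obtain ⟨B, hBA, -, hB⟩ := exists_isometric_inverse (A := A₀) fun w => by rw [hA₀, hT]
  refine ⟨s ∘ φ, A ∘ φ, fun j => hs _, hs0.comp hφ.tendsto_atTop, fun j w => hA _ w, ?_,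
    fun j B hB => hmin _ B hB⟩
  rw [tendsto_iff_norm_sub_tendsto_zero]
  refine squeeze_zero (fun _ => norm_nonneg _)
    (fun j => hmin (φ j) (B * A (φ j)) fun w => by simp [hB, hA]) ?_
  have := ((hlimA.const_mul B).sub_const 1).norm
  simpa [hBA] using this

/-- The first order expansion of the norms induced on `F` by the maps `T + t • X`. -/
theorem exists_tendsto_inv_smul_of_modelsSections (hM : ModelsSections F E) (T X : F →L[ℝ] E)
    (hT : ∀ w, ‖T w‖ = ‖w‖) :
    ∃ (t : ℕ → ℝ) (A : ℕ → F →L[ℝ] F) (M : F →L[ℝ] F), (∀ j, 0 < t j) ∧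
      Tendsto t atTop (𝓝 0) ∧ (∀ j w, ‖A j w‖ = ‖(T + t j • X) w‖) ∧
      Tendsto (fun j => (t j)⁻¹ • (A j - 1)) atTop (𝓝 M) := by
  obtain ⟨t, A, ht, ht0, hA, hA1, hmin⟩ := exists_tendsto_one_of_modelsSections hM T X hT
  let P : ℕ → (F →L[ℝ] F) × ℝ := fun j => (A j - 1, t j)
  have hP0 : Tendsto P atTop (𝓝 0) := by
    have := (hA1.sub_const 1).prodMk_nhds ht0
    rwa [sub_self] at this
  have hPpos : ∀ j, 0 < ‖P j‖ := fun j => by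
    rw [norm_pos_iff]
    exact fun h => (ht j).ne' (congrArg Prod.snd h)
  have : ProperSpace (F →L[ℝ] F) := FiniteDimensional.proper_real _
  have hN : ∀ j, ‖P j‖⁻¹ • P j ∈ sphere (0 : (F →L[ℝ] F) × ℝ) 1 := fun j => by
    rw [mem_sphere_zero_iff_norm, norm_smul, norm_inv, norm_norm, inv_mul_cancel₀ (hPpos j).ne']
  obtain ⟨⟨Z, θ⟩, hZθ, ψ, hψ, hlim⟩ := (isCompact_sphere _ _).tendsto_subseq hN
  rw [mem_sphere_zero_iff_norm] at hZθ
  have hψt := hψ.tendsto_atTop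
  have hZ : Tendsto (fun j => ‖P (ψ j)‖⁻¹ • (A (ψ j) - 1)) atTop (𝓝 Z) :=
    (continuous_fst.tendsto _).comp hlim
  have hθ : Tendsto (fun j => ‖P (ψ j)‖⁻¹ * t (ψ j)) atTop (𝓝 θ) :=
    (continuous_snd.tendsto _).comp hlim
  have hσ0 : Tendsto (fun j => ‖P (ψ j)‖) atTop (𝓝 0) := by
    simpa using (hP0.comp hψt).norm
  rcases eq_or_ne θ 0 with rfl | hθ0
  · exfalso
    have hZ1 : ‖Z‖ = 1 := by simpa [Prod.norm_def] using hZθ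
    have hII : IsInfinitesimalIsometry Z := fun w => by
      have hpert : ∀ j, ‖(t (ψ j)) • X w‖ = ‖P (ψ j)‖ * (‖P (ψ j)‖⁻¹ * t (ψ j) * ‖X w‖) :=
        fun j => by
          rw [norm_smul, Real.norm_of_nonneg (ht _).le, ← mul_assoc, ← mul_assoc,
            mul_inv_cancel₀ (hPpos _).ne', one_mul]
      have heq : ∀ j, ‖w + ‖P (ψ j)‖ • (‖P (ψ j)‖⁻¹ • (A (ψ j) - 1)) w‖ =
          ‖T w + t (ψ j) • X w‖ := fun j => by
        rw [smul_apply, smul_inv_smul₀ (hPpos _).ne']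
        simpa using hA (ψ j) w
      refine norm_le_norm_add_smul_of_tendsto (fun j => hPpos (ψ j)) hσ0
        (z := fun j => (‖P (ψ j)‖⁻¹ • (A (ψ j) - 1)) w)
        (z' := fun j => (‖P (ψ j)‖⁻¹ • (A (ψ j) - 1)) w)
        (tendsto_clm_apply hZ tendsto_const_nhds) (tendsto_clm_apply hZ tendsto_const_nhds)
        (ε := fun j => ‖P (ψ j)‖⁻¹ * t (ψ j) * ‖X w‖) (by simpa using hθ.mul_const ‖X w‖)
        (fun j => ?_) (fun j => ?_)
      · rw [heq, ← hpert, ← hT w]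
        exact norm_add_le _ _
      · rw [heq, ← hpert, ← hT w]
        exact norm_le_add_norm_add _ _
    have hexp : Tendsto (fun j => ‖P (ψ j)‖⁻¹ • (NormedSpace.exp (‖P (ψ j)‖ • -Z) - 1)) atTop
        (𝓝 (-Z)) := by
      have h1 := (hasDerivAt_exp_smul_const (𝕂 := ℝ) (-Z) 0).tendsto_slope_zero
      have h2 : Tendsto (fun j => ‖P (ψ j)‖) atTop (𝓝[≠] 0) :=
        tendsto_nhdsWithin_iff.2 ⟨hσ0, Eventually.of_forall fun j => (hPpos _).ne'⟩
      simpa [Function.comp_def] using h1.comp h2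
    have hle : ∀ j, ‖‖P (ψ j)‖⁻¹ • (A (ψ j) - 1)‖ ≤
        ‖‖P (ψ j)‖⁻¹ • (NormedSpace.exp (‖P (ψ j)‖ • -Z) - 1) * A (ψ j) +
          ‖P (ψ j)‖⁻¹ • (A (ψ j) - 1)‖ := fun j => by
      have h1 := hmin (ψ j) (NormedSpace.exp (‖P (ψ j)‖ • -Z) * A (ψ j)) fun w => by
        rw [mul_apply_eq_comp, hII.neg.norm_exp_apply (norm_nonneg _), hA]
      have h2 : ‖P (ψ j)‖⁻¹ • (NormedSpace.exp (‖P (ψ j)‖ • -Z) - 1) * A (ψ j) +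
          ‖P (ψ j)‖⁻¹ • (A (ψ j) - 1) =
          ‖P (ψ j)‖⁻¹ • (NormedSpace.exp (‖P (ψ j)‖ • -Z) * A (ψ j) - 1) := by
        rw [smul_mul_assoc, ← smul_add, sub_mul, one_mul]
        congr 1
        abel
      rw [h2, norm_smul, norm_smul]
      exact mul_le_mul_of_nonneg_left h1 (norm_nonneg _)
    have hlim0 := ((hexp.mul (hA1.comp hψt)).add hZ).norm
    have := le_of_tendsto_of_tendsto' hZ.norm hlim0 hle
    rw [hZ1] at this
    simp at this
    linarith
  · refine ⟨t ∘ ψ, A ∘ ψ, θ⁻¹ • Z, fun j => ht _, ht0.comp hψt, fun j w => hA _ w, ?_⟩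
    refine ((hθ.inv₀ hθ0).smul hZ).congr fun j => ?_
    rw [smul_smul]
    congr 1
    have := (hPpos (ψ j)).ne'
    have := (ht (ψ j)).ne'
    simp only [Function.comp_apply]
    field_simp

end ModelsSections

section Rotation

variable {F : Type*} [NormedAddCommGroup F] [NormedSpace ℝ F]

theorem exists_eq_smul_add_smul (hF : Module.finrank ℝ F = 2) {u v : F}
    (huv : LinearIndependent ℝ ![u, v]) (x : F) : ∃ p q : ℝ, x = p • u + q • v := by
  have h := huv.span_eq_top_of_card_eq_finrank (by simp [hF])
  have hx : x ∈ Submodule.span ℝ (range ![u, v]) := h ▸ Submodule.mem_top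
  rw [Matrix.range_cons, Matrix.range_cons, Matrix.range_empty, union_empty] at hx
  obtain ⟨p, q, h⟩ := Submodule.mem_span_pair.1 hx
  exact ⟨p, q, h.symm⟩

theorem IsInfinitesimalIsometry.eigenvalue_eq_zero {L : F →L[ℝ] F}
    (hL : IsInfinitesimalIsometry L) {w : F} (hw : w ≠ 0) {r : ℝ} (h : L w = r • w) : r = 0 := by
  by_contra hr
  have h1 := hL w (-r⁻¹)
  rw [h, smul_smul, neg_mul, inv_mul_cancel₀ hr, neg_one_smul, add_neg_cancel, norm_zero] at h1
  exact hw (norm_le_zero_iff.1 h1)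

theorem exists_linearIndependent_apply {L : F →L[ℝ] F} (hL : IsInfinitesimalIsometry L)
    (hL0 : L ≠ 0) : ∃ w, LinearIndependent ℝ ![w, L w] := by
  by_contra! h
  refine hL0 (ContinuousLinearMap.ext fun w => ?_)
  rcases eq_or_ne w 0 with rfl | hw
  · simp
  have := h w
  rw [LinearIndependent.pair_iff' hw] at this
  push Not at this
  obtain ⟨r, hr⟩ := this
  rw [← hr, hL.eigenvalue_eq_zero hw hr.symm, zero_smul]
  rfl

/-- A linear flow of isometries on a plane has no real eigenvalues, so after rescaling it is a
rotation in a suitable basis. -/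
theorem IsInfinitesimalIsometry.exists_rotation (hF : Module.finrank ℝ F = 2) {L : F →L[ℝ] F}
    (hL : IsInfinitesimalIsometry L) {w : F} (hw : LinearIndependent ℝ ![w, L w]) :
    ∃ (a b : ℝ) (v : F), 0 < b ∧ L w = a • w + b • v ∧ L v = a • v - b • w := by
  have hw0 : w ≠ 0 := hw.ne_zero 0
  obtain ⟨p, q, hpq⟩ := exists_eq_smul_add_smul hF hw (L (L w))
  have hne : ∀ r : ℝ, L w - r • w ≠ 0 := fun r h0 => by
    have := (LinearIndependent.pair_iff' hw0).1 hw r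
    exact this (sub_eq_zero.1 h0).symm
  rcases le_or_gt 0 (q ^ 2 / 4 + p) with hd | hd
  · exfalso
    have hsq := Real.sq_sqrt hd
    set r := √(q ^ 2 / 4 + p) with hr
    have hp : p = r ^ 2 - q ^ 2 / 4 := by linarith
    have h1 : q / 2 + r = 0 := hL.eigenvalue_eq_zero (hne (q / 2 - r)) <| by
      rw [map_sub, map_smul, hpq, hp]
      module
    have h2 : q / 2 - r = 0 := hL.eigenvalue_eq_zero (hne (q / 2 + r)) <| by
      rw [map_sub, map_smul, hpq, hp]
      module
    have hq : q = 0 := by linarith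
    have hr0 : r = 0 := by linarith
    have hLL : L (L w) = 0 := by
      rw [hpq, hp, hq, hr0]
      simp
    have hflow : ∀ t : ℝ, 0 ≤ t → ‖w + t • L w‖ = ‖w‖ := fun t ht => by
      have := hL.norm_eq_of_hasDerivAt (c := fun s => w + s • L w) (fun s => ?_) ht
      · simpa using this
      · have := ((hasDerivAt_id s).smul_const (L w)).const_add w
        simpa [hLL] using this
    have hu : 0 < ‖L w‖ := norm_pos_iff.2 (by simpa using hne 0)
    have hw' : 0 < ‖w‖ := norm_pos_iff.2 hw0
    have h3 := hflow (3 * ‖w‖ / ‖L w‖) (by positivity)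
    have h4 : ‖(3 * ‖w‖ / ‖L w‖) • L w‖ = 3 * ‖w‖ := by
      rw [norm_smul, Real.norm_of_nonneg (by positivity)]
      field_simp
    have h5 := norm_sub_le (w + (3 * ‖w‖ / ‖L w‖) • L w) w
    rw [add_sub_cancel_left, h4, h3] at h5
    linarith
  · have hd' : 0 < -(q ^ 2 / 4 + p) := by linarith
    have hb := Real.sqrt_pos.2 hd'
    have hsq := Real.sq_sqrt hd'.le
    set b := √(-(q ^ 2 / 4 + p))
    have hp : p = -b ^ 2 - q ^ 2 / 4 := by linarith
    refine ⟨q / 2, b, b⁻¹ • (L w - (q / 2) • w), hb, ?_, ?_⟩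
    · rw [smul_inv_smul₀ hb.ne']
      abel
    · rw [map_smul, map_sub, map_smul, hpq, hp]
      have hbb : b • w = b⁻¹ • (b ^ 2 • w) := by
        rw [smul_smul]
        congr 1
        field_simp
      rw [hbb]
      module

theorem IsInfinitesimalIsometry.exists_norm_sq_eq (hF : Module.finrank ℝ F = 2) {L : F →L[ℝ] F}
    (hL : IsInfinitesimalIsometry L) (hL0 : L ≠ 0) :
    ∃ (w v : F) (C : ℝ), (∀ x, ∃ p q : ℝ, x = p • w + q • v) ∧
      ∀ p q : ℝ, ‖p • w + q • v‖ ^ 2 = (p ^ 2 + q ^ 2) * C := by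
  obtain ⟨w, hw⟩ := exists_linearIndependent_apply hL hL0
  obtain ⟨a, b, v, hb, h1, h2⟩ := hL.exists_rotation hF hw
  have hw0 : 0 < ‖w‖ := norm_pos_iff.2 (hw.ne_zero 0)
  have hflow : ∀ t : ℝ, 0 ≤ t →
      ‖Real.exp (a * t) • (Real.cos (b * t) • w + Real.sin (b * t) • v)‖ = ‖w‖ := fun t ht => by
    have := hL.norm_eq_of_hasDerivAt
      (c := fun s => Real.exp (a * s) • (Real.cos (b * s) • w + Real.sin (b * s) • v))
      (fun s => ?_) ht
    · simpa using this
    · have hbs : HasDerivAt (fun s : ℝ => b * s) b s := by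
        simpa using (hasDerivAt_id s).const_mul b
      have has : HasDerivAt (fun s : ℝ => a * s) a s := by
        simpa using (hasDerivAt_id s).const_mul a
      refine (has.exp.smul ((hbs.cos.smul_const w).add (hbs.sin.smul_const v))).congr_deriv ?_
      simp only [map_smul, map_add, h1, h2, Pi.add_apply]
      module
  have ha : a = 0 := by
    have h3 := hflow (2 * Real.pi / b) (by positivity)
    rw [mul_div_cancel₀ _ hb.ne', Real.cos_two_pi, Real.sin_two_pi, one_smul, zero_smul, add_zero,
      norm_smul, Real.norm_of_nonneg (Real.exp_pos _).le] at h3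
    have h4 := Real.exp_eq_one_iff _ |>.1 (mul_right_cancel₀ hw0.ne' (h3.trans (one_mul _).symm))
    exact (mul_eq_zero.1 h4).resolve_right (by positivity)
  refine ⟨w, v, ‖w‖ ^ 2, fun x => ?_, fun p q => ?_⟩
  · obtain ⟨p, q, rfl⟩ := exists_eq_smul_add_smul hF hw x
    refine ⟨p + q * a, q * b, ?_⟩
    rw [h1]
    module
  · let z : ℂ := ⟨p, q⟩
    have hp : ‖z‖ * Real.cos z.arg = p := Complex.norm_mul_cos_arg z
    have hq : ‖z‖ * Real.sin z.arg = q := Complex.norm_mul_sin_arg z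
    have hz : ‖z‖ ^ 2 = p ^ 2 + q ^ 2 := by
      rw [Complex.sq_norm, Complex.normSq_mk]
      ring
    have h3 := hflow ((z.arg + 2 * Real.pi) / b)
      (div_nonneg (by linarith [Complex.neg_pi_lt_arg z, Real.pi_pos]) hb.le)
    rw [mul_div_cancel₀ _ hb.ne', Real.cos_add_two_pi, Real.sin_add_two_pi, ha, zero_mul,
      Real.exp_zero, one_smul] at h3
    rw [← hz, ← h3, ← mul_pow, ← norm_norm z, ← norm_smul, smul_add, smul_smul,
      smul_smul, hp, hq]

theorem IsInfinitesimalIsometry.parallelogram (hF : Module.finrank ℝ F = 2) {L : F →L[ℝ] F}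
    (hL : IsInfinitesimalIsometry L) (hL0 : L ≠ 0) (x y : F) :
    ‖x + y‖ ^ 2 + ‖x - y‖ ^ 2 = 2 * (‖x‖ ^ 2 + ‖y‖ ^ 2) := by
  obtain ⟨w, v, C, hspan, hC⟩ := hL.exists_norm_sq_eq hF hL0
  obtain ⟨p, q, rfl⟩ := hspan x
  obtain ⟨p', q', rfl⟩ := hspan y
  have h1 : p • w + q • v + (p' • w + q' • v) = (p + p') • w + (q + q') • v := by module
  have h2 : p • w + q • v - (p' • w + q' • v) = (p - p') • w + (q - q') • v := by module
  rw [h1, h2, hC, hC, hC, hC]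
  ring

end Rotation

section PlaneSections

theorem exists_submodule_between {K V : Type*} [Field K] [AddCommGroup V] [Module K V]
    [FiniteDimensional K V] {U W : Submodule K V} (hUW : U ≤ W) {k : ℕ}
    (hk : Module.finrank K U ≤ k) (hk' : k ≤ Module.finrank K W) :
    ∃ W' : Submodule K V, U ≤ W' ∧ W' ≤ W ∧ Module.finrank K W' = k := by
  induction k, hk using Nat.le_induction with
  | base => exact ⟨U, le_rfl, hUW, rfl⟩
  | succ k _ ih =>
    obtain ⟨W', h1, h2, h3⟩ := ih (by omega)
    have hlt : W' < W := lt_of_le_of_ne h2 fun h => by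
      rw [h] at h3
      omega
    obtain ⟨v, hv, hv'⟩ := SetLike.exists_of_lt hlt
    refine ⟨W' ⊔ Submodule.span K {v}, h1.trans le_sup_left,
      sup_le h2 ((Submodule.span_singleton_le_iff_mem v W).2 hv), ?_⟩
    rw [Submodule.finrank_sup_span_singleton hv', h3]

/-- A closed set which is not a neighbourhood of one of its points `y₀` has, arbitrarily close to
`y₀`, a point with a supporting linear functional for the contingent cone. -/
theorem exists_contingent_normal_of_inner {G : Type*} [NormedAddCommGroup G]
    [InnerProductSpace ℝ G] [FiniteDimensional ℝ G] {C U : Set G} (hC : IsClosed C)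
    (hU : IsOpen U) {y₀ : G} (hy₀ : y₀ ∈ C) (hy₀U : y₀ ∈ U) (hnot : C ∉ 𝓝 y₀) :
    ∃ y ∈ C ∩ U, ∃ (ℓ : G →L[ℝ] ℝ) (x : G), 0 < ℓ x ∧
      ∀ (t : ℕ → ℝ) (Y : ℕ → G) (Y₀ : G), (∀ j, 0 < t j) → Tendsto t atTop (𝓝 0) →
        Tendsto Y atTop (𝓝 Y₀) → (∀ᶠ j in atTop, y + t j • Y j ∈ C) → ℓ Y₀ ≤ 0 := by
  obtain ⟨ρ, hρ, hρU⟩ := Metric.isOpen_iff.1 hU y₀ hy₀U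
  obtain ⟨z, hz, hzC⟩ : ∃ z ∈ ball y₀ (ρ / 2), z ∉ C := by
    by_contra! h
    exact hnot (Filter.mem_of_superset (ball_mem_nhds y₀ (half_pos hρ)) h)
  have : ProperSpace G := FiniteDimensional.proper_real _
  obtain ⟨y, hy, hyz⟩ := hC.exists_infDist_eq_dist ⟨y₀, hy₀⟩ z
  have hmin : ∀ y' ∈ C, ‖z - y‖ ≤ ‖z - y'‖ := fun y' hy' => by
    rw [← dist_eq_norm, ← dist_eq_norm, ← hyz]
    exact infDist_le_dist_of_mem hy'
  have hyU : y ∈ U := hρU <| by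
    rw [mem_ball] at hz ⊢
    have h1 := hmin y₀ hy₀
    rw [← dist_eq_norm, ← dist_eq_norm] at h1
    linarith [dist_triangle_left y y₀ z]
  have hzy : z - y ≠ 0 := fun h => hzC (by rwa [sub_eq_zero.1 h])
  refine ⟨y, ⟨hy, hyU⟩, innerSL ℝ (z - y), z - y,
    by
      rw [innerSL_apply_apply, real_inner_self_eq_norm_sq]
      have := norm_pos_iff.2 hzy
      positivity,
    fun t Y Y₀ ht ht0 hY hmem => ?_⟩
  have hle : ∀ᶠ j in atTop, inner ℝ (z - y) (Y j) ≤ t j * ‖Y j‖ ^ 2 := by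
    filter_upwards [hmem] with j hj
    have h1 := hmin _ hj
    have h2 : z - (y + t j • Y j) = (z - y) - t j • Y j := by abel
    have h3 := norm_sub_sq_real (z - y) (t j • Y j)
    rw [← h2, inner_smul_right, norm_smul, Real.norm_of_nonneg (ht j).le] at h3
    have h4 : ‖z - y‖ ^ 2 ≤ ‖z - (y + t j • Y j)‖ ^ 2 := by gcongr
    have h5 : t j * (2 * inner ℝ (z - y) (Y j)) ≤ t j * (t j * ‖Y j‖ ^ 2) := by nlinarith
    have h6 := le_of_mul_le_mul_left h5 (ht j)
    have h7 : 0 ≤ t j * ‖Y j‖ ^ 2 := mul_nonneg (ht j).le (sq_nonneg _)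
    linarith
  have hl : Tendsto (fun j => inner ℝ (z - y) (Y j)) atTop (𝓝 (inner ℝ (z - y) Y₀)) :=
    tendsto_const_nhds.inner hY
  have hr : Tendsto (fun j => t j * ‖Y j‖ ^ 2) atTop (𝓝 0) := by
    simpa using ht0.mul (hY.norm.pow 2)
  exact le_of_tendsto_of_tendsto hl hr hle

theorem exists_contingent_normal {H : Type*} [NormedAddCommGroup H]
    [NormedSpace ℝ H] [FiniteDimensional ℝ H] {C U : Set H} (hC : IsClosed C)
    (hU : IsOpen U) {y₀ : H} (hy₀ : y₀ ∈ C) (hy₀U : y₀ ∈ U) (hnot : C ∉ 𝓝 y₀) :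
    ∃ y ∈ C ∩ U, ∃ (ℓ : H →L[ℝ] ℝ) (x : H), 0 < ℓ x ∧
      ∀ (t : ℕ → ℝ) (Y : ℕ → H) (Y₀ : H), (∀ j, 0 < t j) → Tendsto t atTop (𝓝 0) →
        Tendsto Y atTop (𝓝 Y₀) → (∀ᶠ j in atTop, y + t j • Y j ∈ C) → ℓ Y₀ ≤ 0 := by
  let e := toEuclidean (E := H)
  obtain ⟨y, ⟨hy, hyU⟩, ℓ, x, hx, h⟩ := exists_contingent_normal_of_inner
    (C := e.symm ⁻¹' C) (U := e.symm ⁻¹' U) (hC.preimage e.symm.continuous)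
    (hU.preimage e.symm.continuous) (y₀ := e y₀) (by simpa using hy₀) (by simpa using hy₀U)
    (fun hn => hnot (by simpa [preimage_preimage] using e.continuous.continuousAt hn))
  refine ⟨e.symm y, ⟨hy, hyU⟩, ℓ ∘L e, e.symm x, by simpa using hx,
    fun t Y Y₀ ht ht0 hY hmem => ?_⟩
  refine h t (e ∘ Y) (e Y₀) ht ht0 ((e.continuous.tendsto _).comp hY) ?_
  filter_upwards [hmem] with j hj
  simpa using hj

variable {F E : Type*} [NormedAddCommGroup F] [NormedSpace ℝ F]
  [NormedAddCommGroup E] [NormedSpace ℝ E]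

variable (F E) in
/-- The linear maps from `F` to `E` inducing on `F` a seminorm which is the pullback of the norm
of `F` under an endomorphism. -/
def pullbackMaps : Set (F →L[ℝ] E) :=
  {S | ∃ A : F →L[ℝ] F, ∀ w, ‖A w‖ = ‖S w‖}

theorem comp_mem_pullbackMaps {S : F →L[ℝ] E} (hS : S ∈ pullbackMaps F E) (B : F →L[ℝ] F) :
    S ∘L B ∈ pullbackMaps F E := by
  obtain ⟨A, hA⟩ := hS
  exact ⟨A ∘L B, fun w => hA (B w)⟩

theorem exists_tendsto_mem_pullbackMaps {V : Type*} [NormedAddCommGroup V] [NormedSpace ℝ V]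
    [FiniteDimensional ℝ V] (hV : ModelsSections V E) (T X : V →L[ℝ] E) (hT : ∀ w, ‖T w‖ = ‖w‖)
    (S : F →L[ℝ] V) (hS : T ∘L S ∈ pullbackMaps F E) :
    ∃ (t : ℕ → ℝ) (Y : ℕ → F →L[ℝ] E) (M : V →L[ℝ] V), (∀ j, 0 < t j) ∧
      Tendsto t atTop (𝓝 0) ∧ Tendsto Y atTop (𝓝 (X ∘L S - T ∘L M ∘L S)) ∧
      ∀ᶠ j in atTop, T ∘L S + t j • Y j ∈ pullbackMaps F E := by
  obtain ⟨t, A, M, ht, ht0, hA, hM⟩ := exists_tendsto_inv_smul_of_modelsSections hV T X hT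
  have : CompleteSpace V := FiniteDimensional.complete ℝ V
  obtain ⟨N, hN⟩ : ∃ N : ℕ → V →L[ℝ] V, N = fun j => (t j)⁻¹ • (A j - 1) := ⟨_, rfl⟩
  rw [← hN] at hM
  have hAN : ∀ j, A j = 1 + t j • N j := fun j => by
    rw [hN]
    simp only
    rw [smul_inv_smul₀ (ht j).ne']
    abel
  have hA1 : Tendsto A atTop (𝓝 1) := by
    have : Tendsto (fun j => 1 + t j • N j) atTop (𝓝 (1 + (0 : ℝ) • M)) :=
      (ht0.smul hM).const_add 1
    rw [zero_smul, add_zero] at this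
    exact this.congr fun j => (hAN j).symm
  have hunit : ∀ᶠ j in atTop, IsUnit (A j) :=
    hA1.eventually (Units.isOpen.mem_nhds isUnit_one)
  let g : ℕ → V →L[ℝ] V := fun j => Ring.inverse (A j)
  have hg1 : Tendsto g atTop (𝓝 1) := by
    have h1 := NormedRing.inverse_continuousAt (1 : (V →L[ℝ] V)ˣ)
    have h2 : Tendsto Ring.inverse (𝓝 (1 : V →L[ℝ] V)) (𝓝 1) := by
      simpa [ContinuousAt] using h1
    exact h2.comp hA1
  refine ⟨t, fun j => X ∘L g j ∘L S - T ∘L (g j * N j) ∘L S, M, ht, ht0, ?_, ?_⟩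
  · have hc1 : Continuous fun D : V →L[ℝ] V => T ∘L D ∘L S := by fun_prop
    have hc2 : Continuous fun D : V →L[ℝ] V => X ∘L D ∘L S := by fun_prop
    have h1 := (hc1.tendsto _).comp (hg1.mul hM)
    have h2 := (hc2.tendsto _).comp hg1
    rw [one_mul] at h1
    exact h2.sub h1
  · filter_upwards [hunit] with j hj
    have hAg : A j * g j = 1 := Ring.mul_inverse_cancel _ hj
    have hgA : g j * A j = 1 := Ring.inverse_mul_cancel _ hj
    have hg : ∀ v, g j v = v - t j • g j (N j v) := fun v => by
      have h1 : g j (A j v) = v := congrArg (fun D : V →L[ℝ] V => D v) hgA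
      rw [hAN j] at h1
      rw [eq_sub_iff_add_eq, ← map_smul, ← map_add]
      exact h1
    obtain ⟨B, hB⟩ := hS
    refine ⟨B, fun w => ?_⟩
    have h1 : (T ∘L S + t j • (X ∘L g j ∘L S - T ∘L (g j * N j) ∘L S)) w =
        (T + t j • X) (g j (S w)) := by
      have h2 : T (g j (S w)) = T (S w) - t j • T (g j (N j (S w))) := by
        rw [← map_smul, ← map_sub, ← hg]
      simp only [add_apply, smul_apply, ContinuousLinearMap.comp_apply, h2,
        sub_apply, mul_apply_eq_comp]
      module
    rw [h1, ← hA, hB]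
    have h3 : A j (g j (S w)) = S w := congrArg (fun D : V →L[ℝ] V => D (S w)) hAg
    rw [h3, ContinuousLinearMap.comp_apply, hT]

variable [FiniteDimensional ℝ F]

theorem isClosed_pullbackMaps : IsClosed (pullbackMaps F E) := by
  refine IsSeqClosed.isClosed fun S S₀ hS hlim => ?_
  choose A hA using hS
  obtain ⟨A₀, -, -, -, hA₀⟩ := exists_subseq_tendsto_of_norm_eq hlim hA
  exact ⟨A₀, hA₀⟩

/-- The coordinate functionals of a basis as continuous linear maps. -/
noncomputable def coordL (b : Module.Basis (Fin 2) ℝ F) (i : Fin 2) : F →L[ℝ] ℝ :=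
  LinearMap.toContinuousLinearMap (b.coord i)

@[simp]
theorem coordL_apply_self (b : Module.Basis (Fin 2) ℝ F) (i : Fin 2) : coordL b i (b i) = 1 := by
  simp [coordL]

theorem coordL_apply_of_ne (b : Module.Basis (Fin 2) ℝ F) {i j : Fin 2} (h : j ≠ i) :
    coordL b i (b j) = 0 := by
  simp [coordL, h]

theorem coordL_sum (b : Module.Basis (Fin 2) ℝ F) (w : F) :
    coordL b 0 w • b 0 + coordL b 1 w • b 1 = w := by
  have := b.sum_repr w
  rwa [Fin.sum_univ_two] at this

theorem eq_sum_smulRight (b : Module.Basis (Fin 2) ℝ F) (S : F →L[ℝ] E) :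
    S = (coordL b 0).smulRight (S (b 0)) + (coordL b 1).smulRight (S (b 1)) := by
  ext w
  conv_lhs => rw [← coordL_sum b w]
  simp

/-- The linear map sending the basis vectors to `x` and `y`. -/
noncomputable def pairMap (b : Module.Basis (Fin 2) ℝ F) (x y : E) : F →L[ℝ] E :=
  (coordL b 0).smulRight x + (coordL b 1).smulRight y

theorem pairMap_apply (b : Module.Basis (Fin 2) ℝ F) (x y : E) (w : F) :
    pairMap b x y w = coordL b 0 w • x + coordL b 1 w • y := rfl

theorem pairMap_self (b : Module.Basis (Fin 2) ℝ F) (S : F →L[ℝ] E) :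
    pairMap b (S (b 0)) (S (b 1)) = S :=
  (eq_sum_smulRight b S).symm

theorem continuous_pairMap (b : Module.Basis (Fin 2) ℝ F) (x : E) :
    Continuous fun y => pairMap b x y :=
  (ContinuousLinearMap.smulRightL ℝ F E (coordL b 1)).continuous.const_add _

theorem injective_pairMap (b : Module.Basis (Fin 2) ℝ F) {x y : E} (hx : x ≠ 0)
    (hy : y ∉ Submodule.span ℝ {x}) : Function.Injective (pairMap b x y) := by
  refine (injective_iff_map_eq_zero _).2 fun w hw => ?_
  rw [pairMap_apply] at hw
  have h1 : coordL b 1 w = 0 := by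
    by_contra h
    refine hy (Submodule.mem_span_singleton.2 ⟨-(coordL b 1 w)⁻¹ * coordL b 0 w, ?_⟩)
    rw [mul_smul, eq_neg_of_add_eq_zero_left hw, smul_neg, neg_smul, neg_neg, inv_smul_smul₀ h]
  rw [h1, zero_smul, add_zero, smul_eq_zero] at hw
  rw [← coordL_sum b w, h1, hw.resolve_right hx]
  simp

theorem pairMap_mem_pullbackMaps_swap {b : Module.Basis (Fin 2) ℝ F} {x y : E}
    (h : pairMap b x y ∈ pullbackMaps F E) : pairMap b y x ∈ pullbackMaps F E := by
  convert comp_mem_pullbackMaps h (pairMap b (b 1) (b 0)) using 1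
  ext w
  simp [pairMap_apply, coordL_apply_of_ne, add_comm]

theorem notMem_span_singleton_comm {x y : E} (hx : x ≠ 0) (hy : y ∉ Submodule.span ℝ {x}) :
    x ∉ Submodule.span ℝ {y} := fun h => by
  obtain ⟨r, rfl⟩ := Submodule.mem_span_singleton.1 h
  have hr : r ≠ 0 := by
    rintro rfl
    simp at hx
  exact hy (Submodule.mem_span_singleton.2 ⟨r⁻¹, inv_smul_smul₀ hr y⟩)

theorem exists_notMem_span_pair (hE : 3 ≤ Module.finrank ℝ E) (x y : E) :
    ∃ z, z ∉ Submodule.span ℝ {x} ∧ z ∉ Submodule.span ℝ {y} := by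
  have h1 : Submodule.span ℝ {x, y} ≠ ⊤ := fun h => by
    have h2 : Module.finrank ℝ (Submodule.span ℝ ({x, y} : Set E)) ≤ 2 := by
      classical
      have := finrank_span_finset_le_card (R := ℝ) ({x, y} : Finset E)
      rw [Finset.coe_pair] at this
      exact this.trans Finset.card_le_two
    rw [h, finrank_top] at h2
    omega
  obtain ⟨z, -, hz⟩ := SetLike.exists_of_lt (lt_top_iff_ne_top.2 h1)
  exact ⟨z, fun h => hz (Submodule.span_mono (by simp) h),
    fun h => hz (Submodule.span_mono (by simp) h)⟩

variable [FiniteDimensional ℝ E]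

/-- A functional which vanishes on the maps `S ∘ A` with `S` injective on a plane vanishes on all
maps with values in a suitable subspace of codimension two containing the range of `S`. -/
theorem exists_submodule_forall_apply_eq_zero {n : ℕ} (hn : 2 ≤ n)
    (hE : Module.finrank ℝ E = n + 2) (hF : Module.finrank ℝ F = 2) {S : F →L[ℝ] E}
    (ℓ : (F →L[ℝ] E) →L[ℝ] ℝ) (hℓ : ∀ A : F →L[ℝ] F, ℓ (S ∘L A) = 0) :
    ∃ W : Submodule ℝ E, Module.finrank ℝ W = n ∧ (∀ w, S w ∈ W) ∧
      ∀ Y : F →L[ℝ] E, (∀ w, Y w ∈ W) → ℓ Y = 0 := by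
  let b : Module.Basis (Fin 2) ℝ F := Module.finBasisOfFinrankEq ℝ F hF
  let Λ : E →ₗ[ℝ] (Fin 2 → ℝ) := LinearMap.pi fun i =>
    (ℓ : (F →L[ℝ] E) →ₗ[ℝ] ℝ) ∘ₗ (coordL b i).smulRightₗ
  have hΛ : ∀ z i, Λ z i = ℓ ((coordL b i).smulRight z) := fun z i => rfl
  have hrange : LinearMap.range (S : F →ₗ[ℝ] E) ≤ LinearMap.ker Λ := by
    rintro _ ⟨v, rfl⟩
    ext i
    rw [hΛ]
    have : (coordL b i).smulRight (S v) = S ∘L (coordL b i).smulRight v := by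
      ext
      simp
    exact (congrArg ℓ this).trans (hℓ _)
  have hker : n ≤ Module.finrank ℝ (LinearMap.ker Λ) := by
    have h1 := Λ.finrank_range_add_finrank_ker
    have h2 := Submodule.finrank_le (LinearMap.range Λ)
    rw [Module.finrank_fin_fun] at h2
    omega
  obtain ⟨W, h1, h2, h3⟩ := exists_submodule_between hrange (k := n)
    ((LinearMap.finrank_range_le _).trans (hF ▸ hn)) hker
  refine ⟨W, h3, fun w => h1 ⟨w, rfl⟩, fun Y hY => ?_⟩
  have h4 : ∀ w i, ℓ ((coordL b i).smulRight (Y w)) = 0 := fun w i => by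
    rw [← hΛ, LinearMap.mem_ker.1 (h2 (hY w))]
    rfl
  rw [eq_sum_smulRight b Y, map_add, h4, h4, add_zero]

theorem pullbackMaps_mem_nhds {n : ℕ} (hn : 2 ≤ n) (hE : Module.finrank ℝ E = n + 2)
    (hW : ∀ W : Submodule ℝ E, Module.finrank ℝ W = n → ModelsSections W E)
    (hF : Module.finrank ℝ F = 2) {S₀ : F →L[ℝ] E} (hS₀ : S₀ ∈ pullbackMaps F E)
    (hinj : Function.Injective S₀) : pullbackMaps F E ∈ 𝓝 S₀ := by
  by_contra hnot
  obtain ⟨S, ⟨hS, hSinj⟩, ℓ, X₀, hX₀, hcone⟩ := exists_contingent_normal isClosed_pullbackMaps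
    (ContinuousLinearMap.isOpen_injective (𝕜 := ℝ)) hS₀ hinj hnot
  have hconst : ∀ A : F →L[ℝ] F, ℓ (S ∘L A) ≤ 0 := fun A => by
    refine hcone (fun j => 1 / ((j : ℝ) + 1)) (fun _ => S ∘L A) _ (fun j => by positivity)
      tendsto_one_div_add_atTop_nhds_zero_nat tendsto_const_nhds (Eventually.of_forall fun j => ?_)
    convert comp_mem_pullbackMaps hS (1 + (1 / ((j : ℝ) + 1)) • A) using 1
    ext w
    simp
  have hzero : ∀ A : F →L[ℝ] F, ℓ (S ∘L A) = 0 := fun A => by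
    refine le_antisymm (hconst A) ?_
    have := hconst (-A)
    rw [ContinuousLinearMap.comp_neg, map_neg] at this
    linarith
  obtain ⟨W, hWn, hSW, hℓW⟩ := exists_submodule_forall_apply_eq_zero hn hE hF ℓ hzero
  let S' : F →L[ℝ] W := S.codRestrict W hSW
  have hS'inj : LinearMap.ker (S' : F →ₗ[ℝ] W) = ⊥ := LinearMap.ker_eq_bot.2 fun x y h =>
    hSinj (congrArg Subtype.val h)
  obtain ⟨R, hR⟩ := LinearMap.exists_leftInverse_of_injective _ hS'inj
  let X : W →L[ℝ] E := X₀ ∘L LinearMap.toContinuousLinearMap R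
  have hXS' : X ∘L S' = X₀ := by
    ext w
    exact congrArg X₀ (LinearMap.congr_fun hR w)
  obtain ⟨t, Y, M, ht, ht0, hY, hmem⟩ := exists_tendsto_mem_pullbackMaps (hW W hWn) W.subtypeL X
    (fun w => rfl) S' hS
  have hle := hcone t _ _ ht ht0 hY hmem
  rw [hXS', map_sub, hℓW (W.subtypeL ∘L M ∘L S') fun w => (M (S' w)).2] at hle
  linarith

theorem isConnected_compl_span_singleton (hE : 3 ≤ Module.finrank ℝ E) (x : E) :
    IsConnected ((Submodule.span ℝ {x} : Submodule ℝ E)ᶜ : Set E) := by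
  refine isConnected_compl_of_one_lt_codim ?_
  have h1 := Submodule.finrank_quotient_add_finrank (Submodule.span ℝ {x})
  have h2 : Module.finrank ℝ (Submodule.span ℝ {x}) ≤ 1 := by
    simpa using finrank_span_le_card (R := ℝ) ({x} : Set E)
  rw [← Module.finrank_eq_rank]
  norm_cast
  omega

/-- If all sections of dimension `n ≥ 2` of a space of dimension `n + 2` are isometric, then so
are all sections of dimension two. -/
theorem modelsSections_of_finrank_eq_two {n : ℕ} (hn : 2 ≤ n)
    (hE : Module.finrank ℝ E = n + 2)
    (hW : ∀ W : Submodule ℝ E, Module.finrank ℝ W = n → ModelsSections W E)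
    (hF : Module.finrank ℝ F = 2) (T : F →L[ℝ] E) (hT : ∀ w, ‖T w‖ = ‖w‖) :
    ModelsSections F E := by
  have hE3 : 3 ≤ Module.finrank ℝ E := by omega
  let b : Module.Basis (Fin 2) ℝ F := Module.finBasisOfFinrankEq ℝ F hF
  have hmove : ∀ x y y' : E, x ≠ 0 → y ∉ Submodule.span ℝ {x} → y' ∉ Submodule.span ℝ {x} →
      pairMap b x y ∈ pullbackMaps F E → pairMap b x y' ∈ pullbackMaps F E := by
    intro x y y' hx hy hy' h
    let 𝒢 : Set E := {z | pairMap b x z ∈ pullbackMaps F E}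
    have hclosed : IsClosed 𝒢 := isClosed_pullbackMaps.preimage (continuous_pairMap b x)
    have hnhds : ∀ z ∈ 𝒢, z ∉ Submodule.span ℝ {x} → z ∈ interior 𝒢 := fun z hz hzx =>
      mem_interior_iff_mem_nhds.2 ((continuous_pairMap b x).continuousAt
        (pullbackMaps_mem_nhds hn hE hW hF hz (injective_pairMap b hx hzx)))
    have hsub := (isConnected_compl_span_singleton hE3 x).isPreconnected
      |>.subset_of_closure_inter_subset (isOpen_interior (s := 𝒢)) ⟨y, hy, hnhds y h hy⟩
        fun z hz => hnhds z (closure_minimal interior_subset hclosed hz.1) hz.2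
    exact interior_subset (s := 𝒢) (hsub hy')
  have hne : ∀ S : F →L[ℝ] E, Function.Injective S → S (b 0) ≠ 0 ∧
      S (b 1) ∉ Submodule.span ℝ {S (b 0)} := fun S hS => by
    have h0 : S (b 0) ≠ 0 := fun h => b.ne_zero 0 (hS (h.trans (map_zero S).symm))
    refine ⟨h0, fun h => ?_⟩
    obtain ⟨r, hr⟩ := Submodule.mem_span_singleton.1 h
    rw [← map_smul] at hr
    have := congrArg (coordL b 1) (hS hr)
    rw [map_smul, coordL_apply_of_ne b (by decide), coordL_apply_self] at this
    simp at this
  intro S hS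
  obtain ⟨hx, hy⟩ := hne S hS
  obtain ⟨hx₀, hy₀⟩ := hne T (injective_of_norm_eq hT)
  obtain ⟨z, hz₀, hz⟩ := exists_notMem_span_pair hE3 (T (b 0)) (S (b 0))
  have hz0 : z ≠ 0 := fun h => hz (h ▸ Submodule.zero_mem _)
  have hT' : pairMap b (T (b 0)) (T (b 1)) ∈ pullbackMaps F E := by
    rw [pairMap_self]
    exact ⟨1, fun w => (hT w).symm⟩
  have h1 := pairMap_mem_pullbackMaps_swap (hmove _ _ z hx₀ hy₀ hz₀ hT')
  have h2 := pairMap_mem_pullbackMaps_swap (hmove _ _ (S (b 0)) hz0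
    (notMem_span_singleton_comm hx₀ hz₀) (notMem_span_singleton_comm hx hz) h1)
  have h3 := hmove _ _ _ hx hz hy h2
  rwa [pairMap_self] at h3

end PlaneSections

section TangentialProjection

open MeasureTheory

variable {F E : Type*} [NormedAddCommGroup F] [NormedSpace ℝ F]
  [NormedAddCommGroup E] [NormedSpace ℝ E]

theorem norm_le_norm_add_smul_of_hasFDerivAt {x u : E} {D : E →L[ℝ] ℝ}
    (hD : HasFDerivAt (fun x : E => ‖x‖) D x) (hu : D u = 0) (s : ℝ) : ‖x‖ ≤ ‖x + s • u‖ := by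
  have key : ∀ v : E, D v = 0 → ∀ r : ℝ, 0 < r → ‖x‖ ≤ ‖x + r • v‖ := fun v hv r hr => by
    let t : ℕ → ℝ := fun j => 1 / ((j : ℝ) + 1)
    have ht : ∀ j, 0 < t j := fun j => by positivity
    have ht0 : Tendsto t atTop (𝓝 0) := tendsto_one_div_add_atTop_nhds_zero_nat
    have hd0 : Tendsto (fun j => t j • v) atTop (𝓝 0) := by
      simpa using ht0.smul_const v
    have hlim := (hD.hasFDerivWithinAt (s := univ)).lim (c := fun j => (t j)⁻¹)
      (d := fun j => t j • v) (v := v) hd0 (by simp)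
      (tendsto_const_nhds.congr fun j => (inv_smul_smul₀ (ht j).ne' v).symm)
    rw [hv] at hlim
    refine norm_le_norm_add_smul_of_le_norm_add ht ht0 tendsto_const_nhds
      (ε := fun j => -((t j)⁻¹ * (‖x + t j • v‖ - ‖x‖))) (by simpa using hlim.neg)
      (fun j => ?_) hr
    rw [mul_neg, mul_inv_cancel_left₀ (ht j).ne']
    linarith
  rcases lt_trichotomy s 0 with hs | rfl | hs
  · simpa using key (-u) (by simp [hu]) (-s) (by linarith)
  · simp
  · exact key u hu s hs

theorem hasFDerivAt_apply_eq_of_tendsto {T X : F →L[ℝ] E} (hT : ∀ w, ‖T w‖ = ‖w‖) {t : ℕ → ℝ}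
    {A : ℕ → F →L[ℝ] F} {M : F →L[ℝ] F} (ht : ∀ j, 0 < t j) (ht0 : Tendsto t atTop (𝓝 0))
    (hA : ∀ j w, ‖A j w‖ = ‖(T + t j • X) w‖)
    (hM : Tendsto (fun j => (t j)⁻¹ • (A j - 1)) atTop (𝓝 M)) {w : F} {D : E →L[ℝ] ℝ}
    (hD : HasFDerivAt (fun x : E => ‖x‖) D (T w)) : D (X w) = D (T (M w)) := by
  have h1 := (hD.hasFDerivWithinAt (s := univ)).lim (c := fun j => (t j)⁻¹)
    (d := fun j => t j • X w) (v := X w) (by simpa using ht0.smul_const (X w)) (by simp)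
    (tendsto_const_nhds.congr fun j => (inv_smul_smul₀ (ht j).ne' _).symm)
  have hAw : Tendsto (fun j => ((t j)⁻¹ • (A j - 1)) w) atTop (𝓝 (M w)) :=
    tendsto_clm_apply hM tendsto_const_nhds
  have hTA : Tendsto (fun j => T (((t j)⁻¹ • (A j - 1)) w)) atTop (𝓝 (T (M w))) :=
    tendsto_clm_apply tendsto_const_nhds hAw
  have heq : ∀ j, (t j)⁻¹ • T (A j w - w) = T (((t j)⁻¹ • (A j - 1)) w) := fun j => by
    simp
  have hd : Tendsto (fun j => T (A j w - w)) atTop (𝓝 0) := by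
    have := ht0.smul hTA
    rw [zero_smul] at this
    refine this.congr fun j => ?_
    rw [← heq, smul_inv_smul₀ (ht j).ne']
  have h2 := (hD.hasFDerivWithinAt (s := univ)).lim (c := fun j => (t j)⁻¹)
    (d := fun j => T (A j w - w)) (v := T (M w)) hd (by simp) (hTA.congr fun j => (heq j).symm)
  refine tendsto_nhds_unique h1 (h2.congr fun j => ?_)
  have h3 : T w + T (A j w - w) = T (A j w) := by
    rw [← map_add]
    congr 1
    abel
  simp only [h3, hT, hA]
  simp

theorem exists_basis_apply_zero_eq (hF : Module.finrank ℝ F = 2) {u : F} (hu : u ≠ 0) :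
    ∃ b : Module.Basis (Fin 2) ℝ F, b 0 = u := by
  have h1 : Submodule.span ℝ {u} ≠ ⊤ := fun h => by
    have h2 := finrank_span_singleton (K := ℝ) hu
    rw [h, finrank_top] at h2
    omega
  obtain ⟨v, -, hv⟩ := SetLike.exists_of_lt (lt_top_iff_ne_top.2 h1)
  have hli : LinearIndependent ℝ ![u, v] := (LinearIndependent.pair_iff' hu).2 fun r h =>
    hv (Submodule.mem_span_singleton.2 ⟨r, h⟩)
  refine ⟨basisOfLinearIndependentOfCardEqFinrank hli (by simp [hF]), ?_⟩
  simp

variable [FiniteDimensional ℝ F]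

theorem exists_eq_smul_of_coordL_mul_eq (b : Module.Basis (Fin 2) ℝ F) {u v : F} (hu : u ≠ 0)
    (h : coordL b 0 u * coordL b 1 v = coordL b 1 u * coordL b 0 v) : ∃ r : ℝ, v = r • u := by
  have hu' := coordL_sum b u
  have hv' := coordL_sum b v
  generalize coordL b 0 u = p, coordL b 1 u = q, coordL b 0 v = p', coordL b 1 v = q' at *
  rcases eq_or_ne p 0 with rfl | hp
  · have hq : q ≠ 0 := by
      rintro rfl
      exact hu (by rw [← hu']; simp)
    have hp' : p' = 0 := by
      rw [zero_mul] at h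
      exact (mul_eq_zero.1 h.symm).resolve_left hq
    refine ⟨q' / q, ?_⟩
    rw [← hu', ← hv', hp', zero_smul, zero_add, zero_add, smul_smul,
      div_mul_cancel₀ _ hq]
  · refine ⟨p' / p, ?_⟩
    rw [← hu', ← hv', smul_add, smul_smul, smul_smul, div_mul_cancel₀ _ hp]
    congr 2
    field_simp
    linarith

/-- Continuity of the determinant of `w, V w` forces an eigenvector of an even map `V`. -/
theorem exists_apply_eq_smul_of_even (hF : Module.finrank ℝ F = 2) {V : F → F}
    (hV : Continuous V) (heven : ∀ w, V (-w) = V w) : ∃ u ≠ 0, ∃ r : ℝ, V u = r • u := by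
  let b : Module.Basis (Fin 2) ℝ F := Module.finBasisOfFinrankEq ℝ F hF
  let d : F → ℝ := fun w => coordL b 0 w * coordL b 1 (V w) - coordL b 1 w * coordL b 0 (V w)
  have hd : Continuous d := by fun_prop
  have hodd : ∀ w, d (-w) = -d w := fun w => by
    simp only [d, heven, map_neg]
    ring
  let c : ℝ → F := fun s => Real.cos s • b 0 + Real.sin s • b 1
  have hc : Continuous c := by fun_prop
  have hc0 : ∀ s, c s ≠ 0 := fun s h => by
    have h0 : coordL b 0 (c s) = Real.cos s := by
      simp [c, coordL_apply_of_ne]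
    have h1 : coordL b 1 (c s) = Real.sin s := by
      simp [c, coordL_apply_of_ne]
    have := Real.sin_sq_add_cos_sq s
    rw [← h0, ← h1, h] at this
    simp at this
  have hπ : c Real.pi = -c 0 := by simp [c]
  have h0 : (0 : ℝ) ∈ uIcc (d (c 0)) (d (c Real.pi)) := by
    rw [hπ, hodd, mem_uIcc]
    rcases le_total 0 (d (c 0)) with h | h
    · exact Or.inr ⟨by linarith, h⟩
    · exact Or.inl ⟨h, by linarith⟩
  obtain ⟨s, -, hs⟩ := intermediate_value_uIcc (hd.comp hc).continuousOn h0
  exact ⟨c s, hc0 s, exists_eq_smul_of_coordL_mul_eq b (hc0 s) (sub_eq_zero.1 hs)⟩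

/-- On a plane without infinitesimal isometries, a quadratic vector field tangent to the unit
circle vanishes. -/
theorem quadratic_eq_zero_of_norm_le (hF : Module.finrank ℝ F = 2)
    (hrigid : ∀ Z : F →L[ℝ] F, IsInfinitesimalIsometry Z → Z = 0) (Q : F →L[ℝ] F →L[ℝ] F)
    (hQ : ∀ w (s : ℝ), ‖w‖ ≤ ‖w + s • Q w w‖) (w : F) : Q w w = 0 := by
  obtain ⟨u, hu, r, hr⟩ := exists_apply_eq_smul_of_even hF (V := fun w => Q w w) (by fun_prop)
    (by simp)
  have hQu : Q u u = 0 := by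
    rcases eq_or_ne r 0 with rfl | hr0
    · simpa using hr
    · have := hQ u (-r⁻¹)
      rw [hr, smul_smul, neg_mul, inv_mul_cancel₀ hr0, neg_one_smul, add_neg_cancel,
        norm_zero] at this
      exact absurd (norm_le_zero_iff.1 this) hu
  obtain ⟨b, rfl⟩ := exists_basis_apply_zero_eq hF hu
  let L : F →L[ℝ] F := pairMap b (Q (b 0) (b 1) + Q (b 1) (b 0)) (Q (b 1) (b 1))
  have hL : ∀ w, Q w w = coordL b 1 w • L w := fun w => by
    have h1 : Q w w = Q (coordL b 0 w • b 0 + coordL b 1 w • b 1)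
      (coordL b 0 w • b 0 + coordL b 1 w • b 1) := by rw [coordL_sum]
    rw [h1]
    simp only [map_add, map_smul, add_apply, smul_apply, hQu, L, pairMap_apply]
    module
  have hne : ∀ w, coordL b 1 w ≠ 0 → ∀ s : ℝ, ‖w‖ ≤ ‖w + s • L w‖ := fun w hw s => by
    have := hQ w (s * (coordL b 1 w)⁻¹)
    rwa [hL, smul_smul, inv_mul_cancel_right₀ hw] at this
  have hL0 : L = 0 := hrigid L fun w s => by
    by_cases hw : coordL b 1 w = 0
    · have hlim : Tendsto (fun j : ℕ => w + (1 / ((j : ℝ) + 1)) • b 1) atTop (𝓝 w) := by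
        simpa using ((tendsto_one_div_add_atTop_nhds_zero_nat (𝕜 := ℝ)).smul_const (b 1)).const_add w
      refine le_of_tendsto_of_tendsto' hlim.norm
        ((hlim.add ((tendsto_clm_apply (tendsto_const_nhds (x := L)) hlim).const_smul s)).norm)
        fun j => hne _ ?_ s
      rw [map_add, hw, map_smul, coordL_apply_self]
      simp only [smul_eq_mul, zero_add, mul_one]
      positivity
    · exact hne w hw s
  rw [hL, hL0]
  simp

/-- The vector `S c` is a projection of `ν` to the range of `S` along all supporting hyperplanes
of the unit ball at points of this range. -/
def IsTangentialProjection (S : F →L[ℝ] E) (ν : E) (c : F) : Prop :=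
  ∀ (w : F) (r : ℝ), ‖S w‖ ≤ ‖S w + r • (ν - S c)‖

theorem exists_isTangentialProjection_of_isometry (hF : Module.finrank ℝ F = 2)
    (hrigid : ∀ Z : F →L[ℝ] F, IsInfinitesimalIsometry Z → Z = 0) (hM : ModelsSections F E)
    {T : F →L[ℝ] E} (hT : ∀ w, ‖T w‖ = ‖w‖)
    (hdense : Dense {w | DifferentiableAt ℝ (fun x : E => ‖x‖) (T w)}) (ν : E) :
    ∃ c, IsTangentialProjection T ν c := by
  let b : Module.Basis (Fin 2) ℝ F := Module.finBasisOfFinrankEq ℝ F hF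
  have hex : ∀ i : Fin 2, ∃ M : F →L[ℝ] F, ∀ w (D : E →L[ℝ] ℝ),
      HasFDerivAt (fun x : E => ‖x‖) D (T w) → coordL b i w * D ν = D (T (M w)) := fun i => by
    obtain ⟨t, A, M, ht, ht0, hA, hlim⟩ :=
      exists_tendsto_inv_smul_of_modelsSections hM T ((coordL b i).smulRight ν) hT
    refine ⟨M, fun w D hD => ?_⟩
    simpa using hasFDerivAt_apply_eq_of_tendsto hT ht ht0 hA hlim hD
  choose M hMD using hex
  have hext : ∀ V : F → F, Continuous V → (∀ w (D : E →L[ℝ] ℝ),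
      HasFDerivAt (fun x : E => ‖x‖) D (T w) → D (T (V w)) = 0) →
      ∀ w (s : ℝ), ‖w‖ ≤ ‖w + s • V w‖ := fun V hV hD w s => by
    have hclosed : IsClosed {w | ‖w‖ ≤ ‖w + s • V w‖} := isClosed_le (by fun_prop) (by fun_prop)
    refine (hclosed.closure_subset_iff.2 ?_) (hdense w)
    intro w hw
    have := norm_le_norm_add_smul_of_hasFDerivAt hw.hasFDerivAt (hD w _ hw.hasFDerivAt) s
    rwa [← map_smul, ← map_add, hT, hT] at this
  let Q : F →L[ℝ] F →L[ℝ] F := (coordL b 1).smulRight (M 0) - (coordL b 0).smulRight (M 1)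
  have hQ : ∀ w, Q w w = coordL b 1 w • M 0 w - coordL b 0 w • M 1 w := fun w => by
    simp [Q]
  have hQ0 : ∀ w, coordL b 1 w • M 0 w = coordL b 0 w • M 1 w := fun w => by
    have := quadratic_eq_zero_of_norm_le hF hrigid Q (hext (fun w => Q w w) (by fun_prop) ?_) w
    · rw [hQ] at this
      exact sub_eq_zero.1 this
    · intro w D hD
      rw [hQ, map_sub, map_smul, map_smul, map_sub, map_smul, map_smul, ← hMD 0 w D hD,
        ← hMD 1 w D hD]
      simp only [smul_eq_mul]
      ring
  have h01 : coordL b 0 (b 1) = 0 := coordL_apply_of_ne b (by decide)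
  have h10 : coordL b 1 (b 0) = 0 := coordL_apply_of_ne b (by decide)
  have hM10 : M 1 (b 0) = 0 := by simpa [h10] using (hQ0 (b 0)).symm
  have hM01 : M 0 (b 1) = 0 := by simpa [h01] using hQ0 (b 1)
  have hM11 : M 0 (b 0) = M 1 (b 1) := by simpa [h01, h10, hM10, hM01] using hQ0 (b 0 + b 1)
  have hMc : ∀ i w, M i w = coordL b i w • M 0 (b 0) := fun i w => by
    rw [eq_sum_smulRight b (M i)]
    fin_cases i
    · simp [hM01]
    · simp [hM10, hM11]
  refine ⟨M 0 (b 0), fun w r => ?_⟩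
  have hclosed : IsClosed {w | ‖T w‖ ≤ ‖T w + r • (ν - T (M 0 (b 0)))‖} :=
    isClosed_le (by fun_prop) (by fun_prop)
  refine (hclosed.closure_subset_iff.2 ?_) (hdense w)
  intro w hw
  rcases eq_or_ne w 0 with rfl | hw0
  · simp
  refine norm_le_norm_add_smul_of_hasFDerivAt hw.hasFDerivAt ?_ r
  have hD : ∀ i, coordL b i w * fderiv ℝ (fun x : E => ‖x‖) (T w) (ν - T (M 0 (b 0))) = 0 :=
    fun i => by
      rw [map_sub, mul_sub, hMD i w _ hw.hasFDerivAt, hMc, map_smul, map_smul, smul_eq_mul,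
        sub_self]
  by_contra hne
  refine hw0 ?_
  rw [← coordL_sum b w, (mul_eq_zero.1 (hD 0)).resolve_right hne,
    (mul_eq_zero.1 (hD 1)).resolve_right hne]
  simp

theorem exists_isTangentialProjection_of_dense (hF : Module.finrank ℝ F = 2)
    (hrigid : ∀ Z : F →L[ℝ] F, IsInfinitesimalIsometry Z → Z = 0) (hM : ModelsSections F E)
    {S : F →L[ℝ] E} (hS : Function.Injective S)
    (hdense : Dense {w | DifferentiableAt ℝ (fun x : E => ‖x‖) (S w)}) (ν : E) :
    ∃ c, IsTangentialProjection S ν c := by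
  obtain ⟨A, hA⟩ := hM S hS
  have hAinj : Function.Injective A := (injective_iff_map_eq_zero A).2 fun w hw => by
    refine hS ?_
    rw [map_zero, ← norm_eq_zero, ← hA, hw, norm_zero]
  obtain ⟨B, hBA, hAB⟩ := exists_inverse_of_injective hAinj
  have hBA' : ∀ w, B (A w) = w := fun w => congrArg (fun D : F →L[ℝ] F => D w) hBA
  have hAB' : ∀ w, A (B w) = w := fun w => congrArg (fun D : F →L[ℝ] F => D w) hAB
  have hopen : IsOpenMap B := by
    have : CompleteSpace F := FiniteDimensional.complete ℝ F
    exact B.isOpenMap fun w => ⟨A w, hBA' w⟩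
  obtain ⟨c, hc⟩ := exists_isTangentialProjection_of_isometry hF hrigid hM (T := S ∘L B)
    (fun w => by rw [ContinuousLinearMap.comp_apply, ← hA, hAB']) (hdense.preimage hopen) ν
  refine ⟨B c, fun w r => ?_⟩
  simpa [hBA'] using hc (A w) r

theorem exists_subseq_isTangentialProjection {S : ℕ → F →L[ℝ] E} {S₀ : F →L[ℝ] E}
    (hS₀ : Function.Injective S₀) (hlim : Tendsto S atTop (𝓝 S₀)) {ν : E} {c : ℕ → F}
    (hc : ∀ j, IsTangentialProjection (S j) ν (c j)) :
    ∃ (c₀ : F) (φ : ℕ → ℕ), StrictMono φ ∧ Tendsto (c ∘ φ) atTop (𝓝 c₀) ∧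
      IsTangentialProjection S₀ ν c₀ := by
  obtain ⟨K, hK, hanti⟩ := LinearMap.exists_antilipschitzWith (S₀ : F →ₗ[ℝ] E)
    (LinearMap.ker_eq_bot.2 hS₀)
  have hK' : ∀ w, ‖w‖ ≤ K * ‖S₀ w‖ := fun w => hanti.le_mul_norm (map_zero _) w
  have hdiff : Tendsto (fun j => K * ‖S j - S₀‖) atTop (𝓝 0) := by
    simpa using (tendsto_iff_norm_sub_tendsto_zero.1 hlim).const_mul (K : ℝ)
  have hbdd : ∀ᶠ j in atTop, c j ∈ closedBall (0 : F) (2 * (K * ‖ν‖)) := by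
    filter_upwards [hdiff.eventually_lt_const (show (0 : ℝ) < 1 / 2 by norm_num)] with j hj
    rw [mem_closedBall_zero_iff]
    have h1 : ‖S j (c j)‖ ≤ ‖ν‖ := by simpa using hc j (c j) 1
    have h2 : ‖S₀ (c j)‖ ≤ ‖ν‖ + ‖S j - S₀‖ * ‖c j‖ := by
      have h3 := (S j - S₀).le_opNorm (c j)
      have h4 : S₀ (c j) = S j (c j) - (S j - S₀) (c j) := by simp
      rw [h4]
      exact (norm_sub_le _ _).trans (add_le_add h1 h3)
    have h5 := (hK' (c j)).trans (mul_le_mul_of_nonneg_left h2 K.2)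
    nlinarith [norm_nonneg (c j)]
  have : ProperSpace F := FiniteDimensional.proper_real F
  obtain ⟨c₀, -, φ, hφ, hc₀⟩ := tendsto_subseq_of_frequently_bounded isBounded_closedBall
    hbdd.frequently
  refine ⟨c₀, φ, hφ, hc₀, fun w r => ?_⟩
  have hSφ := hlim.comp hφ.tendsto_atTop
  have h1 := tendsto_clm_apply hSφ (tendsto_const_nhds (x := w))
  have h2 := tendsto_clm_apply hSφ hc₀
  exact le_of_tendsto_of_tendsto' h1.norm
    (h1.add ((tendsto_const_nhds.sub h2).const_smul r)).norm fun j => hc (φ j) w r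

theorem dense_setOf_dense_differentiableAt_norm [Nontrivial F] [FiniteDimensional ℝ E] :
    Dense {S : F →L[ℝ] E | Dense {w | DifferentiableAt ℝ (fun x : E => ‖x‖) (S w)}} := by
  borelize F
  borelize E
  borelize (F →L[ℝ] E)
  have : ProperSpace (F →L[ℝ] E) := FiniteDimensional.proper_real _
  have : ProperSpace F := FiniteDimensional.proper_real _
  have : ProperSpace E := FiniteDimensional.proper_real _
  have hmeas : MeasurableSet {x : E | DifferentiableAt ℝ (fun x : E => ‖x‖) x} :=
    measurableSet_of_differentiableAt ℝ _
  have h1 : ∀ᵐ w ∂(Measure.addHaar : Measure F), ∀ᵐ S ∂(Measure.addHaar : Measure (F →L[ℝ] E)),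
      DifferentiableAt ℝ (fun x : E => ‖x‖) (S w) := by
    filter_upwards [Measure.ae_ne Measure.addHaar (0 : F)] with w hw
    have hsurj : Function.Surjective (ContinuousLinearMap.apply ℝ E w : (F →L[ℝ] E) →ₗ[ℝ] E) := by
      intro x
      obtain ⟨f, hf⟩ := SeparatingDual.exists_eq_one (R := ℝ) hw
      exact ⟨f.smulRight x, by simp [hf]⟩
    exact (ae_comp_linearMap_mem_iff _ Measure.addHaar (Measure.addHaar : Measure E) hsurj
      hmeas).2 ae_differentiableAt_norm
  rw [Measure.ae_ae_comm] at h1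
  · exact Measure.dense_of_ae (h1.mono fun S hS => Measure.dense_of_ae hS)
  · have : Continuous fun p : F × (F →L[ℝ] E) => p.2 p.1 := by fun_prop
    exact this.measurable hmeas

theorem exists_isTangentialProjection [FiniteDimensional ℝ E] (hF : Module.finrank ℝ F = 2)
    (hrigid : ∀ Z : F →L[ℝ] F, IsInfinitesimalIsometry Z → Z = 0) (hM : ModelsSections F E)
    {S : F →L[ℝ] E} (hS : Function.Injective S) (ν : E) :
    ∃ c, IsTangentialProjection S ν c := by
  have : Nontrivial F := Module.nontrivial_of_finrank_pos (R := ℝ) (by omega)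
  have hmem := dense_setOf_dense_differentiableAt_norm.open_subset_closure_inter
    (ContinuousLinearMap.isOpen_injective (𝕜 := ℝ) (E := F) (F := E)) hS
  obtain ⟨S', hS', hlim⟩ := mem_closure_iff_seq_limit.1 hmem
  choose c hc using fun j =>
    exists_isTangentialProjection_of_dense hF hrigid hM (hS' j).1 (hS' j).2 ν
  obtain ⟨c₀, -, -, -, hc₀⟩ := exists_subseq_isTangentialProjection hS hlim hc
  exact ⟨c₀, hc₀⟩

end TangentialProjection

section RankOneVariation

variable {F E : Type*} [NormedAddCommGroup F] [NormedSpace ℝ F]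
  [NormedAddCommGroup E] [NormedSpace ℝ E]

theorem sub_smulRight_isInfinitesimalIsometry {T : F →L[ℝ] E} (hT : ∀ w, ‖T w‖ = ‖w‖)
    {f : F →L[ℝ] ℝ} {ν : E} {t : ℕ → ℝ} {A : ℕ → F →L[ℝ] F} {M : F →L[ℝ] F} {c : ℕ → F} {c₀ : F}
    (ht : ∀ j, 0 < t j) (ht0 : Tendsto t atTop (𝓝 0))
    (hA : ∀ j w, ‖A j w‖ = ‖(T + t j • f.smulRight ν) w‖)
    (hM : Tendsto (fun j => (t j)⁻¹ • (A j - 1)) atTop (𝓝 M))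
    (hc : ∀ j, IsTangentialProjection (T + t j • f.smulRight ν) ν (c j))
    (hlim : Tendsto c atTop (𝓝 c₀)) (hc₀ : IsTangentialProjection T ν c₀) :
    IsInfinitesimalIsometry (M - f.smulRight c₀) := fun w => by
  have hA1 : Tendsto A atTop (𝓝 1) := by
    have h := (ht0.smul hM).const_add 1
    rw [zero_smul, add_zero] at h
    refine h.congr fun j => ?_
    rw [smul_inv_smul₀ (ht j).ne']
    abel
  have hM' : Tendsto (fun j => ((t j)⁻¹ • (A j - 1)) w) atTop (𝓝 (M w)) :=
    tendsto_clm_apply hM tendsto_const_nhds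
  have hz : ∀ {d : ℕ → F}, Tendsto d atTop (𝓝 c₀) →
      Tendsto (fun j => ((t j)⁻¹ • (A j - 1)) w - f w • A j (d j)) atTop
        (𝓝 ((M - f.smulRight c₀) w)) := fun hd =>
    hM'.sub ((tendsto_clm_apply hA1 hd).const_smul (f w))
  have hnorm : ∀ j d, ‖w + t j • (((t j)⁻¹ • (A j - 1)) w - f w • A j d)‖ =
      ‖T w + (t j * f w) • (ν - T d) - (t j * (t j * (f w * f d))) • ν‖ := fun j d => by
    have h1 : w + t j • (((t j)⁻¹ • (A j - 1)) w - f w • A j d) = A j (w - (t j * f w) • d) := by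
      rw [smul_sub, smul_apply, smul_inv_smul₀ (ht j).ne', map_sub, map_smul, smul_smul]
      simp only [sub_apply, one_apply_eq_self]
      abel
    rw [h1, hA]
    congr 1
    simp only [add_apply, smul_apply, ContinuousLinearMap.smulRight_apply, map_sub, map_smul]
    module
  refine norm_le_norm_add_smul_of_tendsto ht ht0 (hz hlim) (hz tendsto_const_nhds)
    (ε := fun j => t j * ‖(f w * f c₀) • ν‖) (by simpa using ht0.mul_const ‖(f w * f c₀) • ν‖)
    (fun j => ?_) (fun j => ?_)
  · have h1 := hc j (w - (t j * f w) • c j) (-(t j * f w))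
    have h2 : (T + t j • f.smulRight ν) (w - (t j * f w) • c j) +
        (-(t j * f w)) • (ν - (T + t j • f.smulRight ν) (c j)) = T w := by
      simp only [add_apply, smul_apply, ContinuousLinearMap.smulRight_apply, map_sub, map_smul]
      module
    have h3 : (T + t j • f.smulRight ν) (w - (t j * f w) • c j) =
        T w + (t j * f w) • (ν - T (c j)) - (t j * (t j * (f w * f (c j)))) • ν := by
      simp only [add_apply, smul_apply, ContinuousLinearMap.smulRight_apply, map_sub, map_smul]
      module
    rw [h2, h3, hT] at h1
    rw [hnorm]
    refine h1.trans (le_add_of_nonneg_right ?_)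
    have := (ht j).le
    positivity
  · rw [hnorm, ← hT w]
    refine (hc₀ w (t j * f w)).trans
      ((norm_le_norm_sub_add _ ((t j * (t j * (f w * f c₀))) • ν)).trans
        (add_le_add le_rfl (le_of_eq ?_)))
    rw [← mul_assoc (t j), mul_smul, norm_smul, Real.norm_of_nonneg (by have := ht j; positivity)]
    ring

variable [FiniteDimensional ℝ F]

/-- The first order term of the norms induced by a rank one variation is itself of rank one. -/
theorem exists_tendsto_smulRight_of_rigid [FiniteDimensional ℝ E] (hF : Module.finrank ℝ F = 2)
    (hrigid : ∀ Z : F →L[ℝ] F, IsInfinitesimalIsometry Z → Z = 0) (hM : ModelsSections F E)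
    {T : F →L[ℝ] E} (hT : ∀ w, ‖T w‖ = ‖w‖) (f : F →L[ℝ] ℝ) (ν : E) :
    ∃ (t : ℕ → ℝ) (A : ℕ → F →L[ℝ] F) (c : F), (∀ j, 0 < t j) ∧ Tendsto t atTop (𝓝 0) ∧
      (∀ j w, ‖A j w‖ = ‖(T + t j • f.smulRight ν) w‖) ∧
      Tendsto (fun j => (t j)⁻¹ • (A j - 1)) atTop (𝓝 (f.smulRight c)) := by
  obtain ⟨t, A, M, ht, ht0, hA, hlim⟩ :=
    exists_tendsto_inv_smul_of_modelsSections hM T (f.smulRight ν) hT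
  have hS : Tendsto (fun j => T + t j • f.smulRight ν) atTop (𝓝 T) := by
    simpa using (ht0.smul_const (f.smulRight ν)).const_add T
  obtain ⟨N, hN⟩ := eventually_atTop.1 (hS.eventually
    (ContinuousLinearMap.isOpen_injective.mem_nhds (injective_of_norm_eq hT)))
  have hproj : ∀ j, ∃ c, IsTangentialProjection (T + t (j + N) • f.smulRight ν) ν c := fun j =>
    exists_isTangentialProjection hF hrigid hM (hN (j + N) (by omega)) ν
  choose c hc using hproj
  obtain ⟨c₀, φ, hφ, hc₀, hT₀⟩ := exists_subseq_isTangentialProjection (injective_of_norm_eq hT)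
    (hS.comp (tendsto_add_atTop_nat N)) hc
  have hψ : Tendsto (fun j => φ j + N) atTop atTop :=
    (tendsto_add_atTop_nat N).comp hφ.tendsto_atTop
  have hMψ := hlim.comp hψ
  have hZ := hrigid _ (sub_smulRight_isInfinitesimalIsometry hT (fun j => ht (φ j + N))
    (ht0.comp hψ) (fun j => hA (φ j + N)) hMψ (fun j => hc (φ j)) hc₀ hT₀)
  rw [sub_eq_zero] at hZ
  rw [hZ] at hMψ
  exact ⟨_, _, c₀, fun j => ht (φ j + N), ht0.comp hψ, fun j => hA (φ j + N), hMψ⟩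

end RankOneVariation

section Transport

variable {F E : Type*} [NormedAddCommGroup F] [NormedSpace ℝ F]
  [NormedAddCommGroup E] [NormedSpace ℝ E]

theorem det_mul_eq (A B : F →L[ℝ] F) : (A * B).det = A.det * B.det :=
  LinearMap.det_comp _ _

theorem det_one_eq : (1 : F →L[ℝ] F).det = 1 :=
  LinearMap.det_id

variable [FiniteDimensional ℝ F]

theorem exists_subseq_tendsto_of_det_pos {S : ℕ → F →L[ℝ] E} {S₀ : F →L[ℝ] E}
    (hS₀ : Function.Injective S₀) (hS : Tendsto S atTop (𝓝 S₀)) {A : ℕ → F →L[ℝ] F}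
    (hA : ∀ j w, ‖A j w‖ = ‖S j w‖) (hdet : ∀ j, 0 < (A j).det) :
    ∃ (A₀ : F →L[ℝ] F) (φ : ℕ → ℕ), StrictMono φ ∧ Tendsto (A ∘ φ) atTop (𝓝 A₀) ∧
      (∀ w, ‖A₀ w‖ = ‖S₀ w‖) ∧ 0 < A₀.det := by
  obtain ⟨A₀, φ, hφ, hlim, hA₀⟩ := exists_subseq_tendsto_of_norm_eq hS hA
  refine ⟨A₀, φ, hφ, hlim, hA₀, lt_of_le_of_ne ?_ fun h => ?_⟩
  · exact ge_of_tendsto' ((ContinuousLinearMap.continuous_det.tendsto A₀).comp hlim)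
      fun j => (hdet _).le
  · have hinj : Function.Injective A₀ := (injective_iff_map_eq_zero A₀).2 fun w hw => by
      refine hS₀ ?_
      rw [map_zero, ← norm_eq_zero, ← hA₀, hw, norm_zero]
    obtain ⟨B, hB, -⟩ := exists_inverse_of_injective hinj
    have := det_mul_eq B A₀
    rw [hB, ← h, mul_zero, det_one_eq] at this
    exact one_ne_zero this

/-- The norm on the plane spanned by `x` and `y` admits an orientation preserving model in which
`x` is represented by `b 0`. -/
def HasOrientedModel (b : Module.Basis (Fin 2) ℝ F) (x y : E) : Prop :=
  ∃ A : F →L[ℝ] F, (∀ w, ‖A w‖ = ‖pairMap b x y w‖) ∧ 0 < A.det ∧ A (b 0) = b 0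

theorem HasOrientedModel.of_approx {b : Module.Basis (Fin 2) ℝ F} {x y : E} (hx : x ≠ 0)
    (hy : y ∉ Submodule.span ℝ {x})
    (h : ∀ ε > 0, ∃ A : F →L[ℝ] F, (∀ w, ‖A w‖ = ‖pairMap b x y w‖) ∧ 0 < A.det ∧
      ‖A (b 0) - b 0‖ ≤ ε) : HasOrientedModel b x y := by
  choose A hA hdet hle using fun j : ℕ => h (1 / ((j : ℝ) + 1)) (by positivity)
  obtain ⟨A₀, φ, hφ, hlim, hA₀, hdet₀⟩ := exists_subseq_tendsto_of_det_pos
    (injective_pairMap b hx hy) tendsto_const_nhds hA hdet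
  refine ⟨A₀, hA₀, hdet₀, sub_eq_zero.1 (norm_le_zero_iff.1 ?_)⟩
  exact le_of_tendsto_of_tendsto'
    ((tendsto_clm_apply hlim (tendsto_const_nhds (x := b 0))).sub_const (b 0)).norm
    (tendsto_one_div_add_atTop_nhds_zero_nat.comp hφ.tendsto_atTop) fun j => hle (φ j)

variable [FiniteDimensional ℝ E]

theorem HasOrientedModel.add (hF : Module.finrank ℝ F = 2)
    (hrigid : ∀ Z : F →L[ℝ] F, IsInfinitesimalIsometry Z → Z = 0) (hM : ModelsSections F E)
    {b : Module.Basis (Fin 2) ℝ F} {x y ν : E} (hx : x ≠ 0)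
    (hy : ∀ s ∈ Icc (0 : ℝ) 1, y + s • ν ∉ Submodule.span ℝ {x})
    (h : HasOrientedModel b x y) : HasOrientedModel b x (y + ν) := by
  have hSinj : ∀ s ∈ Icc (0 : ℝ) 1, Function.Injective (pairMap b x (y + s • ν)) :=
    fun s hs => injective_pairMap b hx (hy s hs)
  refine HasOrientedModel.of_approx hx (by simpa using hy 1 (by simp)) fun ε hε => ?_
  let K : Set ℝ := {s | ∃ A : F →L[ℝ] F, (∀ w, ‖A w‖ = ‖pairMap b x (y + s • ν) w‖) ∧
    0 < A.det ∧ ‖A (b 0) - b 0‖ ≤ ε * s}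
  have hclosed : IsClosed (K ∩ Icc 0 1) := by
    refine IsSeqClosed.isClosed fun s s₀ hs hs₀ => ?_
    have hmem : s₀ ∈ Icc (0 : ℝ) 1 := isClosed_Icc.mem_of_tendsto hs₀
      (Eventually.of_forall fun j => (hs j).2)
    choose A hA hdet hle using fun j => (hs j).1
    have hlimS : Tendsto (fun j => pairMap b x (y + s j • ν)) atTop
        (𝓝 (pairMap b x (y + s₀ • ν))) :=
      ((continuous_pairMap b x).tendsto _).comp ((hs₀.smul_const ν).const_add y)
    obtain ⟨A₀, φ, hφ, hlim, hA₀, hdet₀⟩ :=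
      exists_subseq_tendsto_of_det_pos (hSinj s₀ hmem) hlimS hA hdet
    refine ⟨⟨A₀, hA₀, hdet₀, ?_⟩, hmem⟩
    exact le_of_tendsto_of_tendsto'
      ((tendsto_clm_apply hlim (tendsto_const_nhds (x := b 0))).sub_const (b 0)).norm
      ((hs₀.comp hφ.tendsto_atTop).const_mul ε) fun j => hle (φ j)
  have h0 : (0 : ℝ) ∈ K := by
    obtain ⟨A, hA, hdet, hAb⟩ := h
    exact ⟨A, by simpa using hA, hdet, by simp [hAb]⟩
  have hsub : Icc (0 : ℝ) 1 ⊆ K := by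
    refine hclosed.Icc_subset_of_forall_exists_gt h0 fun s hs r hr => ?_
    obtain ⟨⟨A, hA, hdet, hle⟩, hs01⟩ := hs
    have hAinj : Function.Injective A := (injective_iff_map_eq_zero A).2 fun w hw => by
      refine hSinj s (Ico_subset_Icc_self hs01) ?_
      rw [map_zero, ← norm_eq_zero, ← hA, hw, norm_zero]
    obtain ⟨B, hBA, hAB⟩ := exists_inverse_of_injective hAinj
    have hBA' : ∀ w, B (A w) = w := fun w => congrArg (fun D : F →L[ℝ] F => D w) hBA
    have hAB' : ∀ w, A (B w) = w := fun w => congrArg (fun D : F →L[ℝ] F => D w) hAB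
    obtain ⟨t, C, c, ht, ht0, hC, hlim⟩ := exists_tendsto_smulRight_of_rigid hF hrigid hM
      (T := pairMap b x (y + s • ν) ∘L B)
      (fun w => by rw [ContinuousLinearMap.comp_apply, ← hA, hAB']) (coordL b 1 ∘L B) ν
    have hC1 : Tendsto C atTop (𝓝 1) := by
      have h := (ht0.smul hlim).const_add 1
      rw [zero_smul, add_zero] at h
      refine h.congr fun j => ?_
      rw [smul_inv_smul₀ (ht j).ne']
      abel
    have hdetC : ∀ᶠ j in atTop, 0 < (C j).det := by
      refine ((ContinuousLinearMap.continuous_det.tendsto 1).comp hC1).eventually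
        (lt_mem_nhds ?_)
      rw [det_one_eq]
      exact zero_lt_one
    have hv : Tendsto (fun j => ‖((t j)⁻¹ • (C j - 1)) (A (b 0))‖) atTop (𝓝 0) := by
      have := (tendsto_clm_apply hlim (tendsto_const_nhds (x := A (b 0)))).norm
      simpa [hBA', coordL_apply_of_ne] using this
    obtain ⟨j, hj1, hj2, hj3⟩ := (hdetC.and ((hv.eventually_lt_const hε).and
      (ht0.eventually_lt_const (sub_pos.2 hr)))).exists
    refine ⟨s + t j, ⟨C j * A, fun w => ?_, ?_, ?_⟩, by linarith [ht j], by linarith⟩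
    · rw [mul_apply_eq_comp, hC]
      congr 1
      simp only [add_apply, smul_apply, ContinuousLinearMap.smulRight_apply,
        ContinuousLinearMap.comp_apply, hBA', pairMap_apply]
      module
    · rw [det_mul_eq]
      exact mul_pos hj1 hdet
    · have h1 : (C j * A) (b 0) - b 0 =
          (A (b 0) - b 0) + t j • ((t j)⁻¹ • (C j - 1)) (A (b 0)) := by
        rw [smul_apply, smul_inv_smul₀ (ht j).ne']
        simp
      rw [h1]
      refine (norm_add_le _ _).trans ?_
      rw [norm_smul, Real.norm_of_nonneg (ht j).le]
      nlinarith [ht j]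
  simpa [K] using hsub (right_mem_Icc.2 zero_le_one)

end Transport

section Reflection

variable {F E : Type*} [NormedAddCommGroup F] [NormedSpace ℝ F] [FiniteDimensional ℝ F]
  [NormedAddCommGroup E] [NormedSpace ℝ E]

theorem exists_isInfinitesimalIsometry_of_tendsto_one {g : ℕ → F →L[ℝ] F}
    (hg : ∀ j w, ‖g j w‖ = ‖w‖) (hg1 : ∀ j, g j ≠ 1) (hlim : Tendsto g atTop (𝓝 1)) :
    ∃ Z : F →L[ℝ] F, Z ≠ 0 ∧ IsInfinitesimalIsometry Z := by
  have ht : ∀ j, 0 < ‖g j - 1‖ := fun j => norm_pos_iff.2 (sub_ne_zero.2 (hg1 j))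
  have ht0 : Tendsto (fun j => ‖g j - 1‖) atTop (𝓝 0) :=
    tendsto_iff_norm_sub_tendsto_zero.1 hlim
  have : ProperSpace (F →L[ℝ] F) := FiniteDimensional.proper_real _
  have hN : ∀ j, ‖g j - 1‖⁻¹ • (g j - 1) ∈ sphere (0 : F →L[ℝ] F) 1 := fun j => by
    rw [mem_sphere_zero_iff_norm, norm_smul, norm_inv, norm_norm, inv_mul_cancel₀ (ht j).ne']
  obtain ⟨Z, hZ, φ, hφ, hlimZ⟩ := (isCompact_sphere _ _).tendsto_subseq hN
  rw [mem_sphere_zero_iff_norm] at hZ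
  refine ⟨Z, norm_ne_zero_iff.1 (by rw [hZ]; exact one_ne_zero), fun w => ?_⟩
  have hz : Tendsto (fun j => (‖g (φ j) - 1‖⁻¹ • (g (φ j) - 1)) w) atTop (𝓝 (Z w)) :=
    tendsto_clm_apply hlimZ tendsto_const_nhds
  have heq : ∀ j, ‖w + ‖g (φ j) - 1‖ • (‖g (φ j) - 1‖⁻¹ • (g (φ j) - 1)) w‖ = ‖w‖ := fun j => by
    rw [smul_apply, smul_inv_smul₀ (ht _).ne']
    simpa using hg (φ j) w
  exact norm_le_norm_add_smul_of_tendsto (fun j => ht (φ j)) (ht0.comp hφ.tendsto_atTop) hz hz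
    (ε := fun _ => 0) tendsto_const_nhds (fun j => by rw [heq]; simp)
    (fun j => by rw [heq]; simp)

theorem exists_isInfinitesimalIsometry_of_injective {g : ℕ → F →L[ℝ] F}
    (hg : ∀ j w, ‖g j w‖ = ‖w‖) (hinj : Function.Injective g) :
    ∃ Z : F →L[ℝ] F, Z ≠ 0 ∧ IsInfinitesimalIsometry Z := by
  obtain ⟨g₀, φ, hφ, hlim, hg₀⟩ := exists_subseq_tendsto_of_norm_eq
    (S := fun _ => (1 : F →L[ℝ] F)) tendsto_const_nhds (A := g) (by simpa using hg)
  obtain ⟨h, hh, hh', hnorm⟩ := exists_isometric_inverse (A := g₀) (by simpa using hg₀)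
  have hne : ∃ N, ∀ j, h * g (φ (j + N)) ≠ 1 := by
    have huniq : ∀ i, h * g i = 1 → g i = g₀ := fun i hi => by
      have := congrArg (g₀ * ·) hi
      simpa [← mul_assoc, hh'] using this
    by_cases h0 : ∃ N, h * g (φ N) = 1
    · obtain ⟨N, hN⟩ := h0
      refine ⟨N + 1, fun j hj => ?_⟩
      have := hφ.injective (hinj ((huniq _ hj).trans (huniq _ hN).symm))
      omega
    · exact ⟨0, fun j => not_exists.1 h0 j⟩
  obtain ⟨N, hN⟩ := hne
  refine exists_isInfinitesimalIsometry_of_tendsto_one (g := fun j => h * g (φ (j + N)))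
    (fun j w => by rw [mul_apply_eq_comp, hnorm, hg]) hN ?_
  have := (hlim.comp (tendsto_add_atTop_nat N)).const_mul h
  rwa [hh] at this

variable [FiniteDimensional ℝ E]

theorem HasOrientedModel.neg (hE : 3 ≤ Module.finrank ℝ E) (hF : Module.finrank ℝ F = 2)
    (hrigid : ∀ Z : F →L[ℝ] F, IsInfinitesimalIsometry Z → Z = 0) (hM : ModelsSections F E)
    {b : Module.Basis (Fin 2) ℝ F} {x y : E} (hx : x ≠ 0) (hy : y ∉ Submodule.span ℝ {x})
    (h : HasOrientedModel b x y) : HasOrientedModel b x (-y) := by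
  obtain ⟨z, hz⟩ : ∃ z, z ∉ Submodule.span ℝ {y, x} := by
    by_contra! hall
    classical
    have h1 := (finrank_span_finset_le_card (R := ℝ) ({y, x} : Finset E)).trans Finset.card_le_two
    rw [Finset.coe_pair, Set.finrank, Submodule.eq_top_iff'.2 hall, finrank_top] at h1
    omega
  have hind : ∀ p q : ℝ, p • z + q • y ∈ Submodule.span ℝ {x} → p = 0 ∧ q = 0 := by
    intro p q hpq
    have hp : p = 0 := by
      by_contra hp
      obtain ⟨r, hr⟩ := Submodule.mem_span_singleton.1 hpq
      refine hz (Submodule.mem_span_pair.2 ⟨-(p⁻¹ * q), p⁻¹ * r, ?_⟩)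
      rw [mul_smul p⁻¹ r, hr, smul_add, inv_smul_smul₀ hp]
      module
    rw [hp, zero_smul, zero_add] at hpq
    refine ⟨hp, ?_⟩
    by_contra hq
    exact hy ((Submodule.smul_mem_iff _ hq).1 hpq)
  have h1 : HasOrientedModel b x (y + (z - y)) := h.add hF hrigid hM hx fun s _ hmem => by
    have := hind s (1 - s) (by convert hmem using 1; module)
    linarith
  have h2 : HasOrientedModel b x ((y + (z - y)) + (-y - z)) :=
    h1.add hF hrigid hM hx fun s _ hmem => by
      have := hind (1 - s) (-s) (by convert hmem using 1; module)
      linarith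
  convert h2 using 1
  abel

theorem exists_isometry_det_neg (hE : 3 ≤ Module.finrank ℝ E) (hF : Module.finrank ℝ F = 2)
    (hrigid : ∀ Z : F →L[ℝ] F, IsInfinitesimalIsometry Z → Z = 0) (hM : ModelsSections F E)
    {T : F →L[ℝ] E} (hT : ∀ w, ‖T w‖ = ‖w‖) {v : F} (hv : v ≠ 0) :
    ∃ g : F →L[ℝ] F, (∀ w, ‖g w‖ = ‖w‖) ∧ g v = v ∧ g.det < 0 := by
  obtain ⟨b, rfl⟩ := exists_basis_apply_zero_eq hF hv
  have hTinj := injective_of_norm_eq hT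
  have hx : T (b 0) ≠ 0 := fun h => hv (hTinj (by rw [h, map_zero]))
  have hy : T (b 1) ∉ Submodule.span ℝ {T (b 0)} := fun h => by
    obtain ⟨r, hr⟩ := Submodule.mem_span_singleton.1 h
    rw [← map_smul] at hr
    have h1 := congrArg (coordL b 1) (hTinj hr)
    simp [coordL_apply_of_ne] at h1
  have hmodel : HasOrientedModel b (T (b 0)) (T (b 1)) :=
    ⟨1, fun w => by rw [pairMap_self, hT, one_apply_eq_self], by rw [det_one_eq]; exact one_pos,
      rfl⟩
  obtain ⟨A, hA, hdet, hAb⟩ := hmodel.neg hE hF hrigid hM hx hy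
  let r : F →L[ℝ] F := pairMap b (b 0) (-b 1)
  have hr0 : r (b 0) = b 0 := by simp [r, pairMap_apply, coordL_apply_of_ne]
  have hr1 : r (b 1) = -b 1 := by simp [r, pairMap_apply, coordL_apply_of_ne]
  have hrdet : r.det = -1 := by
    change LinearMap.det (r : F →ₗ[ℝ] F) = -1
    rw [← LinearMap.det_toMatrix b, Matrix.det_fin_two]
    simp [LinearMap.toMatrix_apply, hr0, hr1]
  refine ⟨A * r, fun w => ?_, by rw [mul_apply_eq_comp, hr0, hAb], ?_⟩
  · rw [mul_apply_eq_comp, hA, ← hT w, ← coordL_sum b (r w)]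
    congr 1
    conv_rhs => rw [← coordL_sum b w]
    simp [r, pairMap_apply, coordL_apply_of_ne]
  · rw [det_mul_eq, hrdet]
    linarith

/-- If all plane sections of a space of dimension at least three are isometric, then they have an
infinitesimal isometry. -/
theorem exists_isInfinitesimalIsometry (hE : 3 ≤ Module.finrank ℝ E)
    (hF : Module.finrank ℝ F = 2) (hM : ModelsSections F E)
    {T : F →L[ℝ] E} (hT : ∀ w, ‖T w‖ = ‖w‖) :
    ∃ Z : F →L[ℝ] F, Z ≠ 0 ∧ IsInfinitesimalIsometry Z := by
  by_contra hcon
  have hrigid : ∀ Z : F →L[ℝ] F, IsInfinitesimalIsometry Z → Z = 0 := fun Z hZ =>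
    by_contra fun h => hcon ⟨Z, h, hZ⟩
  let b : Module.Basis (Fin 2) ℝ F := Module.finBasisOfFinrankEq ℝ F hF
  have hv : ∀ j : ℕ, b 0 + (j : ℝ) • b 1 ≠ 0 := fun j h => by
    have := congrArg (coordL b 0) h
    simp [coordL_apply_of_ne] at this
  choose g hg hgv hdet using fun j => exists_isometry_det_neg hE hF hrigid hM hT (hv j)
  refine hcon (exists_isInfinitesimalIsometry_of_injective hg fun i j hij => ?_)
  by_contra hne
  have hi := hgv i
  rw [map_add, map_smul] at hi
  have hj := hgv j
  rw [← hij, map_add, map_smul] at hj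
  have h1 : g i (b 1) = b 1 := by
    have h2 : ((i : ℝ) - j) • g i (b 1) = ((i : ℝ) - j) • b 1 := by
      convert congrArg₂ (· - ·) hi hj using 1 <;> module
    exact smul_right_injective F (sub_ne_zero.2 (Nat.cast_injective.ne hne)) h2
  have h0 : g i (b 0) = b 0 := by
    rw [h1] at hi
    exact add_right_cancel hi
  have hg1 : g i = 1 := by
    ext w
    rw [← coordL_sum b w, map_add, map_smul, map_smul, h0, h1]
    rfl
  have := hdet i
  rw [hg1, det_one_eq] at this
  linarith

end Reflection

section EuclideanNorm

variable {E : Type*} [NormedAddCommGroup E] [NormedSpace ℝ E] [FiniteDimensional ℝ E]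

theorem parallelogram_of_modelsSections {n : ℕ} (hn : 2 ≤ n) (hE : Module.finrank ℝ E = n + 2)
    (hW : ∀ W : Submodule ℝ E, Module.finrank ℝ W = n → ModelsSections W E) (x y : E) :
    ‖x + y‖ ^ 2 + ‖x - y‖ ^ 2 = 2 * (‖x‖ ^ 2 + ‖y‖ ^ 2) := by
  obtain ⟨F, -, -, hF⟩ := exists_submodule_between (bot_le : ⊥ ≤ (⊤ : Submodule ℝ E)) (k := 2)
    (by simp) (by rw [finrank_top]; omega)
  have hT : ∀ w : F, ‖F.subtypeL w‖ = ‖w‖ := fun w => rfl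
  have hM : ModelsSections F E := modelsSections_of_finrank_eq_two hn hE hW hF F.subtypeL hT
  obtain ⟨Z, hZ0, hZ⟩ := exists_isInfinitesimalIsometry (by omega) hF hM hT
  by_cases hx : x = 0
  · simp only [hx, zero_add, zero_sub, norm_neg, norm_zero]
    ring
  by_cases hy : y ∈ Submodule.span ℝ {x}
  · obtain ⟨r, rfl⟩ := Submodule.mem_span_singleton.1 hy
    have h1 : x + r • x = (1 + r) • x := by module
    have h2 : x - r • x = (1 - r) • x := by module
    simp only [h1, h2, norm_smul, Real.norm_eq_abs, mul_pow, sq_abs]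
    ring
  let b : Module.Basis (Fin 2) ℝ F := Module.finBasisOfFinrankEq ℝ F hF
  obtain ⟨A, hA⟩ := hM _ (injective_pairMap b hx hy)
  have hx' : pairMap b x y (b 0) = x := by simp [pairMap_apply, coordL_apply_of_ne]
  have hy' : pairMap b x y (b 1) = y := by simp [pairMap_apply, coordL_apply_of_ne]
  have h := hZ.parallelogram hF hZ0 (A (b 0)) (A (b 1))
  rwa [← map_add, ← map_sub, hA, hA, hA, hA, map_add, map_sub, hx', hy'] at h

theorem nonempty_linearIsometryEquiv_of_modelsSections {n : ℕ} (hn : 2 ≤ n)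
    (hE : Module.finrank ℝ E = n + 2)
    (hW : ∀ W : Submodule ℝ E, Module.finrank ℝ W = n → ModelsSections W E) :
    Nonempty (E ≃ₗᵢ[ℝ] EuclideanSpace ℝ (Fin (n + 2))) := by
  let _ : InnerProductSpace ℝ E := InnerProductSpace.ofNorm ℝ fun x y => by
    simpa only [sq] using parallelogram_of_modelsSections hn hE hW x y
  exact ⟨((stdOrthonormalBasis ℝ E).reindex (finCongr hE)).repr⟩

end EuclideanNorm

theorem exists_linearEquiv_norm_eq {V : Type*} [AddCommGroup V] [Module ℝ V]
    [FiniteDimensional ℝ V] {n : ℕ} (hn : 2 ≤ n) (hV : Module.finrank ℝ V = n + 2)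
    (p : Seminorm ℝ V) (hp : ∀ x, p x = 0 → x = 0)
    (hW : ∀ W : Submodule ℝ V, Module.finrank ℝ W = n →
      ∀ S : W →ₗ[ℝ] V, Function.Injective S → ∃ A : W →ₗ[ℝ] W, ∀ w, p (A w) = p (S w)) :
    ∃ e : V ≃ₗ[ℝ] EuclideanSpace ℝ (Fin (n + 2)), ∀ x, ‖e x‖ = p x := by
  let _ : Norm V := ⟨p⟩
  have core : NormedSpace.Core ℝ V :=
    { norm_nonneg := apply_nonneg p
      norm_smul := map_smul_eq_mul p
      norm_triangle := map_add_le_add p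
      norm_eq_zero_iff := fun x => ⟨hp x, fun h => by rw [h]; exact map_zero p⟩ }
  let _ : NormedAddCommGroup V := .ofCore core
  let _ : NormedSpace ℝ V := .ofCore core
  obtain ⟨e⟩ := nonempty_linearIsometryEquiv_of_modelsSections (E := V) hn hV
    fun W hWn S hS => by
      obtain ⟨A, hA⟩ := hW W hWn (S : W →ₗ[ℝ] V) hS
      exact ⟨LinearMap.toContinuousLinearMap A, hA⟩
  exact ⟨e.toLinearEquiv, e.norm_map⟩

variable {V : Type*} [AddCommGroup V] [Module ℝ V]

theorem map_mem_of_image_inter_eq {B : Set V} (hB : Absorbent ℝ B) {W₁ W₂ : Submodule ℝ V}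
    {f : V ≃ₗ[ℝ] V} (hf : f '' (B ∩ W₁) = B ∩ W₂) {x : V} (hx : x ∈ W₁) : f x ∈ W₂ := by
  obtain ⟨r, hr, hxr⟩ := hB.gauge_set_nonempty (x := x)
  rw [mem_smul_set_iff_inv_smul_mem₀ hr.ne'] at hxr
  have h := (hf.subset (mem_image_of_mem f ⟨hxr, W₁.smul_mem _ hx⟩)).2
  rw [map_smul] at h
  exact (Submodule.smul_mem_iff _ (inv_ne_zero hr.ne')).1 h

theorem gauge_map_of_image_inter_eq {B : Set V} (hB : Absorbent ℝ B) {W₁ W₂ : Submodule ℝ V}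
    {f : V ≃ₗ[ℝ] V} (hf : f '' (B ∩ W₁) = B ∩ W₂) {x : V} (hx : x ∈ W₁) :
    gauge B (f x) = gauge B x := by
  rw [gauge_def', gauge_def']
  congr 1
  ext r
  refine and_congr_right fun _ => ⟨fun h => ?_, fun h => ?_⟩
  · obtain ⟨y, hy, hyx⟩ := hf.superset ⟨h, W₂.smul_mem _ (map_mem_of_image_inter_eq hB hf hx)⟩
    rw [← map_smul] at hyx
    rw [← f.injective hyx]
    exact hy.1
  · rw [← map_smul]
    exact (hf.subset (mem_image_of_mem f ⟨h, W₁.smul_mem _ hx⟩)).1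

theorem exists_gauge_apply_eq [FiniteDimensional ℝ V] {B : Set V} (hB : Absorbent ℝ B) {n : ℕ}
    (hsec : ∀ W₁ W₂ : Submodule ℝ V, Module.finrank ℝ W₁ = n → Module.finrank ℝ W₂ = n →
      ∃ f : V ≃ₗ[ℝ] V, f '' (B ∩ W₁) = B ∩ W₂) {W : Submodule ℝ V}
    (hW : Module.finrank ℝ W = n) (S : W →ₗ[ℝ] V) (hS : Function.Injective S) :
    ∃ A : W →ₗ[ℝ] W, ∀ w, gauge B (A w) = gauge B (S w) := by
  obtain ⟨f, hf⟩ := hsec (LinearMap.range S) W ((LinearMap.finrank_range_of_inj hS).trans hW) hW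
  exact ⟨((f : V →ₗ[ℝ] V) ∘ₗ S).codRestrict W fun w =>
    map_mem_of_image_inter_eq hB hf (LinearMap.mem_range_self S w), fun w =>
    gauge_map_of_image_inter_eq hB hf (LinearMap.mem_range_self S w)⟩

end

/-- Gromov: let `n > 1` be odd and let `B ⊆ ℝ^{n+2}` be a symmetric convex
body with `0` in its interior.  If all sections of `B` by `n`-dimensional linear subspaces
are linearly equivalent, then `B` is an ellipsoid. -/
theorem linearly_equivalent_codim_two_sections_implies_ellipsoid
    (n : ℕ) (hn : 1 < n) (hodd : Odd n)
    (B : Set (EuclideanSpace ℝ (Fin (n + 2))))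
    (hBcompact : IsCompact B) (hBconv : Convex ℝ B)
    (hBsym : B = -B)
    (hB0 : (0 : EuclideanSpace ℝ (Fin (n + 2))) ∈ interior B)
    (hsec : ∀ W₁ W₂ : Submodule ℝ (EuclideanSpace ℝ (Fin (n + 2))),
      Module.finrank ℝ W₁ = n → Module.finrank ℝ W₂ = n →
        ∃ f : EuclideanSpace ℝ (Fin (n + 2)) ≃ₗ[ℝ] EuclideanSpace ℝ (Fin (n + 2)),
          f '' (B ∩ (W₁ : Set (EuclideanSpace ℝ (Fin (n + 2))))) =
            B ∩ (W₂ : Set (EuclideanSpace ℝ (Fin (n + 2))))) :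
    IsEllipsoid B := by
  have hnhds : B ∈ nhds 0 := mem_interior_iff_mem_nhds.1 hB0
  have habs : Absorbent ℝ B := absorbent_nhds_zero hnhds
  have hbal : Balanced ℝ B := (balanced_iff_neg_mem hBconv).2 fun x hx => by
    rwa [hBsym, Set.neg_mem_neg]
  obtain ⟨e, he⟩ := exists_linearEquiv_norm_eq (by omega) finrank_euclideanSpace_fin
    (gaugeSeminorm hbal hBconv habs)
    (fun x hx => (gauge_eq_zero habs (hBcompact.isVonNBounded ℝ)).1 hx)
    fun W hW S hS => exists_gauge_apply_eq habs hsec hW S hS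
  refine ⟨e.symm.toAffineEquiv, Set.ext fun x => ?_⟩
  have hmem : x ∈ B ↔ ‖e x‖ ≤ 1 := by
    rw [he]
    exact (hBcompact.isClosed.closure_eq ▸ (gauge_le_one_iff_mem_closure hBconv hnhds)).symm
  rw [hmem]
  refine ⟨fun h => ⟨e x, mem_closedBall_zero_iff.2 h, e.symm_apply_apply x⟩, ?_⟩
  rintro ⟨y, hy, rfl⟩
  simpa using hy
end

section
/- Let n ≥ 3 and let K ⊂ ℝ^n be a convex body of revolution. If K admits two distinct axes of revolution (two distinct lines L₁ ≠ L₂, each an axis of revolution of K), then K is a closed Euclidean ball. -/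
open Metric
open scoped RealInnerProductSpace

/-- The point `p` and unit direction `u` determine an axis of revolution of `K`: every
affine hyperplane orthogonal to the line through `p` with direction `u` meets `K` in a set
that is either empty, a single point, or a full-dimensional Euclidean ball (of the
hyperplane) centered at the intersection point of the hyperplane with the axis. -/
def IsAxisOfRevolution {E : Type*} [NormedAddCommGroup E] [InnerProductSpace ℝ E]
    (K : Set E) (p u : E) : Prop :=
  ‖u‖ = 1 ∧ ∀ t : ℝ,
    K ∩ {x | ⟪x - p, u⟫ = t} = ∅ ∨
    (∃ x, K ∩ {x | ⟪x - p, u⟫ = t} = {x}) ∨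
    (∃ r : ℝ, 0 < r ∧
      K ∩ {x | ⟪x - p, u⟫ = t} = {x | ⟪x - p, u⟫ = t ∧ dist x (p + t • u) ≤ r})

/-- The line `L` (as a subset) is an axis of revolution of `K`. -/
def IsAxisLineOfRevolution {E : Type*} [NormedAddCommGroup E] [InnerProductSpace ℝ E]
    (K L : Set E) : Prop :=
  ∃ p u : E, IsAxisOfRevolution K p u ∧ L = {x | ∃ t : ℝ, x = p + t • u}

section

open MeasureTheory

variable {E : Type*} [NormedAddCommGroup E] [InnerProductSpace ℝ E]

theorem exists_norm_eq_one_inner_eq_zero_inner_eq_zero [FiniteDimensional ℝ E]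
    (hE : 3 ≤ Module.finrank ℝ E) (u v : E) :
    ∃ f : E, ‖f‖ = 1 ∧ ⟪f, u⟫ = 0 ∧ ⟪f, v⟫ = 0 := by
  classical
  have h1 : Module.finrank ℝ (Submodule.span ℝ (({u, v} : Finset E) : Set E)) ≤ 2 :=
    (finrank_span_finset_le_card _).trans Finset.card_le_two
  have h2 := Submodule.finrank_add_finrank_orthogonal
    (Submodule.span ℝ (({u, v} : Finset E) : Set E))
  obtain ⟨g, hg, hg0⟩ := Submodule.exists_mem_ne_zero_of_ne_bot
    (p := (Submodule.span ℝ (({u, v} : Finset E) : Set E))ᗮ) (by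
      intro h
      rw [h, finrank_bot] at h2
      omega)
  rw [Submodule.mem_orthogonal'] at hg
  refine ⟨‖g‖⁻¹ • g, norm_smul_inv_norm hg0, ?_, ?_⟩
  · rw [real_inner_smul_left, hg u (Submodule.subset_span (by simp)), mul_zero]
  · rw [real_inner_smul_left, hg v (Submodule.subset_span (by simp)), mul_zero]

theorem exists_ne_zero_add_smul_mem_of_mem_interior {K : Set E} {x : E} (hx : x ∈ interior K)
    (f : E) : ∃ δ : ℝ, δ ≠ 0 ∧ x + δ • f ∈ K := by
  have hc : Filter.Tendsto (fun δ : ℝ => x + δ • f) (nhdsWithin 0 {0}ᶜ) (nhds x) := by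
    have : Continuous fun δ : ℝ => x + δ • f := by fun_prop
    simpa using (this.tendsto 0).mono_left nhdsWithin_le_nhds
  obtain ⟨δ, hδ, hδ0⟩ :=
    ((hc.eventually (mem_interior_iff_mem_nhds.1 hx)).and self_mem_nhdsWithin).exists
  exact ⟨δ, hδ0, hδ⟩

/-- A body is invariant under the linear isometries fixing an axis of revolution. -/
theorem IsAxisOfRevolution.isometry_mem [FiniteDimensional ℝ E]
    (hE : 3 ≤ Module.finrank ℝ E) {K : Set E} (hK : IsClosed K) (hconv : Convex ℝ K)
    (hint : (interior K).Nonempty) {p u : E} (h : IsAxisOfRevolution K p u)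
    (R : E ≃ₗᵢ[ℝ] E) (hR : R u = u) {x : E} (hx : x ∈ K) : p + R (x - p) ∈ K := by
  have key : Set.MapsTo (fun x => p + R (x - p)) (interior K) K := by
    intro x hx
    have hxK := interior_subset hx
    have hinner : ⟪R (x - p), u⟫ = ⟪x - p, u⟫ := by
      conv_lhs => rw [← hR]
      exact R.inner_map_map _ _
    rcases h.2 ⟪x - p, u⟫ with h0 | ⟨z, hz⟩ | ⟨r, -, hr⟩
    · exact absurd (h0.subset ⟨hxK, rfl⟩) (Set.notMem_empty _)
    · obtain ⟨f, hf, hfu, -⟩ := exists_norm_eq_one_inner_eq_zero_inner_eq_zero hE u u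
      have hf0 : f ≠ 0 := by rintro rfl; simp at hf
      obtain ⟨δ, hδ, hmem⟩ := exists_ne_zero_add_smul_mem_of_mem_interior hx f
      have e1 : x = z := hz.subset ⟨hxK, rfl⟩
      have e2 : x + δ • f = z := hz.subset ⟨hmem, by
        simp [add_sub_right_comm, inner_add_left, real_inner_smul_left, hfu]⟩
      have : δ • f = 0 := by simpa [← e1] using e2
      simp [hδ, hf0] at this
    · have hx' := (hr.subset ⟨hxK, rfl⟩).2
      refine (hr.symm.subset ⟨by simpa using hinner, ?_⟩).1
      rw [dist_eq_norm] at hx' ⊢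
      rw [show p + R (x - p) - (p + ⟪x - p, u⟫ • u) = R (x - (p + ⟪x - p, u⟫ • u)) by
        rw [← sub_sub x, map_sub R (x - p), map_smul, hR]; abel, R.norm_map]
      exact hx'
  have := key.closure (by fun_prop)
  rw [hconv.closure_interior_eq_closure_of_nonempty_interior hint, hK.closure_eq] at this
  exact this hx

/-- The line of an axis of revolution passes through the centroid. -/
theorem IsAxisOfRevolution.exists_centroid_eq [FiniteDimensional ℝ E]
    [MeasurableSpace E] [BorelSpace E]
    (hE : 3 ≤ Module.finrank ℝ E) {K : Set E} (hK : IsCompact K) (hconv : Convex ℝ K)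
    (hint : (interior K).Nonempty) {p u : E} (h : IsAxisOfRevolution K p u) :
    ∃ s : ℝ, ⨍ x in K, x ∂volume = p + s • u := by
  set R := (ℝ ∙ u).reflection with hRdef
  have hRu : R u = u :=
    Submodule.reflection_mem_subspace_eq_self (Submodule.mem_span_singleton_self u)
  have hRR : ∀ v, R (R v) = v := fun v => Submodule.reflection_reflection _ v
  let T : E ≃ₜ E := (Homeomorph.subRight p).trans
    (R.toHomeomorph.trans (Homeomorph.addLeft p))
  have hT : ∀ x, T x = p + R (x - p) := fun x => rfl
  have hTm : MeasurePreserving T volume volume :=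
    (measurePreserving_add_left volume p).comp
      (R.measurePreserving.comp (measurePreserving_sub_right volume p))
  have hTK : T ⁻¹' K = K := by
    ext x
    refine ⟨fun hx => ?_, fun hx => h.isometry_mem hE hK.isClosed hconv hint R hRu hx⟩
    have := h.isometry_mem hE hK.isClosed hconv hint R hRu hx
    simpa [hT, hRR] using this
  have hi : IntegrableOn (fun x : E => x) K volume :=
    continuousOn_id.integrableOn_compact hK
  have hm : R (∫ x in K, (x - p)) = ∫ x in K, (x - p) := by
    have e1 : R (∫ x in K, (x - p)) = ∫ x in K, R (x - p) :=
      (R.toContinuousLinearEquiv.integral_comp_comm _).symm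
    have e2 := hTm.setIntegral_preimage_emb T.measurableEmbedding (fun x => x - p) K
    rw [hTK] at e2
    rw [e1, ← e2]
    simp [hT]
  obtain ⟨s, hs⟩ := Submodule.mem_span_singleton.1
    ((Submodule.reflection_eq_self_iff _).1 hm)
  have hfin : volume K ≠ ⊤ := hK.measure_lt_top.ne
  have hpos : volume.real K ≠ 0 := by
    rw [measureReal_def, ENNReal.toReal_ne_zero]
    exact ⟨(Measure.measure_pos_of_nonempty_interior _ hint).ne', hfin⟩
  refine ⟨(volume.real K)⁻¹ * s, ?_⟩
  rw [integral_sub hi (integrableOn_const hfin), setIntegral_const] at hs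
  rw [setAverage_eq, mul_smul, hs, smul_sub, smul_smul, inv_mul_cancel₀ hpos, one_smul]
  abel

/-- A compact subset of a sphere that is invariant under rotations about two distinct
directions contains, with any of its points, points of every height. -/
theorem exists_mem_inner_eq {S : Set E} {ρ : ℝ} (hS : IsCompact S) (hne : S.Nonempty)
    (hSρ : ∀ x ∈ S, ‖x‖ = ρ) {u v f : E} (hu : ‖u‖ = 1) (hv : ‖v‖ = 1) (hf : ‖f‖ = 1)
    (hfu : ⟪f, u⟫ = 0) (hfv : ⟪f, v⟫ = 0) (huv : ⟪u, v⟫ ^ 2 < 1)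
    (h1 : ∀ x ∈ S, ∀ y, ‖y‖ = ‖x‖ → ⟪y, u⟫ = ⟪x, u⟫ → y ∈ S)
    (h2 : ∀ x ∈ S, ∀ y, ‖y‖ = ‖x‖ → ⟪y, v⟫ = ⟪x, v⟫ → y ∈ S)
    {b : ℝ} (hb : b ^ 2 ≤ ρ ^ 2) : ∃ y ∈ S, ⟪y, u⟫ = b := by
  obtain ⟨y, hy, hmin⟩ := hS.exists_isMinOn hne
    (f := fun y => |⟪y, u⟫ - b|) (by fun_prop)
  refine ⟨y, hy, ?_⟩
  set a := ⟪y, u⟫ with ha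
  set β := ⟪u, v⟫ with hβ
  have hρ : 0 ≤ ρ := hSρ y hy ▸ norm_nonneg y
  have ha2 : a ^ 2 ≤ ρ ^ 2 := by
    rw [sq_le_sq, abs_of_nonneg hρ, ← hSρ y hy]
    simpa [hu] using abs_real_inner_le_norm y u
  have huu : ⟪u, u⟫ = 1 := by rw [real_inner_self_eq_norm_sq, hu, one_pow]
  have hvv : ⟪v, v⟫ = 1 := by rw [real_inner_self_eq_norm_sq, hv, one_pow]
  have hff : ⟪f, f⟫ = 1 := by rw [real_inner_self_eq_norm_sq, hf, one_pow]
  have hvu : ⟪v, u⟫ = β := real_inner_comm _ _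
  have huf : ⟪u, f⟫ = 0 := by rw [real_inner_comm, hfu]
  have hvf : ⟪v, f⟫ = 0 := by rw [real_inner_comm, hfv]
  have hnorm : ∀ {z : E} {c : ℝ}, ⟪z, z⟫ = c → c = ρ ^ 2 → ‖z‖ = ρ := by
    intro z c h h'
    rw [real_inner_self_eq_norm_sq, h'] at h
    exact (sq_eq_sq₀ (norm_nonneg z) hρ).1 h
  have hs1 := Real.sq_sqrt (sub_nonneg.2 ha2)
  set q := √(ρ ^ 2 - a ^ 2)
  have hy₁ρ : ‖a • u + q • f‖ = ρ := by
    refine hnorm (c := a ^ 2 + q ^ 2) ?_ (by linarith)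
    simp only [inner_add_left, inner_add_right, real_inner_smul_left,
      real_inner_smul_right, huu, hff, hfu, huf]
    ring
  have hy₁ : a • u + q • f ∈ S := by
    refine h1 y hy _ (by rw [hy₁ρ, hSρ y hy]) ?_
    simp only [inner_add_left, real_inner_smul_left, huu, hfu]
    rw [← ha]; ring
  have hnn : 0 ≤ ρ ^ 2 - (a ^ 2 * β ^ 2 + b ^ 2 * (1 - β ^ 2)) := by
    nlinarith [mul_le_mul_of_nonneg_right ha2 (sq_nonneg β),
      mul_le_mul_of_nonneg_right hb (sub_nonneg.2 huv.le)]
  have hs2 := Real.sq_sqrt hnn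
  set r := √(ρ ^ 2 - (a ^ 2 * β ^ 2 + b ^ 2 * (1 - β ^ 2)))
  have hy₂ρ : ‖b • u + ((a - b) * β) • v + r • f‖ = ρ := by
    refine hnorm (c := a ^ 2 * β ^ 2 + b ^ 2 * (1 - β ^ 2) + r ^ 2) ?_ (by linarith)
    simp only [inner_add_left, inner_add_right, real_inner_smul_left,
      real_inner_smul_right, huu, hff, hfu, huf, hvv, hvu, hfv, hvf, ← hβ]
    ring
  have hy₂ : b • u + ((a - b) * β) • v + r • f ∈ S := by
    refine h2 _ hy₁ _ (by rw [hy₁ρ, hy₂ρ]) ?_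
    simp only [inner_add_left, real_inner_smul_left, hvv, hfv, ← hβ]
    ring
  have hle : |a - b| ≤ |⟪b • u + ((a - b) * β) • v + r • f, u⟫ - b| := hmin hy₂
  rw [show ⟪b • u + ((a - b) * β) • v + r • f, u⟫ - b = β ^ 2 * (a - b) by
    simp only [inner_add_left, real_inner_smul_left, huu, hfu, hvu]
    ring, abs_mul, abs_of_nonneg (sq_nonneg β)] at hle
  have : |a - b| = 0 := by nlinarith [abs_nonneg (a - b)]
  exact sub_eq_zero.1 (abs_eq_zero.1 this)

/-- A body is invariant under rotations about an axis of revolution, in terms of any point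
`c` of the axis. -/
theorem IsAxisOfRevolution.add_mem [FiniteDimensional ℝ E]
    (hE : 3 ≤ Module.finrank ℝ E) {K : Set E} (hK : IsClosed K) (hconv : Convex ℝ K)
    (hint : (interior K).Nonempty) {p u c : E} (h : IsAxisOfRevolution K p u) {s : ℝ}
    (hc : c = p + s • u) {x y : E} (hx : c + x ∈ K) (hn : ‖y‖ = ‖x‖)
    (hi : ⟪y, u⟫ = ⟪x, u⟫) : c + y ∈ K := by
  have hRu : (ℝ ∙ (x - y))ᗮ.reflection u = u := by
    refine Submodule.reflection_mem_subspace_eq_self ?_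
    rw [Submodule.mem_orthogonal_singleton_iff_inner_right, inner_sub_left, hi, sub_self]
  have := h.isometry_mem hE hK hconv hint _ hRu hx
  rwa [hc, show p + s • u + x - p = s • u + x by abel, map_add, map_smul, hRu,
    Submodule.reflection_sub hn.symm, ← add_assoc, ← hc] at this

end

/-- A compact convex body that contains, with any point, the sphere around `c` through this
point, is a ball. -/
theorem Convex.exists_eq_closedBall {E : Type*} [NormedAddCommGroup E] [NormedSpace ℝ E]
    [Nontrivial E] {K : Set E} (hK : IsCompact K) (hconv : Convex ℝ K)
    (hint : (interior K).Nonempty) {c : E}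
    (h : ∀ x y : E, c + x ∈ K → ‖y‖ = ‖x‖ → c + y ∈ K) :
    ∃ r : ℝ, 0 < r ∧ K = closedBall c r := by
  obtain ⟨m, hm, hmax⟩ := hK.exists_isMaxOn (hint.mono interior_subset)
    (f := fun x => dist x c) (by fun_prop)
  have hsub : K ⊆ closedBall c (dist m c) := fun x hx => hmax hx
  have hr : 0 < dist m c := by
    refine dist_nonneg.lt_of_ne' fun h0 => ?_
    rw [h0, closedBall_zero] at hsub
    have := hint.mono (interior_mono hsub)
    rw [interior_singleton] at this
    exact Set.not_nonempty_empty this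
  refine ⟨dist m c, hr, hsub.antisymm fun y hy => ?_⟩
  have hm' : c + (m - c) ∈ K := by simpa using hm
  rw [mem_closedBall, dist_eq_norm] at hy
  rw [dist_eq_norm] at hy hr
  obtain ⟨w, hw, t, ht, hyt⟩ : ∃ w : E, ‖w‖ = ‖m - c‖ ∧
      ∃ t : ℝ, (0 ≤ t ∧ t ≤ 1) ∧ y - c = t • w := by
    rcases eq_or_ne (y - c) 0 with h0 | h0
    · exact ⟨m - c, rfl, 0, by simp, by simp [h0]⟩
    · have hn := norm_pos_iff.2 h0
      refine ⟨(‖m - c‖ / ‖y - c‖) • (y - c), ?_, ‖y - c‖ / ‖m - c‖,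
        ⟨by positivity, div_le_one_of_le₀ hy hr.le⟩, ?_⟩
      · rw [norm_smul, norm_div, norm_norm, norm_norm, div_mul_cancel₀ _ hn.ne']
      · rw [smul_smul, div_mul_div_cancel₀ hr.ne', div_self hn.ne', one_smul]
  have h1 := h _ w hm' hw
  have h2 := h _ (-w) hm' (by rw [norm_neg, hw])
  have := hconv h1 h2 (a := (1 + t) / 2) (b := (1 - t) / 2) (by linarith) (by linarith)
    (by ring)
  convert this using 1
  rw [← sub_add_cancel y c, hyt]
  module

/-- a convex body of revolution `K ⊆ ℝ^n`, `n ≥ 3`, with two different axes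
of revolution must be a ball. -/
theorem two_axes_of_revolution_implies_ball
    (n : ℕ) (hn : 3 ≤ n)
    (K : Set (EuclideanSpace ℝ (Fin n)))
    (hKcompact : IsCompact K) (hKconv : Convex ℝ K) (hKint : (interior K).Nonempty)
    (L₁ L₂ : Set (EuclideanSpace ℝ (Fin n)))
    (hL₁ : IsAxisLineOfRevolution K L₁) (hL₂ : IsAxisLineOfRevolution K L₂)
    (hne : L₁ ≠ L₂) :
    ∃ (c : EuclideanSpace ℝ (Fin n)) (r : ℝ), 0 < r ∧ K = closedBall c r := by
  have hE : 3 ≤ Module.finrank ℝ (EuclideanSpace ℝ (Fin n)) := by simpa using hn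
  have : Nontrivial (EuclideanSpace ℝ (Fin n)) :=
    Module.nontrivial_of_finrank_pos (R := ℝ) (by omega)
  obtain ⟨p, u, hu, rfl⟩ := hL₁
  obtain ⟨q, v, hv, rfl⟩ := hL₂
  obtain ⟨s, hs⟩ := hu.exists_centroid_eq hE hKcompact hKconv hKint
  obtain ⟨t, ht⟩ := hv.exists_centroid_eq hE hKcompact hKconv hKint
  generalize (⨍ x in K, x ∂MeasureTheory.volume) = c at hs ht
  have hp : p = c - s • u := by rw [hs]; abel
  have hq : q = c - t • v := by rw [ht]; abel
  have huv : ⟪u, v⟫ ^ 2 < 1 := by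
    rw [sq_lt_one_iff_abs_lt_one]
    refine lt_of_le_of_ne (by simpa [hu.1, hv.1] using abs_real_inner_le_norm u v) ?_
    intro habs
    apply hne
    rcases eq_or_eq_neg_of_abs_eq habs with h | h
    · obtain rfl := (inner_eq_one_iff_of_norm_eq_one (𝕜 := ℝ) hu.1 hv.1).1 h
      ext x
      refine ⟨fun ⟨a, ha⟩ => ⟨a - s + t, ?_⟩, fun ⟨a, ha⟩ => ⟨a - t + s, ?_⟩⟩ <;>
        rw [ha, hp, hq] <;> module
    · obtain rfl : u = -v := (inner_eq_one_iff_of_norm_eq_one (𝕜 := ℝ) hu.1 (by simp [hv.1])).1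
        (by rw [inner_neg_right, h, neg_neg])
      ext x
      refine ⟨fun ⟨a, ha⟩ => ⟨s - a + t, ?_⟩, fun ⟨a, ha⟩ => ⟨t - a + s, ?_⟩⟩ <;>
        rw [ha, hp, hq] <;> module
  obtain ⟨f, hf, hfu, hfv⟩ := exists_norm_eq_one_inner_eq_zero_inner_eq_zero hE u v
  refine ⟨c, hKconv.exists_eq_closedBall hKcompact hKint fun x y hx hxy => ?_⟩
  have hcl := hKcompact.isClosed
  have hS : IsCompact ((c + ·) ⁻¹' K ∩ sphere 0 ‖x‖) :=
    (isCompact_sphere _ _).inter_left (hcl.preimage (by fun_prop))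
  have hinv : ∀ {p u : EuclideanSpace ℝ (Fin n)} {s : ℝ}, IsAxisOfRevolution K p u →
      c = p + s • u → ∀ x' ∈ (c + ·) ⁻¹' K ∩ sphere 0 ‖x‖, ∀ y, ‖y‖ = ‖x'‖ →
      ⟪y, u⟫ = ⟪x', u⟫ → y ∈ (c + ·) ⁻¹' K ∩ sphere 0 ‖x‖ := by
    intro p u s h hc x' hx' y hy hyu
    refine ⟨h.add_mem hE hcl hKconv hKint hc hx'.1 hy hyu, ?_⟩
    rw [mem_sphere_zero_iff_norm, hy]
    exact mem_sphere_zero_iff_norm.1 hx'.2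
  obtain ⟨z, hz, hzu⟩ := exists_mem_inner_eq hS ⟨x, hx, by simp⟩
    (fun z hz => mem_sphere_zero_iff_norm.1 hz.2) hu.1 hv.1 hf hfu hfv huv
    (hinv hu hs) (hinv hv ht) (b := ⟪y, u⟫) (by
      rw [sq_le_sq, abs_norm, ← hxy]
      simpa [hu.1] using abs_real_inner_le_norm y u)
  exact (hinv hu hs z hz y (by rw [hxy, mem_sphere_zero_iff_norm.1 hz.2]) hzu.symm).1
end

section
/- Let n ≥ 3 and let K ⊂ ℝ^n be an affine body of revolution with axis of revolution the line L. Let Γ be a hyperplane of ℝ^n containing L, and suppose that the section Γ ∩ K is an ellipsoid (in the (n-1)-dimensional affine space Γ). Then K is an ellipsoid. -/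
open Metric
open scoped RealInnerProductSpace

/-- `K` is an affine body of revolution with axis of revolution `L`: `K = g(K₀)` and
`L = g(L₀)` for a bijective affine map `g` and a convex body of revolution `K₀` with
axis the line `L₀`. -/
def IsAffineAxisOfRevolution {E : Type*} [NormedAddCommGroup E] [InnerProductSpace ℝ E]
    (K L : Set E) : Prop :=
  ∃ (g : E ≃ᵃ[ℝ] E) (K₀ L₀ : Set E),
    IsCompact K₀ ∧ Convex ℝ K₀ ∧ (interior K₀).Nonempty ∧
    IsAxisLineOfRevolution K₀ L₀ ∧ K = g '' K₀ ∧ L = g '' L₀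

/-- A quadratic polynomial with sublevel set `[-r, r]` is even. -/
lemma quadratic_even_of_sublevel_eq_Icc {a b c r : ℝ} (hr : 0 < r)
    (h : ∀ s : ℝ, a * s ^ 2 + 2 * s * b + c ≤ 1 ↔ |s| ≤ r) :
    b = 0 ∧ a * r ^ 2 = 1 - c := by
  have hc : Continuous fun s : ℝ => a * s ^ 2 + 2 * s * b + c := by fun_prop
  have h₁ : 1 ≤ a * r ^ 2 + 2 * r * b + c := by
    refine ge_of_tendsto (hc.continuousWithinAt (s := Set.Ioi r) (x := r)) ?_
    filter_upwards [self_mem_nhdsWithin] with s hs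
    by_contra hlt
    have := (abs_le.1 ((h s).1 (not_le.1 hlt).le)).2
    exact absurd hs (not_lt.2 this)
  have h₂ : 1 ≤ a * (-r) ^ 2 + 2 * (-r) * b + c := by
    refine ge_of_tendsto (hc.continuousWithinAt (s := Set.Iio (-r)) (x := -r)) ?_
    filter_upwards [self_mem_nhdsWithin] with s hs
    by_contra hlt
    have := (abs_le.1 ((h s).1 (not_le.1 hlt).le)).1
    exact absurd hs (not_lt.2 this)
  have h₃ := (h r).2 (abs_of_pos hr).le
  have h₄ := (h (-r)).2 (by rw [abs_neg, abs_of_pos hr])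
  have hb : r * b = 0 := by nlinarith
  have hb' : b = 0 := (mul_eq_zero.1 hb).resolve_left hr.ne'
  subst hb'
  exact ⟨rfl, by nlinarith⟩

section InnerProductSpace

variable {E : Type*} [NormedAddCommGroup E] [InnerProductSpace ℝ E]

/-- Scaling by `β` along the line spanned by the unit vector `u` and by `α` orthogonally to it. -/
noncomputable def axialScaling (u : E) (hu : ‖u‖ = 1) (α β : ℝ) (hα : α ≠ 0) (hβ : β ≠ 0) :
    E ≃ₗ[ℝ] E :=
  LinearEquiv.ofLinearMap
    (α • LinearMap.id + (β - α) • (innerₛₗ ℝ u).smulRight u)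
    (α⁻¹ • LinearMap.id + (β⁻¹ - α⁻¹) • (innerₛₗ ℝ u).smulRight u)
    (by
      ext x
      simp [inner_add_right, inner_smul_right, hu]
      match_scalars <;> field_simp
      ring)
    (by
      ext x
      simp [inner_add_right, inner_smul_right, hu]
      match_scalars <;> field_simp
      ring)

lemma axialScaling_apply (u : E) (hu : ‖u‖ = 1) (α β : ℝ) (hα : α ≠ 0) (hβ : β ≠ 0) (x : E) :
    axialScaling u hu α β hα hβ x = α • (x - ⟪x, u⟫ • u) + (β * ⟪x, u⟫) • u := by
  simp [axialScaling, real_inner_comm]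
  module

lemma inner_sub_inner_smul_self {u : E} (hu : ‖u‖ = 1) (x : E) : ⟪x - ⟪x, u⟫ • u, u⟫ = 0 := by
  rw [inner_sub_left, real_inner_smul_left, real_inner_self_eq_norm_sq, hu]
  ring

lemma norm_sq_axialScaling (u : E) (hu : ‖u‖ = 1) (α β : ℝ) (hα : α ≠ 0) (hβ : β ≠ 0) (x : E) :
    ‖axialScaling u hu α β hα hβ x‖ ^ 2 =
      α ^ 2 * ‖x - ⟪x, u⟫ • u‖ ^ 2 + β ^ 2 * ⟪x, u⟫ ^ 2 := by
  rw [axialScaling_apply, norm_add_sq_real, real_inner_smul_left, real_inner_smul_right,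
    inner_sub_inner_smul_self hu, norm_smul, norm_smul, hu]
  simp only [mul_pow, Real.norm_eq_abs, sq_abs, mul_one]
  ring

lemma IsEllipsoid.image {K : Set E} (h : IsEllipsoid K) (g : E ≃ᵃ[ℝ] E) :
    IsEllipsoid (g '' K) := by
  obtain ⟨f, rfl⟩ := h
  exact ⟨f.trans g, by rw [Set.image_image]; rfl⟩

/-- A set defined by a quadratic inequality in the distance to an axis and the height along the
axis is an ellipsoid. -/
lemma isEllipsoid_of_quadratic {K : Set E} {p u : E} (hu : ‖u‖ = 1) {a e b c : ℝ}
    (ha : 0 < a) (he : 0 < e) (hpos : ∃ t : ℝ, e * t ^ 2 + 2 * t * b + c < 1)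
    (hK : ∀ x, x ∈ K ↔ a * ‖x - p - ⟪x - p, u⟫ • u‖ ^ 2 +
      (e * ⟪x - p, u⟫ ^ 2 + 2 * ⟪x - p, u⟫ * b + c) ≤ 1) :
    IsEllipsoid K := by
  obtain ⟨t₀, ht₀⟩ := hpos
  set R : ℝ := 1 - c + b ^ 2 / e with hR
  have hsq : ∀ t : ℝ, e * t ^ 2 + 2 * t * b + c = e * (t + b / e) ^ 2 + (1 - R) := by
    intro t
    rw [hR]
    field_simp
    ring
  have hRpos : 0 < R := by
    have := hsq t₀
    nlinarith [mul_nonneg he.le (sq_nonneg (t₀ + b / e))]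
  have hα : √(a / R) ≠ 0 := (Real.sqrt_pos.2 (div_pos ha hRpos)).ne'
  have hβ : √(e / R) ≠ 0 := (Real.sqrt_pos.2 (div_pos he hRpos)).ne'
  let T := axialScaling u hu _ _ hα hβ
  let φ : E ≃ᵃ[ℝ] E :=
    (AffineEquiv.constVAdd ℝ E (-(p - (b / e) • u))).trans T.toAffineEquiv
  refine ⟨φ.symm, ?_⟩
  ext x
  have hmem : x ∈ φ.symm '' closedBall (0 : E) 1 ↔ ‖φ x‖ ≤ 1 := by
    constructor
    · rintro ⟨y, hy, rfl⟩
      simpa using hy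
    · intro h
      exact ⟨φ x, by simpa using h, by simp⟩
  have hφ : φ x = T (x - p + (b / e) • u) := by
    simp only [φ, AffineEquiv.trans_apply, AffineEquiv.constVAdd_apply, vadd_eq_add,
      LinearEquiv.coe_toAffineEquiv]
    congr 1
    module
  have hin : ⟪x - p + (b / e) • u, u⟫ = ⟪x - p, u⟫ + b / e := by
    rw [inner_add_left, real_inner_smul_left, real_inner_self_eq_norm_sq, hu]
    ring
  have hnorm : ‖φ x‖ ^ 2 =
      (a * ‖x - p - ⟪x - p, u⟫ • u‖ ^ 2 + e * (⟪x - p, u⟫ + b / e) ^ 2) / R := by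
    have hv : x - p + (b / e) • u - (⟪x - p, u⟫ + b / e) • u = x - p - ⟪x - p, u⟫ • u := by
      module
    rw [hφ, norm_sq_axialScaling, hin, hv, Real.sq_sqrt (div_pos ha hRpos).le,
      Real.sq_sqrt (div_pos he hRpos).le]
    ring
  rw [hmem, hK, hsq, ← sq_le_one_iff₀ (norm_nonneg _), hnorm, div_le_one hRpos]
  constructor <;> intro h <;> linarith

/-- A convex body of revolution whose intersection with a plane through the axis is a
nondegenerate quadratic sublevel set is an ellipsoid. -/
lemma IsAxisOfRevolution.isEllipsoid_of_planar_section
    {V : Type*} [NormedAddCommGroup V] [InnerProductSpace ℝ V]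
    {K : Set E} {p u w : E} (hK : IsAxisOfRevolution K p u) (hconv : Convex ℝ K)
    (hint : (interior K).Nonempty) (hw : ‖w‖ = 1) (hwu : ⟪w, u⟫ = 0)
    {z₀ z₁ z₂ : V} (hz₁ : z₁ ≠ 0) (hz₂ : z₂ ≠ 0)
    (hsec : ∀ t s : ℝ, p + t • u + s • w ∈ K ↔ ‖z₀ + t • z₁ + s • z₂‖ ≤ 1) :
    IsEllipsoid K := by
  obtain ⟨hu, hslice⟩ := hK
  have huu : ⟪u, u⟫ = 1 := by rw [real_inner_self_eq_norm_sq, hu]; norm_num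
  set a := ‖z₂‖ ^ 2 with ha_def
  set e := ‖z₁‖ ^ 2 with he_def
  set b := ⟪z₀, z₁⟫ with hb_def
  set c := ‖z₀‖ ^ 2 with hc_def
  have ha : 0 < a := by positivity
  have he : 0 < e := by positivity
  let Q : ℝ → ℝ := fun t => e * t ^ 2 + 2 * t * b + c
  have hQ : Continuous Q := by fun_prop
  let l : ℝ → ℝ := fun t => ⟪z₀, z₂⟫ + t * ⟪z₁, z₂⟫
  have hF : ∀ t s : ℝ, p + t • u + s • w ∈ K ↔ a * s ^ 2 + 2 * s * l t + Q t ≤ 1 := by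
    intro t s
    rw [hsec, ← sq_le_one_iff₀ (norm_nonneg _), norm_add_sq_real, norm_add_sq_real,
      inner_add_left, real_inner_smul_right, real_inner_smul_right, real_inner_smul_right,
      real_inner_smul_left, norm_smul, norm_smul, mul_pow, mul_pow, Real.norm_eq_abs,
      Real.norm_eq_abs, sq_abs, sq_abs]
    simp only [l, Q, a, e, b, c]
    constructor <;> intro h <;> linarith
  have hheight : ∀ t s : ℝ, ⟪p + t • u + s • w - p, u⟫ = t := by
    intro t s
    rw [show p + t • u + s • w - p = t • u + s • w by module, inner_add_left,
      real_inner_smul_left, real_inner_smul_left, huu, hwu]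
    ring
  have hball : ∀ t r : ℝ, 0 < r →
      K ∩ {x | ⟪x - p, u⟫ = t} = {x | ⟪x - p, u⟫ = t ∧ dist x (p + t • u) ≤ r} →
      l t = 0 ∧ a * r ^ 2 = 1 - Q t := by
    intro t r hr h
    refine quadratic_even_of_sublevel_eq_Icc hr fun s => ?_
    have := Set.ext_iff.1 h (p + t • u + s • w)
    simp only [Set.mem_inter_iff, Set.mem_ofPred_eq, hheight, and_true, true_and] at this
    rw [← hF, this, dist_eq_norm, add_sub_cancel_left, norm_smul, hw, mul_one, Real.norm_eq_abs]
  have htwo : ∀ (t : ℝ) (x y : E), x ∈ K → y ∈ K → ⟪x - p, u⟫ = t → ⟪y - p, u⟫ = t → x ≠ y →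
      ∃ r : ℝ, 0 < r ∧
        K ∩ {x | ⟪x - p, u⟫ = t} = {x | ⟪x - p, u⟫ = t ∧ dist x (p + t • u) ≤ r} := by
    intro t x y hx hy hxt hyt hxy
    rcases hslice t with h | ⟨z, h⟩ | h
    · exact absurd h (Set.Nonempty.ne_empty ⟨x, hx, hxt⟩)
    · have h₁ : x ∈ ({z} : Set E) := h ▸ ⟨hx, hxt⟩
      have h₂ : y ∈ ({z} : Set E) := h ▸ ⟨hy, hyt⟩
      exact absurd (h₁.trans h₂.symm) hxy
    · exact h
  have hw0 : w ≠ 0 := by rintro rfl; simp at hw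
  -- An interior point of `K` gives two heights at which the slice is a ball.
  obtain ⟨x₀, hx₀⟩ := hint
  obtain ⟨ε, hε, hεK⟩ := Metric.isOpen_iff.1 isOpen_interior x₀ hx₀
  have hnear : ∀ δ s : ℝ, |δ| + |s| < ε → x₀ + δ • u + s • w ∈ K := by
    intro δ s h
    refine interior_subset (hεK ?_)
    rw [mem_ball, dist_eq_norm, show x₀ + δ • u + s • w - x₀ = δ • u + s • w by module]
    refine (norm_add_le _ _).trans_lt ?_
    simpa [norm_smul, hu, hw] using h
  set t₀ := ⟪x₀ - p, u⟫ with ht₀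
  have hheight₀ : ∀ δ s : ℝ, ⟪x₀ + δ • u + s • w - p, u⟫ = t₀ + δ := by
    intro δ s
    rw [show x₀ + δ • u + s • w - p = (x₀ - p) + δ • u + s • w by module, inner_add_left,
      inner_add_left, real_inner_smul_left, real_inner_smul_left, huu, hwu]
    ring
  have hballs : ∀ δ : ℝ, |δ| < ε / 2 → ∃ r : ℝ, 0 < r ∧ l (t₀ + δ) = 0 ∧
      a * r ^ 2 = 1 - Q (t₀ + δ) := by
    intro δ hδ
    obtain ⟨r, hr, h⟩ := htwo (t₀ + δ) _ _
      (hnear δ 0 (by rw [abs_zero]; linarith))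
      (hnear δ (ε / 4) (by rw [abs_of_pos (by positivity : (0 : ℝ) < ε / 4)]; linarith))
      (hheight₀ _ _) (hheight₀ _ _) (by simp [hw0, hε.ne'])
    exact ⟨r, hr, hball _ r hr h⟩
  obtain ⟨r₀, hr₀, hl₀, hQ₀⟩ := hballs 0 (by rw [abs_zero]; linarith)
  obtain ⟨-, -, hl₁, -⟩ := hballs (ε / 4)
    (by rw [abs_of_pos (by positivity : (0 : ℝ) < ε / 4)]; linarith)
  have hl : ∀ t, l t = 0 := by
    simp only [l] at hl₀ hl₁ ⊢
    have h₁ : ε * ⟪z₁, z₂⟫ = 0 := by linarith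
    have h₂ := (mul_eq_zero.1 h₁).resolve_left hε.ne'
    rw [h₂] at hl₀ ⊢
    intro t
    linarith
  simp only [hl, mul_zero, add_zero] at hF
  rw [add_zero] at hQ₀
  have hQt₀ : Q t₀ < 1 := by
    have : 0 < a * r₀ ^ 2 := by positivity
    linarith
  -- Slices that are a single point lie on the boundary of the quadratic region.
  have hQle : ∀ x ∈ K, Q ⟪x - p, u⟫ ≤ 1 := by
    intro x hx
    set t := ⟪x - p, u⟫ with ht
    have hcont : Continuous fun θ : ℝ => Q ((1 - θ) * t + θ * t₀) := by fun_prop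
    have hlim : Filter.Tendsto (fun θ : ℝ => Q ((1 - θ) * t + θ * t₀)) (nhdsWithin 0 (Set.Ioi 0))
        (nhds (Q t)) := by
      have := hcont.continuousWithinAt (s := Set.Ioi 0) (x := 0)
      simpa [ContinuousWithinAt] using this
    refine le_of_tendsto hlim ?_
    filter_upwards [Ioo_mem_nhdsGT (zero_lt_one (α := ℝ))] with θ hθ
    have hmem : ∀ s : ℝ, |s| < ε → (1 - θ) • x + θ • (x₀ + s • w) ∈ K := fun s hs =>
      hconv hx (by simpa using hnear 0 s (by simpa using hs)) (by linarith [hθ.2]) hθ.1.le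
        (by ring)
    have hh : ∀ s : ℝ, ⟪(1 - θ) • x + θ • (x₀ + s • w) - p, u⟫ = (1 - θ) * t + θ * t₀ := by
      intro s
      rw [show (1 - θ) • x + θ • (x₀ + s • w) - p =
        (1 - θ) • (x - p) + θ • (x₀ - p) + (θ * s) • w by module, inner_add_left, inner_add_left,
        real_inner_smul_left, real_inner_smul_left, real_inner_smul_left, hwu]
      ring
    obtain ⟨r, hr, h⟩ := htwo _ _ _ (hmem 0 (by simpa using hε))
      (hmem (ε / 2) (by rw [abs_of_pos (by positivity : (0 : ℝ) < ε / 2)]; linarith))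
      (hh _) (hh _) (by simp [hw0, hε.ne', hθ.1.ne'])
    have h₁ := (hball _ r hr h).2
    have h₂ : 0 < a * r ^ 2 := by positivity
    linarith
  have haxis : ∀ t : ℝ, Q t ≤ 1 → p + t • u ∈ K := by
    intro t h
    simpa using (hF t 0).2 (by simpa using h)
  have hheight_axis : ∀ t : ℝ, ⟪p + t • u - p, u⟫ = t := by
    intro t
    simpa using hheight t 0
  refine isEllipsoid_of_quadratic (p := p) hu ha he ⟨t₀, hQt₀⟩ fun x => ?_
  change x ∈ K ↔ a * ‖x - p - ⟪x - p, u⟫ • u‖ ^ 2 + Q ⟪x - p, u⟫ ≤ 1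
  set t := ⟪x - p, u⟫ with ht
  have key : p + t • u ∈ K →
      (x ∈ K ↔ a * ‖x - p - t • u‖ ^ 2 + Q t ≤ 1) := by
    intro hpt
    have hnn := norm_nonneg (x - p - t • u)
    rcases hslice t with h | ⟨y, h⟩ | ⟨r, hr, h⟩
    · exact absurd h (Set.Nonempty.ne_empty ⟨p + t • u, hpt, hheight_axis t⟩)
    · have hy : p + t • u = y := by
        have : p + t • u ∈ ({y} : Set E) := h ▸ ⟨hpt, hheight_axis t⟩
        exact this
      have hQt : 1 ≤ Q t := by
        by_contra! hlt
        have hs : p + t • u + √((1 - Q t) / a) • w ∈ K := by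
          rw [hF, Real.sq_sqrt (div_nonneg (by linarith) ha.le), mul_div_cancel₀ _ ha.ne']
          linarith
        have hs' : p + t • u + √((1 - Q t) / a) • w ∈ ({y} : Set E) := h ▸ ⟨hs, hheight _ _⟩
        rw [← hy] at hs'
        have hz : √((1 - Q t) / a) = 0 := by simpa [hw0] using hs'
        exact (Real.sqrt_pos.2 (div_pos (by linarith) ha)).ne' hz
      constructor
      · intro hx
        have hxy : x ∈ ({y} : Set E) := h ▸ ⟨hx, ht.symm⟩
        have hx' : x = p + t • u := hxy.trans hy.symm
        have hz : x - p - t • u = 0 := by rw [sub_sub, sub_eq_zero]; exact hx'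
        have hle := hQle x hx
        rw [hz]
        simpa using hle
      · intro hle
        have hz : ‖x - p - t • u‖ ^ 2 = 0 := by
          have : 0 ≤ a * ‖x - p - t • u‖ ^ 2 := by positivity
          have h0 : a * ‖x - p - t • u‖ ^ 2 = 0 := by linarith
          exact (mul_eq_zero.1 h0).resolve_left ha.ne'
        have hx : x = p + t • u := by
          rw [← sub_eq_zero, ← sub_sub]
          simpa using hz
        exact hx.symm ▸ hpt
    · have hr' := (hball t r hr h).2
      have := Set.ext_iff.1 h x
      simp only [Set.mem_inter_iff, Set.mem_ofPred_eq, ← ht, and_true, true_and] at this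
      rw [this, dist_eq_norm, ← sub_sub, ← sq_le_sq₀ hnn hr.le, ← mul_le_mul_iff_right₀ ha, hr']
      constructor <;> intro h <;> linarith
  constructor
  · intro hx
    exact (key (haxis t (hQle x hx))).1 hx
  · intro hle
    have : 0 ≤ a * ‖x - p - t • u‖ ^ 2 := by positivity
    exact (key (haxis t (by linarith))).2 hle

end InnerProductSpace

/-- let `K ⊆ ℝ^n`, `n ≥ 3`, be an affine body of revolution with axis of
revolution the line `L`, and let `Γ = p + D` be an affine hyperplane containing `L`
(described by a point `p` and an `(n-1)`-dimensional direction subspace `D`, and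
identified with `D` via `v ↦ p + v`).  If the section `Γ ∩ K` is an ellipsoid (in `Γ`),
then `K` is an ellipsoid. -/
theorem elliptical_section_through_axis_implies_ellipsoid
    (n : ℕ) (hn : 3 ≤ n)
    (K L : Set (EuclideanSpace ℝ (Fin n)))
    (hax : IsAffineAxisOfRevolution K L)
    (p : EuclideanSpace ℝ (Fin n))
    (D : Submodule ℝ (EuclideanSpace ℝ (Fin n)))
    (hD : Module.finrank ℝ D = n - 1)
    (hLΓ : L ⊆ {x | x - p ∈ D})
    (hsec : IsEllipsoid {v : D | p + (v : EuclideanSpace ℝ (Fin n)) ∈ K}) :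
    IsEllipsoid K := by
  obtain ⟨g, K₀, L₀, -, hconv, hint, ⟨p₀, u, hrev, rfl⟩, rfl, rfl⟩ := hax
  obtain ⟨h, hh⟩ := hsec
  have hu : ‖u‖ = 1 := hrev.1
  have hline : ∀ t : ℝ, g (p₀ + t • u) - p ∈ D := fun t => hLΓ ⟨_, ⟨t, rfl⟩, rfl⟩
  have hp₀ : g p₀ - p ∈ D := by simpa using hline 0
  have hmap : ∀ v : EuclideanSpace ℝ (Fin n), g (p₀ + v) = g p₀ + g.linear v := by
    intro v
    have := g.map_vadd p₀ v
    rw [vadd_eq_add, vadd_eq_add] at this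
    rw [add_comm p₀, this, add_comm]
  have hgu : g.linear u ∈ D := by
    have h₁ := D.sub_mem (hline 1) hp₀
    rw [hmap] at h₁
    simpa using h₁
  -- A direction of the hyperplane whose preimage is orthogonal to the axis.
  obtain ⟨v, hv, hv0⟩ : ∃ v : D, ⟪u, g.linear.symm (v : EuclideanSpace ℝ (Fin n))⟫ = 0 ∧ v ≠ 0 := by
    let f : D →ₗ[ℝ] ℝ := innerₛₗ ℝ u ∘ₗ g.linear.symm.toLinearMap ∘ₗ D.subtype
    have hker : LinearMap.ker f ≠ ⊥ := LinearMap.ker_ne_bot_of_finrank_lt (by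
      rw [hD, Module.finrank_self]; omega)
    obtain ⟨v, hv, hv0⟩ := (Submodule.ne_bot_iff _).1 hker
    exact ⟨v, by simpa [f] using hv, hv0⟩
  set w₀ := g.linear.symm (v : EuclideanSpace ℝ (Fin n)) with hw₀
  have hw₀0 : w₀ ≠ 0 := by simpa [hw₀] using hv0
  have hgw : g.linear (‖w₀‖⁻¹ • w₀) = ‖w₀‖⁻¹ • (v : EuclideanSpace ℝ (Fin n)) := by
    rw [map_smul, hw₀, LinearEquiv.apply_symm_apply]
  refine IsEllipsoid.image (hrev.isEllipsoid_of_planar_section (w := ‖w₀‖⁻¹ • w₀) hconv hint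
    ?_ ?_ (z₀ := h.symm ⟨g p₀ - p, hp₀⟩) (z₁ := h.symm.linear ⟨g.linear u, hgu⟩)
    (z₂ := h.symm.linear (‖w₀‖⁻¹ • v)) ?_ ?_ fun t s => ?_) g
  · rw [norm_smul, norm_inv, norm_norm, inv_mul_cancel₀ (norm_ne_zero_iff.2 hw₀0)]
  · rw [real_inner_smul_left, real_inner_comm, hv, mul_zero]
  · have hu0 : u ≠ 0 := by rintro rfl; simp at hu
    intro hz
    have h₁ := (LinearEquiv.map_eq_zero_iff _).1 hz
    exact hu0 ((LinearEquiv.map_eq_zero_iff _).1 (congrArg Subtype.val h₁))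
  · intro hz
    have h₁ := (LinearEquiv.map_eq_zero_iff _).1 hz
    exact (smul_ne_zero (inv_ne_zero (norm_ne_zero_iff.2 hw₀0)) hv0) h₁
  · set y : D := t • ⟨g.linear u, hgu⟩ + s • ‖w₀‖⁻¹ • v + ⟨g p₀ - p, hp₀⟩ with hy
    have hyp : p + (y : EuclideanSpace ℝ (Fin n)) = g (p₀ + t • u + s • ‖w₀‖⁻¹ • w₀) := by
      rw [add_assoc, hmap, map_add, map_smul, map_smul, hgw, hy]
      push_cast
      abel
    have hys : h.symm y = h.symm ⟨g p₀ - p, hp₀⟩ + t • h.symm.linear ⟨g.linear u, hgu⟩ +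
        s • h.symm.linear (‖w₀‖⁻¹ • v) := by
      have := h.symm.map_vadd ⟨g p₀ - p, hp₀⟩ (t • ⟨g.linear u, hgu⟩ + s • ‖w₀‖⁻¹ • v)
      rw [vadd_eq_add, vadd_eq_add] at this
      rw [hy, this, map_add, map_smul, map_smul _ s]
      abel
    rw [← hys]
    have hmem := Set.ext_iff.1 hh y
    rw [Set.mem_ofPred_eq, hyp, g.injective.mem_set_image] at hmem
    rw [hmem]
    constructor
    · rintro ⟨z, hz, hzy⟩
      rw [← hzy, AffineEquiv.symm_apply_apply]
      simpa using hz
    · intro hn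
      exact ⟨h.symm y, by simpa using hn, by simp⟩
end

section
/- Let n ≥ 4 and let B ⊂ ℝ^{n+1} be a convex body that is symmetric about the origin (B = -B) and contains the origin in its interior. Suppose that for every n-dimensional linear subspace H of ℝ^{n+1}, the hyperplane section B ∩ H is an affine body of revolution (inside H). Then there exists an n-dimensional linear subspace H₀ of ℝ^{n+1} such that B ∩ H₀ is an ellipsoid. -/
open Metric
open scoped RealInnerProductSpace

/-- A convex body of revolution: a compact convex set with nonempty interior admitting
an axis of revolution. -/
def IsBodyOfRevolution {E : Type*} [NormedAddCommGroup E] [InnerProductSpace ℝ E]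
    (K : Set E) : Prop :=
  IsCompact K ∧ Convex ℝ K ∧ (interior K).Nonempty ∧ ∃ p u : E, IsAxisOfRevolution K p u

/-- An affine body of revolution: the image of a convex body of revolution under a
bijective affine map. -/
def IsAffineBodyOfRevolution {E : Type*} [NormedAddCommGroup E] [InnerProductSpace ℝ E]
    (K : Set E) : Prop :=
  ∃ (g : E ≃ᵃ[ℝ] E) (K₀ : Set E), IsBodyOfRevolution K₀ ∧ K = g '' K₀

section SeminormSections

open Module Submodule Filter Topology

variable {V : Type*} [AddCommGroup V] [Module ℝ V]

/-- The seminorm `p` satisfies the parallelogram law on the subspace `W`. -/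
def ParallelogramOn (p : Seminorm ℝ V) (W : Submodule ℝ V) : Prop :=
  ∀ x ∈ W, ∀ y ∈ W, p (x + y) ^ 2 + p (x - y) ^ 2 = 2 * (p x ^ 2 + p y ^ 2)

/-- On `N ⊔ ℝ ∙ u`, the unit ball of `p` is linearly equivalent to a body of revolution with
axis `ℝ ∙ u` and hyperplane of revolution `N`. -/
structure IsRevolutionPair (p : Seminorm ℝ V) (N : Submodule ℝ V) (u : V) : Prop where
  notMem : u ∉ N
  parallelogram : ParallelogramOn p N
  rotate : ∀ s : ℝ, ∀ y ∈ N, ∀ y' ∈ N, p y = p y' → p (s • u + y) = p (s • u + y')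

variable {p : Seminorm ℝ V} {N M W : Submodule ℝ V} {u v e m : V}

theorem ParallelogramOn.mono (h : ParallelogramOn p N) (hW : W ≤ N) : ParallelogramOn p W :=
  fun x hx y hy => h x (hW hx) y (hW hy)

theorem ParallelogramOn.sq_add_of_eq (h : ParallelogramOn p N) {x y : V} (hx : x ∈ N) (hy : y ∈ N)
    (hxy : p (x + y) = p (x - y)) : p (x + y) ^ 2 = p x ^ 2 + p y ^ 2 := by
  have := h x hx y hy
  rw [← hxy] at this
  linarith

theorem seminorm_smul_sq (p : Seminorm ℝ V) (t : ℝ) (x : V) : p (t • x) ^ 2 = t ^ 2 * p x ^ 2 := by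
  rw [map_smul_eq_mul, mul_pow, Real.norm_eq_abs, sq_abs]

/-- A definite seminorm satisfying the parallelogram law is Euclidean (Jordan–von Neumann). -/
theorem exists_linearEquiv_norm_eq_s11 [FiniteDimensional ℝ V] (p : Seminorm ℝ V)
    (hp : ∀ x, p x = 0 → x = 0) (h : ParallelogramOn p ⊤) :
    ∃ φ : V ≃ₗ[ℝ] EuclideanSpace ℝ (Fin (finrank ℝ V)), ∀ x, ‖φ x‖ = p x := by
  let : Norm V := ⟨p⟩
  have core : NormedSpace.Core ℝ V :=
    { norm_nonneg := fun x => apply_nonneg p x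
      norm_smul := fun c x => map_smul_eq_mul p c x
      norm_triangle := fun x y => map_add_le_add p x y
      norm_eq_zero_iff := fun x => ⟨hp x, fun hx => by rw [hx]; exact map_zero p⟩ }
  let : NormedAddCommGroup V := NormedAddCommGroup.ofCore core
  let : NormedSpace ℝ V := NormedSpace.ofCore core
  let : InnerProductSpace ℝ V := InnerProductSpace.ofNorm ℝ (fun x y => by
    have := h x trivial y trivial
    simp only [sq] at this
    exact this)
  exact ⟨(stdOrthonormalBasis ℝ V).repr.toLinearEquiv, fun x =>
    (stdOrthonormalBasis ℝ V).repr.norm_map x⟩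

theorem ParallelogramOn.exists_linearEquiv [FiniteDimensional ℝ V] (h : ParallelogramOn p N)
    (hp : ∀ x, p x = 0 → x = 0) :
    ∃ φ : N ≃ₗ[ℝ] EuclideanSpace ℝ (Fin (finrank ℝ N)), ∀ x, ‖φ x‖ = p x :=
  exists_linearEquiv_norm_eq_s11 (p.comp N.subtype) (fun x hx => by simpa using hp x hx)
    (fun x _ y _ => h x x.2 y y.2)

/-- Orthogonal projection onto a subspace on which `p` is Euclidean. -/
theorem ParallelogramOn.exists_projection [FiniteDimensional ℝ V] (h : ParallelogramOn p N)
    (hp : ∀ x, p x = 0 → x = 0) (hW : W ≤ N) {x : V} (hx : x ∈ N) :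
    ∃ z ∈ W, ∀ y ∈ W, p (x - z + y) ^ 2 = p (x - z) ^ 2 + p y ^ 2 := by
  obtain ⟨φ, hφ⟩ := h.exists_linearEquiv hp
  let P : Submodule ℝ (EuclideanSpace ℝ (Fin (finrank ℝ N))) :=
    (W.comap N.subtype).map φ.toLinearMap
  obtain ⟨z, hz, hzP⟩ := (P.starProjection_apply_mem (φ ⟨x, hx⟩))
  refine ⟨z, hz, fun y hy => ?_⟩
  have hyP : φ ⟨y, hW hy⟩ ∈ P := ⟨⟨y, hW hy⟩, hy, rfl⟩
  have hperp : ⟪φ ⟨x, hx⟩ - φ z, φ ⟨y, hW hy⟩⟫ = 0 := by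
    have := P.starProjection_inner_eq_zero (φ ⟨x, hx⟩) _ hyP
    rw [← hzP] at this
    exact this
  have key := norm_add_sq_eq_norm_sq_add_norm_sq_real hperp
  rw [← map_sub, ← map_add, hφ, hφ, hφ] at key
  simpa [sq] using key

/-- Reflections in the direction `e` preserving a line of a definite seminorm are unique. -/
theorem eq_zero_of_two_symmetries (p : Seminorm ℝ V) {w e : V} {β : ℝ} (he : p e ≠ 0)
    (h₀ : ∀ t : ℝ, p (w + t • e) = p (w - t • e))
    (h₁ : ∀ t : ℝ, p (w + β • e + t • e) = p (w + β • e - t • e)) : β = 0 := by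
  have hper : ∀ t : ℝ, p (w + (t + 2 * β) • e) = p (w + t • e) := by
    intro t
    have h2 := h₁ (t + β)
    rw [h₀ t]
    convert h2 using 2 <;> module
  have hk : ∀ k : ℕ, p (w + (k * (2 * β)) • e) = p w := by
    intro k
    induction k with
    | zero => simp
    | succ k ih =>
      rw [← ih, ← hper (k * (2 * β))]
      congr 3
      push_cast
      ring
  by_contra hβ
  have hpos : 0 < 2 * |β| * p e := by
    positivity [abs_pos.mpr hβ, lt_of_le_of_ne (apply_nonneg p e) he.symm]
  obtain ⟨k, hk'⟩ := exists_nat_gt (2 * p w / (2 * |β| * p e))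
  rw [div_lt_iff₀ hpos] at hk'
  have h3 : p ((k * (2 * β)) • e) ≤ p (w + (k * (2 * β)) • e) + p w := by
    have := map_sub_le_add p (w + (k * (2 * β)) • e) w
    rwa [add_sub_cancel_left] at this
  rw [hk, map_smul_eq_mul, Real.norm_eq_abs, abs_mul, abs_mul, abs_of_nonneg (Nat.cast_nonneg k),
    abs_two] at h3
  nlinarith

theorem IsRevolutionPair.rotate_neg (h : IsRevolutionPair p N u) {y : V} (hy : y ∈ N) (s : ℝ) :
    p (s • u + y) = p (s • u - y) := by
  rw [sub_eq_add_neg]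
  exact h.rotate s y hy _ (N.neg_mem hy) (map_neg_eq_map p y).symm

theorem IsRevolutionPair.reflect (h : IsRevolutionPair p N u) {y : V} (hy : y ∈ N) (s : ℝ) :
    p (y + s • u) = p (y - s • u) := by
  rw [add_comm, h.rotate_neg hy, ← map_neg_eq_map p, neg_sub]

/-- A pair whose unit ball is elliptical in one plane through the axis is elliptical. -/
theorem IsRevolutionPair.parallelogramOn_of_sq (h : IsRevolutionPair p N u) {Δ : ℝ}
    (hΔ : ∀ s : ℝ, ∀ y ∈ N, p (s • u + y) ^ 2 = Δ * s ^ 2 + p y ^ 2) :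
    ParallelogramOn p (N ⊔ span ℝ {u}) := by
  intro x hx y hy
  obtain ⟨x₁, hx₁, x₂, hx₂, rfl⟩ := mem_sup.mp hx
  obtain ⟨y₁, hy₁, y₂, hy₂, rfl⟩ := mem_sup.mp hy
  obtain ⟨a, rfl⟩ := mem_span_singleton.mp hx₂
  obtain ⟨b, rfl⟩ := mem_span_singleton.mp hy₂
  have e₁ : x₁ + a • u + (y₁ + b • u) = (a + b) • u + (x₁ + y₁) := by module
  have e₂ : x₁ + a • u - (y₁ + b • u) = (a - b) • u + (x₁ - y₁) := by module
  rw [e₁, e₂, add_comm x₁ (a • u), add_comm y₁ (b • u), hΔ _ _ (N.add_mem hx₁ hy₁),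
    hΔ _ _ (N.sub_mem hx₁ hy₁),
    hΔ _ _ hx₁, hΔ _ _ hy₁]
  linarith [h.parallelogram x₁ hx₁ y₁ hy₁]

theorem IsRevolutionPair.map_smul_add_eq (h : IsRevolutionPair p N u) (he : e ∈ N) (hpe : p e = 1)
    (s : ℝ) {y : V} (hy : y ∈ N) {r : ℝ} (hr : 0 ≤ r) (hyr : p y ^ 2 = r ^ 2) :
    p (s • u + y) = p (s • u + r • e) := by
  refine h.rotate s y hy _ (N.smul_mem _ he) ?_
  rw [map_smul_eq_mul, hpe, mul_one, Real.norm_of_nonneg hr]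
  exact (sq_eq_sq₀ (apply_nonneg p y) hr).mp hyr

theorem IsRevolutionPair.parallelogramOn_of_plane (h : IsRevolutionPair p N u)
    (hW : ParallelogramOn p W) (hu : u ∈ W) (heN : e ∈ N) (heW : e ∈ W) (hpe : p e = 1) :
    ParallelogramOn p (N ⊔ span ℝ {u}) := by
  refine h.parallelogramOn_of_sq (Δ := p u ^ 2) fun s y hy => ?_
  rw [h.map_smul_add_eq heN hpe s hy (apply_nonneg p y) rfl,
    hW.sq_add_of_eq (W.smul_mem _ hu) (W.smul_mem _ heW) (h.rotate_neg (N.smul_mem _ heN) s),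
    seminorm_smul_sq, seminorm_smul_sq, hpe]
  ring

/-- Hyperplane sections of bodies of revolution are bodies of revolution. -/
theorem IsRevolutionPair.exists_section [FiniteDimensional ℝ V] (h : IsRevolutionPair p N u)
    (hp : ∀ x, p x = 0 → x = 0) {E : Submodule ℝ V} (hE : E ≤ N ⊔ span ℝ {u}) (hEN : ¬ E ≤ N) :
    ∃ v, IsRevolutionPair p (E ⊓ N) v ∧ E = E ⊓ N ⊔ span ℝ {v} := by
  obtain ⟨x, hxE, hxN⟩ := SetLike.not_le_iff_exists.mp hEN
  obtain ⟨w, hw, u', hu', hx⟩ := mem_sup.mp (hE hxE)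
  obtain ⟨a, rfl⟩ := mem_span_singleton.mp hu'
  obtain ⟨z, hz, hzW⟩ := h.parallelogram.exists_projection hp (inf_le_right : E ⊓ N ≤ N) hw
  have ha : a ≠ 0 := by
    rintro rfl
    exact hxN (by rw [← hx]; simpa using hw)
  have hv : a • u + (w - z) = x - z := by rw [← hx]; abel
  have hvN : x - z ∉ N := fun h' => hxN (by simpa using N.add_mem h' hz.2)
  have hvE : x - z ∈ E := E.sub_mem hxE hz.1
  refine ⟨x - z, ⟨fun h' => hvN h'.2, h.parallelogram.mono inf_le_right, ?_⟩, ?_⟩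
  · intro s y hy y' hy' hyy'
    have key : ∀ y ∈ E ⊓ N, p (s • (w - z) + y) ^ 2 = s ^ 2 * p (w - z) ^ 2 + p y ^ 2 := by
      intro y hy
      rcases eq_or_ne s 0 with rfl | hs
      · simp
      · have := hzW (s⁻¹ • y) (smul_mem _ _ hy)
        rw [show s • (w - z) + y = s • (w - z + s⁻¹ • y) by rw [smul_add, smul_inv_smul₀ hs],
          seminorm_smul_sq, this, seminorm_smul_sq]
        field_simp
    have hwz : ∀ y ∈ E ⊓ N, s • (w - z) + y ∈ N := fun y hy =>
      N.add_mem (N.smul_mem _ (N.sub_mem hw hz.2)) hy.2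
    have := h.rotate (s * a) _ (hwz y hy) _ (hwz y' hy') (by
      rw [← sq_eq_sq₀ (apply_nonneg p _) (apply_nonneg p _), key y hy, key y' hy', hyy'])
    rw [← hv]
    convert this using 2 <;> module
  · refine le_antisymm (fun y hy => ?_)
      (sup_le inf_le_left ((span_singleton_le_iff_mem _ _).mpr hvE))
    obtain ⟨n, hn, u', hu', rfl⟩ := mem_sup.mp (hE hy)
    obtain ⟨b, rfl⟩ := mem_span_singleton.mp hu'
    refine mem_sup.mpr ⟨n + b • u - (b / a) • (x - z), ⟨E.sub_mem hy (E.smul_mem _ hvE), ?_⟩,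
      (b / a) • (x - z), smul_mem _ _ (mem_span_singleton_self _), by abel⟩
    have : n + b • u - (b / a) • (x - z) = n - (b / a) • (w - z) := by
      rw [← hv, smul_add, smul_smul, div_mul_cancel₀ _ ha]
      abel
    rw [this]
    exact N.sub_mem hn (N.smul_mem _ (N.sub_mem hw hz.2))

/-- Along a common vector `e` of two hyperplanes of revolution, `e` is orthogonal to the component
of one axis in the other hyperplane. -/
theorem IsRevolutionPair.sq_add_smul_common [FiniteDimensional ℝ V] (hN : IsRevolutionPair p N u)
    (hM : IsRevolutionPair p M v) (hp : ∀ x, p x = 0 → x = 0) (heN : e ∈ N) (heM : e ∈ M)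
    (he : p e = 1) (hm : m ∈ M) {κ : ℝ} (hu : u = m + κ • v) (s t : ℝ) :
    p (s • m + t • e) ^ 2 = s ^ 2 * p m ^ 2 + t ^ 2 := by
  obtain ⟨z, hz, hze⟩ := hM.parallelogram.exists_projection hp
    ((span_singleton_le_iff_mem _ _).mpr heM) hm
  obtain ⟨β, rfl⟩ := mem_span_singleton.mp hz
  have hβ : β = 0 := by
    refine eq_zero_of_two_symmetries p (w := m - β • e + κ • v) (e := e)
      (by rw [he]; exact one_ne_zero) ?_ ?_
    · intro t
      have h₁ : m - β • e ∈ M := M.sub_mem hm (M.smul_mem _ heM)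
      have h₂ := hM.rotate κ _ (M.add_mem h₁ (M.smul_mem t heM)) _
        (M.add_mem h₁ (M.smul_mem (-t) heM)) (by
          rw [← sq_eq_sq₀ (apply_nonneg p _) (apply_nonneg p _),
            hze _ (smul_mem _ _ (mem_span_singleton_self e)),
            hze _ (smul_mem _ _ (mem_span_singleton_self e)), seminorm_smul_sq, seminorm_smul_sq,
            neg_sq])
      convert h₂ using 2 <;> module
    · intro t
      have h₂ := hN.rotate_neg (N.smul_mem t heN) 1
      rw [hu] at h₂
      convert h₂ using 2 <;> module
  subst hβ
  rcases eq_or_ne s 0 with rfl | hs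
  · simp [seminorm_smul_sq, he]
  · have := hze ((s⁻¹ * t) • e) (smul_mem _ _ (mem_span_singleton_self e))
    rw [zero_smul, sub_zero] at this
    rw [show s • m + t • e = s • (m + (s⁻¹ * t) • e) by
      rw [smul_add, smul_smul, mul_inv_cancel_left₀ hs], seminorm_smul_sq, this,
      seminorm_smul_sq, he]
    field_simp

theorem IsRevolutionPair.map_transfer [FiniteDimensional ℝ V] (hN : IsRevolutionPair p N u)
    (hM : IsRevolutionPair p M v) (hp : ∀ x, p x = 0 → x = 0) (heN : e ∈ N) (heM : e ∈ M)
    (he : p e = 1) (hm : m ∈ M) {κ : ℝ} (hu : u = m + κ • v) (s t : ℝ) :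
    p (s • u + t • e) = p ((s * κ) • v + √(s ^ 2 * p m ^ 2 + t ^ 2) • e) := by
  have h₁ : p (s • u + t • e) = p ((s * κ) • v + (s • m + t • e)) := by
    rw [hu]
    congr 1
    module
  rw [h₁]
  refine hM.map_smul_add_eq heM he _ (M.add_mem (M.smul_mem _ hm) (M.smul_mem _ heM))
    (Real.sqrt_nonneg _) ?_
  rw [Real.sq_sqrt (by positivity), hN.sq_add_smul_common hM hp heN heM he hm hu]

theorem IsRevolutionPair.abs_mul_le (hM : IsRevolutionPair p M v) (hm : m ∈ M) {κ : ℝ}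
    (hu : u = m + κ • v) : |κ| * p v ≤ p u := by
  have h₁ := hM.reflect hm κ
  have h₂ := map_sub_le_add p (m + κ • v) (m - κ • v)
  rw [← h₁, ← hu, show u - (m - κ • v) = (2 * κ) • v by rw [hu]; module, map_smul_eq_mul,
    Real.norm_eq_abs, abs_mul, abs_two] at h₂
  linarith

/-- Hyperplanes of revolution with the same axis coincide. -/
theorem IsRevolutionPair.le_of_axis_eq (hN : IsRevolutionPair p N u)
    (hM : IsRevolutionPair p M v) (hp : ∀ x, p x = 0 → x = 0)
    (hNM : N ≤ M ⊔ span ℝ {v}) {κ : ℝ} (hu : v = κ • u) : N ≤ M := by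
  intro x hx
  obtain ⟨y, hy, v', hv', rfl⟩ := mem_sup.mp (hNM hx)
  obtain ⟨β, rfl⟩ := mem_span_singleton.mp hv'
  have hv : p v ≠ 0 := fun h => hM.notMem (by rw [hp v h]; exact M.zero_mem)
  have hβ : β = 0 := eq_zero_of_two_symmetries p hv (w := y) (fun t => hM.reflect hy t)
    (fun t => by
      have := hN.reflect hx (t * κ)
      rwa [mul_smul, ← hu] at this)
  simpa [hβ] using hy

theorem le_zero_of_forall_nat_mul_le {a C : ℝ} (h : ∀ k : ℕ, k * a ≤ C) : a ≤ 0 := by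
  by_contra! ha
  obtain ⟨k, hk⟩ := exists_nat_gt (C / a)
  rw [div_lt_iff₀ ha] at hk
  exact (h k).not_gt hk

/-- A body with two different hyperplanes of revolution is an ellipsoid. -/
theorem IsRevolutionPair.parallelogramOn_or_eq [FiniteDimensional ℝ V]
    (hN : IsRevolutionPair p N u) (hM : IsRevolutionPair p M v) (hp : ∀ x, p x = 0 → x = 0)
    (hNM : N ⊔ span ℝ {u} = M ⊔ span ℝ {v}) (heN : e ∈ N) (heM : e ∈ M) (he : p e = 1) :
    ParallelogramOn p (N ⊔ span ℝ {u}) ∨ N = M := by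
  obtain ⟨m, hm, v', hv', hu⟩ := mem_sup.mp
    (hNM ▸ (mem_sup_right (mem_span_singleton_self u) : u ∈ N ⊔ span ℝ {u}))
  obtain ⟨κ, rfl⟩ := mem_span_singleton.mp hv'
  obtain ⟨n, hn, u', hu', hv⟩ := mem_sup.mp
    (hNM ▸ (mem_sup_right (mem_span_singleton_self v) : v ∈ M ⊔ span ℝ {v}))
  obtain ⟨κ', rfl⟩ := mem_span_singleton.mp hu'
  have hpu : 0 < p u := lt_of_le_of_ne (apply_nonneg p u)
    fun h => hN.notMem (by rw [hp u h.symm]; exact N.zero_mem)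
  set τ := κ * κ' with hτ
  set δ := κ ^ 2 * p n ^ 2 + p m ^ 2 with hδ
  have hδ₀ : 0 ≤ δ := by positivity
  have step : ∀ s t : ℝ, p (s • u + t • e) = p ((s * τ) • u + √(δ * s ^ 2 + t ^ 2) • e) := by
    intro s t
    rw [hN.map_transfer hM hp heN heM he hm hu.symm, hM.map_transfer hN hp heM heN he hn hv.symm,
      Real.sq_sqrt (by positivity), hτ, hδ, mul_assoc]
    congr 4
    ring
  have hτ₁ : |τ| ≤ 1 := by
    have h₁ := hM.abs_mul_le hm hu.symm
    have h₂ := hN.abs_mul_le hn hv.symm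
    rw [hτ, abs_mul]
    refine le_of_mul_le_mul_right ?_ hpu
    nlinarith [abs_nonneg κ]
  have hτ₂ : τ ^ 2 ≤ 1 := (sq_le_one_iff_abs_le_one τ).mpr hτ₁
  rcases hτ₁.lt_or_eq with hlt | heq
  · left
    have hτ₃ : τ ^ 2 < 1 := (sq_lt_one_iff_abs_lt_one τ).mpr hlt
    set Δ := δ / (1 - τ ^ 2) with hΔ
    have hΔ₀ : 0 ≤ Δ := div_nonneg hδ₀ (by linarith)
    have hΔδ : δ = Δ * (1 - τ ^ 2) := by rw [hΔ, div_mul_cancel₀]; linarith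
    refine hN.parallelogramOn_of_sq (Δ := Δ) fun s y hy => ?_
    have iter : ∀ k : ℕ, p (s • u + y) =
        p ((s * τ ^ k) • u + √(Δ * s ^ 2 * (1 - (τ ^ k) ^ 2) + p y ^ 2) • e) := by
      intro k
      have hk : (τ ^ k) ^ 2 ≤ 1 := by
        rw [← pow_mul, mul_comm, pow_mul]
        exact pow_le_one₀ (sq_nonneg _) hτ₂
      induction k with
      | zero =>
        simpa [Real.sqrt_sq (apply_nonneg p y)] using
          hN.map_smul_add_eq heN he s hy (apply_nonneg p y) rfl
      | succ k ih =>
        have hk' : (τ ^ k) ^ 2 ≤ 1 := by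
          rw [← pow_mul, mul_comm, pow_mul]
          exact pow_le_one₀ (sq_nonneg _) hτ₂
        rw [ih hk', step, Real.sq_sqrt (by
          have : 0 ≤ 1 - (τ ^ k) ^ 2 := by linarith
          positivity), mul_assoc s, ← pow_succ]
        congr 4
        rw [hΔδ]
        ring
    have lim₀ : Tendsto (fun k : ℕ => τ ^ k) atTop (𝓝 0) :=
      tendsto_pow_atTop_nhds_zero_of_abs_lt_one hlt
    have lim₁ : Tendsto (fun k : ℕ => |s * τ ^ k|) atTop (𝓝 0) := by
      simpa using (lim₀.const_mul s).abs
    have lim₂ : Tendsto (fun k : ℕ => √(Δ * s ^ 2 * (1 - (τ ^ k) ^ 2) + p y ^ 2)) atTop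
        (𝓝 (√(Δ * s ^ 2 + p y ^ 2))) := by
      have := ((((lim₀.pow 2).const_sub 1).const_mul (Δ * s ^ 2)).add_const (p y ^ 2)).sqrt
      simpa using this
    have bound : ∀ a b : ℝ, 0 ≤ b → |p (a • u + b • e) - b| ≤ |a| * p u := by
      intro a b hb
      have h₁ := abs_sub_map_le_sub p (a • u + b • e) (b • e)
      rwa [add_sub_cancel_right, map_smul_eq_mul, map_smul_eq_mul, he, mul_one,
        Real.norm_of_nonneg hb, Real.norm_eq_abs] at h₁
    have hlim : Tendsto (fun k : ℕ => √(Δ * s ^ 2 * (1 - (τ ^ k) ^ 2) + p y ^ 2)) atTop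
        (𝓝 (p (s • u + y))) := by
      rw [tendsto_iff_dist_tendsto_zero]
      refine squeeze_zero (fun _ => dist_nonneg) (g := fun k : ℕ => |s * τ ^ k| * p u)
        (fun k => ?_) ?_
      · have := bound (s * τ ^ k) _ (Real.sqrt_nonneg (Δ * s ^ 2 * (1 - (τ ^ k) ^ 2) + p y ^ 2))
        rwa [← iter k, abs_sub_comm] at this
      · simpa only [zero_mul] using lim₁.mul_const (p u)
    rw [tendsto_nhds_unique hlim lim₂, Real.sq_sqrt (by positivity)]
  · right
    have hτ₃ : τ ^ 2 = 1 := by rw [← sq_abs, heq, one_pow]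
    have iter : ∀ k : ℕ, p (τ ^ k • u + √(k * δ) • e) = p u := by
      intro k
      induction k with
      | zero => simp
      | succ k ih =>
        rw [← ih, step (τ ^ k), Real.sq_sqrt (by positivity), ← pow_mul, mul_comm k 2, pow_mul, hτ₃,
          one_pow, pow_succ]
        congr 4
        push_cast
        ring
    have hδ₁ : δ ≤ 0 := by
      refine le_zero_of_forall_nat_mul_le (C := (2 * p u) ^ 2) fun k => ?_
      have h₁ := map_sub_le_add p (τ ^ k • u + √(k * δ) • e) (τ ^ k • u)
      rw [add_sub_cancel_left, iter k, map_smul_eq_mul, map_smul_eq_mul, he, mul_one,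
        Real.norm_of_nonneg (Real.sqrt_nonneg _), norm_pow, Real.norm_eq_abs, heq, one_pow, one_mul,
        ← two_mul] at h₁
      exact (Real.sqrt_le_left (by positivity)).mp h₁
    have hm₀ : m = 0 := hp m (by
      nlinarith [sq_nonneg (p m), mul_nonneg (sq_nonneg κ) (sq_nonneg (p n))])
    rw [hm₀, zero_add] at hu
    have hκ : κ ≠ 0 := by
      rintro rfl
      rw [zero_smul] at hu
      exact hN.notMem (hu ▸ N.zero_mem)
    refine le_antisymm ?_ ?_
    · exact hN.le_of_axis_eq hM hp (hNM ▸ le_sup_left) (κ := κ⁻¹) (by rw [← hu, inv_smul_smul₀ hκ])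
    · exact hM.le_of_axis_eq hN hp (hNM ▸ le_sup_left) hu.symm

theorem exists_le_finrank_eq [FiniteDimensional ℝ V] {k : ℕ} (hk : k ≤ finrank ℝ V)
    (W : Submodule ℝ V) (hW : finrank ℝ W ≤ k) :
    ∃ H : Submodule ℝ V, W ≤ H ∧ finrank ℝ H = k := by
  induction k with
  | zero => exact ⟨W, le_rfl, Nat.le_zero.mp hW⟩
  | succ k ih =>
    rcases hW.lt_or_eq with hlt | heq
    · obtain ⟨H, hWH, hH⟩ := ih (by omega) (by omega)
      obtain ⟨x, -, hx⟩ := SetLike.exists_of_lt (lt_top_iff_ne_top.mpr fun h : H = ⊤ => by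
        rw [h, finrank_top] at hH
        omega)
      exact ⟨H ⊔ span ℝ {x}, hWH.trans le_sup_left, by rw [finrank_sup_span_singleton hx, hH]⟩
    · exact ⟨W, le_rfl, heq⟩

theorem exists_finrank_eq_of_forall_mem [FiniteDimensional ℝ V] {k : ℕ} (hk₃ : 3 ≤ k)
    (hk : k ≤ finrank ℝ V) (x y z : V) :
    ∃ H : Submodule ℝ V, finrank ℝ H = k ∧ x ∈ H ∧ y ∈ H ∧ z ∈ H := by
  classical
  obtain ⟨H, hle, hH⟩ := exists_le_finrank_eq hk (span ℝ (({x, y, z} : Finset V) : Set V))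
    ((finrank_span_finset_le_card _).trans (Finset.card_le_three.trans hk₃))
  have := span_le.mp hle
  exact ⟨H, hH, this (by simp), this (by simp), this (by simp)⟩

theorem le_finrank_inf [FiniteDimensional ℝ V] (A C : Submodule ℝ V) :
    finrank ℝ A + finrank ℝ C ≤ finrank ℝ (A ⊓ C : Submodule ℝ V) + finrank ℝ V := by
  have h₁ := finrank_sup_add_finrank_inf_eq A C
  have h₂ := finrank_le (A ⊔ C)
  omega

theorem exists_mem_seminorm_eq_one (hp : ∀ x, p x = 0 → x = 0) {A : Submodule ℝ V}
    (hA : 0 < finrank ℝ A) : ∃ e ∈ A, p e = 1 := by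
  obtain ⟨x, hx, hx₀⟩ := A.ne_bot_iff.mp (fun h => by
    rw [h, finrank_bot] at hA
    exact hA.false)
  have hpx : p x ≠ 0 := fun h => hx₀ (hp x h)
  exact ⟨(p x)⁻¹ • x, A.smul_mem _ hx, by
    rw [map_smul_eq_mul, Real.norm_of_nonneg (inv_nonneg.mpr (apply_nonneg p x)),
      inv_mul_cancel₀ hpx]⟩

/-- If all hyperplane sections are bodies of revolution, then some hyperplane section is an
ellipsoid. -/
theorem exists_parallelogramOn_hyperplane [FiniteDimensional ℝ V] (hp : ∀ x, p x = 0 → x = 0)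
    {n : ℕ} (hn : 4 ≤ n) (hV : finrank ℝ V = n + 1)
    (hsec : ∀ H : Submodule ℝ V, finrank ℝ H = n →
      ∃ N u, IsRevolutionPair p N u ∧ N ⊔ span ℝ {u} = H) :
    ∃ H : Submodule ℝ V, finrank ℝ H = n ∧ ParallelogramOn p H := by
  by_contra! hcon
  choose! N u hrev hspan using hsec
  have hdim : ∀ H : Submodule ℝ V, finrank ℝ H = n → finrank ℝ (N H) + 1 = n := by
    intro H hH
    rw [← finrank_sup_span_singleton (hrev H hH).notMem, hspan H hH, hH]
  have hle : ∀ H : Submodule ℝ V, finrank ℝ H = n → N H ≤ H := fun H hH =>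
    le_sup_left.trans (hspan H hH).le
  obtain ⟨H₁, -, hH₁⟩ := exists_le_finrank_eq (V := V) (k := n) (by omega) ⊥ (by simp)
  set l := u H₁
  have hlH₁ : l ∈ H₁ := hspan H₁ hH₁ ▸ mem_sup_right (mem_span_singleton_self l)
  have hcompat : ∀ A C : Submodule ℝ V, finrank ℝ A = n → finrank ℝ C = n → l ∈ A → l ∈ C →
      ∀ x ∈ N A, x ∈ C → x ∈ N C := by
    intro A C hA hC hlA hlC x hxA hxC
    by_cases hAC : A = C
    · exact hAC ▸ hxA
    have hE := le_finrank_inf A C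
    obtain ⟨e, ⟨heE, heN⟩, he⟩ := exists_mem_seminorm_eq_one hp (A := (A ⊓ C) ⊓ N H₁) (by
      have := le_finrank_inf (A ⊓ C) (N H₁)
      have := hdim H₁ hH₁
      omega)
    have hEnot : ¬ ParallelogramOn p (A ⊓ C) := fun h => hcon H₁ hH₁ (hspan H₁ hH₁ ▸
      (hrev H₁ hH₁).parallelogramOn_of_plane h ⟨hlA, hlC⟩ heN heE he)
    obtain ⟨v, hv, hvE⟩ := (hrev A hA).exists_section hp (E := A ⊓ C)
      (by rw [hspan A hA]; exact inf_le_left)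
      (fun h => hEnot ((hrev A hA).parallelogram.mono h))
    obtain ⟨w, hw, hwE⟩ := (hrev C hC).exists_section hp (E := A ⊓ C)
      (by rw [hspan C hC]; exact inf_le_right)
      (fun h => hEnot ((hrev C hC).parallelogram.mono h))
    have hv₁ := finrank_sup_span_singleton hv.notMem
    have hw₁ := finrank_sup_span_singleton hw.notMem
    rw [← hvE] at hv₁
    rw [← hwE] at hw₁
    obtain ⟨f, ⟨hfA, hfC⟩, hf⟩ :=
      exists_mem_seminorm_eq_one hp (A := (A ⊓ C ⊓ N A) ⊓ (A ⊓ C ⊓ N C)) (by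
        have h₁ := finrank_sup_add_finrank_inf_eq (A ⊓ C ⊓ N A) (A ⊓ C ⊓ N C)
        have h₂ := finrank_mono (sup_le inf_le_left inf_le_left :
          (A ⊓ C ⊓ N A) ⊔ (A ⊓ C ⊓ N C) ≤ A ⊓ C)
        omega)
    rcases hv.parallelogramOn_or_eq hw hp (hvE.symm.trans hwE) hfA hfC hf with h | h
    · rw [← hvE] at h
      exact (hEnot h).elim
    · have : x ∈ A ⊓ C ⊓ N A := ⟨⟨hle A hA hxA, hxC⟩, hxA⟩
      rw [h] at this
      exact this.2
  have hlN : ∀ H : Submodule ℝ V, finrank ℝ H = n → l ∈ H → l ∉ N H := fun H hH hlH h =>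
    (hrev H₁ hH₁).notMem (hcompat H H₁ hH hH₁ hlH hlH₁ l h hlH₁)
  have hjoint : ∀ x y : V, (∃ H : Submodule ℝ V, finrank ℝ H = n ∧ l ∈ H ∧ x ∈ N H) →
      (∃ H : Submodule ℝ V, finrank ℝ H = n ∧ l ∈ H ∧ y ∈ N H) →
      ∃ H : Submodule ℝ V, finrank ℝ H = n ∧ l ∈ H ∧ x ∈ N H ∧ y ∈ N H := by
    rintro x y ⟨A, hA, hlA, hx⟩ ⟨C, hC, hlC, hy⟩
    obtain ⟨D, hD, hlD, hxD, hyD⟩ :=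
      exists_finrank_eq_of_forall_mem (k := n) (by omega) (by omega) l x y
    exact ⟨D, hD, hlD, hcompat A D hA hD hlA hlD x hx hxD, hcompat C D hC hD hlC hlD y hy hyD⟩
  let G : Submodule ℝ V :=
    { carrier := {x | ∃ H : Submodule ℝ V, finrank ℝ H = n ∧ l ∈ H ∧ x ∈ N H}
      zero_mem' := ⟨H₁, hH₁, hlH₁, zero_mem _⟩
      add_mem' := fun {x y} hx hy => by
        obtain ⟨D, hD, hlD, hxD, hyD⟩ := hjoint x y hx hy
        exact ⟨D, hD, hlD, add_mem hxD hyD⟩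
      smul_mem' := fun c x ⟨H, hH, hlH, hx⟩ => ⟨H, hH, hlH, smul_mem _ c hx⟩ }
  have hlG : l ∉ G := fun ⟨H, hH, hlH, h⟩ => hlN H hH hlH h
  have hGtop : G ⊔ span ℝ {l} = ⊤ := by
    rw [eq_top_iff]
    intro x _
    obtain ⟨D, hD, hlD, hxD, -⟩ :=
      exists_finrank_eq_of_forall_mem (k := n) (by omega) (by omega) l x x
    have hDsup : N D ⊔ span ℝ {l} = D := by
      refine eq_of_le_of_finrank_eq
        (sup_le (hle D hD) ((span_singleton_le_iff_mem _ _).mpr hlD)) ?_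
      rw [finrank_sup_span_singleton (hlN D hD hlD), hdim D hD, hD]
    have hNG : N D ≤ G := fun y hy => ⟨D, hD, hlD, hy⟩
    exact sup_le_sup_right hNG _ (hDsup.symm ▸ hxD)
  refine hcon G ?_ ?_
  · have := finrank_sup_span_singleton hlG
    rw [hGtop, finrank_top] at this
    omega
  · intro x hx y hy
    obtain ⟨D, hD, -, hxD, hyD⟩ := hjoint x y hx hy
    exact (hrev D hD).parallelogram x hxD y hyD

end SeminormSections

section BodiesOfRevolution

open Module Submodule Filter Topology

variable {F : Type*} [NormedAddCommGroup F] [InnerProductSpace ℝ F] {K : Set F} {p u : F}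

theorem IsAxisOfRevolution.exists_slice_eq (h : IsAxisOfRevolution K p u) {x e : F} (hx : x ∈ K)
    (he : e ≠ 0) (heu : ⟪e, u⟫ = 0) (hxe : x + e ∈ K) :
    ∃ r : ℝ, 0 < r ∧ K ∩ {z | ⟪z - p, u⟫ = ⟪x - p, u⟫} =
      {z | ⟪z - p, u⟫ = ⟪x - p, u⟫ ∧ dist z (p + ⟪x - p, u⟫ • u) ≤ r} := by
  have h₁ : x ∈ K ∩ {z | ⟪z - p, u⟫ = ⟪x - p, u⟫} := ⟨hx, rfl⟩
  have h₂ : x + e ∈ K ∩ {z | ⟪z - p, u⟫ = ⟪x - p, u⟫} :=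
    ⟨hxe, by rw [Set.mem_ofPred_eq, add_sub_right_comm, inner_add_left, heu, add_zero]⟩
  rcases h.2 ⟪x - p, u⟫ with h' | ⟨z, h'⟩ | h'
  · rw [h'] at h₁
    exact h₁.elim
  · rw [h', Set.mem_singleton_iff] at h₁ h₂
    rw [← h₁] at h₂
    exact (he (by simpa using h₂)).elim
  · exact h'

theorem IsAxisOfRevolution.mem_of_norm_eq (h : IsAxisOfRevolution K p u) {x x' e : F} (hx : x ∈ K)
    (he : e ≠ 0) (heu : ⟪e, u⟫ = 0) (hxe : x + e ∈ K) (hx' : ⟪x' - p, u⟫ = ⟪x - p, u⟫)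
    (hn : dist x' (p + ⟪x - p, u⟫ • u) = dist x (p + ⟪x - p, u⟫ • u)) : x' ∈ K := by
  obtain ⟨r, -, hr⟩ := h.exists_slice_eq hx he heu hxe
  have h₁ : x ∈ K ∩ {z | ⟪z - p, u⟫ = ⟪x - p, u⟫} := ⟨hx, rfl⟩
  rw [hr] at h₁
  have h₂ : x' ∈ K ∩ {z | ⟪z - p, u⟫ = ⟪x - p, u⟫} := by
    rw [hr]
    exact ⟨hx', hn.trans_le h₁.2⟩
  exact h₂.1

/-- The center of symmetry of a body of revolution lies on its axis. -/
theorem IsAxisOfRevolution.center_eq (h : IsAxisOfRevolution K p u) {c e : F} (hc : c ∈ K)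
    (he : e ≠ 0) (heu : ⟪e, u⟫ = 0) (hce : c + e ∈ K) (hsym : ∀ x, c + x ∈ K → c - x ∈ K) :
    c = p + ⟪c - p, u⟫ • u := by
  obtain ⟨r, hr₀, hr⟩ := h.exists_slice_eq hc he heu hce
  set t := ⟪c - p, u⟫ with ht
  set d := c - (p + t • u) with hd
  have huu : ⟪u, u⟫ = 1 := by rw [real_inner_self_eq_norm_sq, h.1, one_pow]
  have hdu : ⟪d, u⟫ = 0 := by
    rw [hd, ← sub_sub, inner_sub_left, real_inner_smul_left, huu, ← ht]
    ring
  by_contra hne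
  have hd₀ : d ≠ 0 := fun h' => hne (sub_eq_zero.mp h')
  have hdn : 0 < ‖d‖ := norm_pos_iff.mpr hd₀
  set a := r / ‖d‖ with ha
  have ha₀ : 0 < a := div_pos hr₀ hdn
  have hcd : c = p + t • u + d := by rw [hd]; abel
  have hslice : ∀ b : ℝ, ⟪p + t • u + b • d - p, u⟫ = t := by
    intro b
    rw [show p + t • u + b • d - p = t • u + b • d by abel, inner_add_left, real_inner_smul_left,
      real_inner_smul_left, huu, hdu]
    ring
  have hdist : ∀ b : ℝ, dist (p + t • u + b • d) (p + t • u) = |b| * ‖d‖ := by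
    intro b
    rw [dist_eq_norm, add_sub_cancel_left, norm_smul, Real.norm_eq_abs]
  have h₁ : p + t • u + (-a) • d ∈ K := by
    have : p + t • u + (-a) • d ∈ K ∩ {z | ⟪z - p, u⟫ = t} := by
      rw [hr]
      exact ⟨hslice _, by
        rw [hdist, abs_neg, abs_of_pos ha₀, ha, div_mul_cancel₀ _ hdn.ne']⟩
    exact this.1
  have h₂ : p + t • u + (2 + a) • d ∈ K := by
    have := hsym ((-a - 1) • d) (by convert h₁ using 1; rw [hcd]; module)
    convert this using 1
    rw [hcd]
    module
  have h₃ : p + t • u + (2 + a) • d ∈ K ∩ {z | ⟪z - p, u⟫ = t} := ⟨h₂, hslice _⟩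
  rw [hr] at h₃
  have h₄ := h₃.2
  rw [hdist, abs_of_pos (by positivity), add_mul, ha, div_mul_cancel₀ _ hdn.ne'] at h₄
  linarith

theorem exists_norm_eq_one_inner_eq_zero [FiniteDimensional ℝ F] (hF : 2 ≤ finrank ℝ F) (u : F) :
    ∃ e, ‖e‖ = 1 ∧ ⟪e, u⟫ = 0 := by
  have hpos : 0 < finrank ℝ (span ℝ {u})ᗮ := by
    have h₁ := (span ℝ {u}).finrank_add_finrank_orthogonal
    have h₂ := finrank_span_le_card (R := ℝ) ({u} : Set F)
    rw [Set.toFinset_singleton, Finset.card_singleton] at h₂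
    omega
  have := Module.nontrivial_of_finrank_pos hpos
  obtain ⟨e, he⟩ := exists_norm_eq (span ℝ {u})ᗮ zero_le_one
  exact ⟨e, he, mem_orthogonal_singleton_iff_inner_left.mp e.2⟩

/-- A symmetric affine body of revolution is linearly equivalent to a body of revolution. -/
theorem IsAffineBodyOfRevolution.exists_gauge_eq [FiniteDimensional ℝ F]
    (hK : IsAffineBodyOfRevolution K) (hconv : Convex ℝ K) (hsym : ∀ x ∈ K, -x ∈ K)
    (h₀ : K ∈ 𝓝 0) (hF : 2 ≤ finrank ℝ F) :
    ∃ (A : F ≃ₗ[ℝ] F) (u : F), ‖u‖ = 1 ∧ ∀ (s : ℝ) (y y' : F), ⟪y, u⟫ = 0 → ⟪y', u⟫ = 0 →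
      ‖y‖ = ‖y'‖ → gauge K (A (s • u + y)) = gauge K (A (s • u + y')) := by
  obtain ⟨g, K₀, ⟨-, -, -, p, u, hax⟩, hKg⟩ := hK
  set c := g.symm 0 with hc
  have hmem : ∀ z, g.linear z ∈ K ↔ c + z ∈ K₀ := by
    intro z
    have : g (c + z) = g.linear z := by
      have := g.map_vadd c z
      rw [vadd_eq_add, vadd_eq_add, hc, g.apply_symm_apply, add_zero, add_comm] at this
      rw [hc, this]
    rw [hKg, ← this, g.injective.mem_set_image]
  have huu : ⟪u, u⟫ = 1 := by rw [real_inner_self_eq_norm_sq, hax.1, one_pow]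
  obtain ⟨e, he₁, heu⟩ := exists_norm_eq_one_inner_eq_zero hF u
  have he : e ≠ 0 := norm_ne_zero_iff.mp (by simp [he₁])
  have hstep : ∀ z, K ∈ 𝓝 (g.linear z) → ∃ f, f ≠ 0 ∧ ⟪f, u⟫ = 0 ∧ c + z + f ∈ K₀ := by
    intro z hz
    have hcont : Continuous fun t : ℝ => g.linear (z + t • e) :=
      (g.linear : F →ₗ[ℝ] F).continuous_of_finiteDimensional.comp (by fun_prop)
    have hev : ∀ᶠ t : ℝ in 𝓝 0, g.linear (z + t • e) ∈ K :=
      hcont.continuousAt.eventually_mem (by simpa using hz)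
    obtain ⟨t, ht, ht₀⟩ := ((hev.filter_mono nhdsWithin_le_nhds).and
      (self_mem_nhdsWithin : {(0 : ℝ)}ᶜ ∈ 𝓝[≠] 0)).exists
    exact ⟨t • e, smul_ne_zero ht₀ he, by rw [real_inner_smul_left, heu, mul_zero], by
      rw [add_assoc]
      exact (hmem _).mp ht⟩
  have hcenter : c = p + ⟪c - p, u⟫ • u := by
    obtain ⟨f, hf₀, hfu, hf⟩ := hstep 0 (by simpa using h₀)
    rw [add_zero] at hf
    refine hax.center_eq ?_ hf₀ hfu hf fun x hx => ?_
    · simpa using (hmem 0).mp (by simpa using mem_of_mem_nhds h₀)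
    · rw [sub_eq_add_neg, ← hmem, map_neg]
      exact hsym _ ((hmem x).mpr hx)
  have hle : ∀ (s : ℝ) (y y' : F), ⟪y, u⟫ = 0 → ⟪y', u⟫ = 0 → ‖y‖ = ‖y'‖ →
      gauge K (g.linear (s • u + y)) ≤ gauge K (g.linear (s • u + y')) := by
    intro s y y' hy hy' hyy'
    refine le_of_forall_gt_imp_ge_of_dense fun μ hμ => ?_
    have hμ₀ : 0 < μ := (gauge_nonneg _).trans_lt hμ
    have hnhds : K ∈ 𝓝 (g.linear (μ⁻¹ • (s • u + y'))) := by
      rw [← mem_interior_iff_mem_nhds, ← gauge_lt_one_iff_mem_interior hconv h₀, map_smul,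
        gauge_smul_of_nonneg (inv_nonneg.mpr hμ₀.le), smul_eq_mul, inv_mul_lt_iff₀ hμ₀, mul_one]
      exact hμ
    obtain ⟨f, hf₀, hfu, hf⟩ := hstep _ hnhds
    have hcoord : ∀ w : F, ⟪w, u⟫ = 0 →
        c + μ⁻¹ • (s • u + w) - p = (⟪c - p, u⟫ + μ⁻¹ * s) • u + μ⁻¹ • w := by
      intro w hw
      conv_lhs => rw [hcenter]
      module
    have hheight : ∀ w : F, ⟪w, u⟫ = 0 →
        ⟪c + μ⁻¹ • (s • u + w) - p, u⟫ = ⟪c - p, u⟫ + μ⁻¹ * s := by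
      intro w hw
      rw [hcoord w hw, inner_add_left, real_inner_smul_left, real_inner_smul_left, huu, hw]
      ring
    have hdist : ∀ w : F, ⟪w, u⟫ = 0 →
        dist (c + μ⁻¹ • (s • u + w)) (p + (⟪c - p, u⟫ + μ⁻¹ * s) • u) = μ⁻¹ * ‖w‖ := by
      intro w hw
      rw [dist_eq_norm, ← sub_sub, hcoord w hw, add_sub_cancel_left, norm_smul,
        Real.norm_of_nonneg (inv_nonneg.mpr hμ₀.le)]
    have hfin : g.linear (μ⁻¹ • (s • u + y)) ∈ K := by
      rw [hmem]
      refine hax.mem_of_norm_eq ((hmem _).mp (mem_of_mem_nhds hnhds)) hf₀ hfu hf ?_ ?_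
      · rw [hheight y hy, hheight y' hy']
      · rw [hheight y' hy', hdist y hy, hdist y' hy', hyy']
    have := gauge_le_one_of_mem hfin
    rwa [map_smul, gauge_smul_of_nonneg (inv_nonneg.mpr hμ₀.le), smul_eq_mul,
      inv_mul_le_iff₀ hμ₀, mul_one] at this
  exact ⟨g.linear, u, hax.1, fun s y y' hy hy' hyy' =>
    (hle s y y' hy hy' hyy').antisymm (hle s y' y hy' hy hyy'.symm)⟩

theorem Convex.balanced_of_neg_mem {E : Type*} [AddCommGroup E] [Module ℝ E] {B : Set E}
    (hB : Convex ℝ B) (hsym : ∀ x ∈ B, -x ∈ B) : Balanced ℝ B := by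
  rw [balanced_iff_smul_mem]
  intro a ha x hx
  rw [Real.norm_eq_abs, abs_le] at ha
  have := hB hx (hsym x hx) (a := (1 + a) / 2) (b := (1 - a) / 2) (by linarith) (by linarith)
    (by ring)
  convert this using 1
  module

theorem gauge_subtype_preimage (B : Set F) (H : Submodule ℝ F) (x : H) :
    gauge {x : H | (x : F) ∈ B} x = gauge B x := by
  simp [gauge_def']

/-- A hyperplane section that is an affine body of revolution gives a revolution pair for the
gauge seminorm. -/
theorem exists_isRevolutionPair [FiniteDimensional ℝ F] {B : Set F} (p : Seminorm ℝ F)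
    (hpB : ∀ x, p x = gauge B x) (hp : ∀ x, p x = 0 → x = 0) (hconv : Convex ℝ B)
    (hsym : ∀ x ∈ B, -x ∈ B) (h₀ : B ∈ 𝓝 0) (H : Submodule ℝ F) (hH : 2 ≤ finrank ℝ H)
    (hrev : IsAffineBodyOfRevolution {x : H | (x : F) ∈ B}) :
    ∃ N v, IsRevolutionPair p N v ∧ N ⊔ span ℝ {v} = H := by
  obtain ⟨A, u, hu, hA⟩ := hrev.exists_gauge_eq (hconv.linear_preimage H.subtype)
    (fun x hx => hsym x hx) (continuous_subtype_val.continuousAt.preimage_mem_nhds h₀) hH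
  let T : H →ₗ[ℝ] F := H.subtype ∘ₗ A.toLinearMap
  have hT : Function.Injective T := H.subtype_injective.comp A.injective
  have hrot : ∀ (s : ℝ) (y y' : H), ⟪y, u⟫ = 0 → ⟪y', u⟫ = 0 → ‖y‖ = ‖y'‖ →
      p (s • T u + T y) = p (s • T u + T y') := by
    intro s y y' hy hy' hyy'
    have := hA s y y' hy hy' hyy'
    rw [gauge_subtype_preimage, gauge_subtype_preimage, ← hpB, ← hpB] at this
    rw [← map_smul, ← map_add, ← map_add]
    exact this
  obtain ⟨e, he, heu⟩ := exists_norm_eq_one_inner_eq_zero hH u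
  have hTe : p (T e) ≠ 0 := fun h => by
    have : e = 0 := hT ((hp _ h).trans (map_zero T).symm)
    simp [this] at he
  have hnorm : ∀ y : H, ⟪y, u⟫ = 0 → p (T y) = ‖y‖ * p (T e) := by
    intro y hy
    have := hrot 0 y (‖y‖ • e) hy (by rw [real_inner_smul_left, heu, mul_zero])
      (by rw [norm_smul, norm_norm, he, mul_one])
    rwa [zero_smul, zero_add, zero_add, map_smul, map_smul_eq_mul, norm_norm] at this
  refine ⟨(span ℝ {u})ᗮ.map T, T u, ⟨?_, ?_, ?_⟩, ?_⟩
  · rintro ⟨y, hy, hyu⟩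
    rw [hT hyu, SetLike.mem_coe, mem_orthogonal_singleton_iff_inner_left,
      real_inner_self_eq_norm_sq, hu] at hy
    norm_num at hy
  · rintro _ ⟨x, hx, rfl⟩ _ ⟨y, hy, rfl⟩
    rw [SetLike.mem_coe, mem_orthogonal_singleton_iff_inner_left] at hx hy
    rw [← map_add, ← map_sub, hnorm x hx, hnorm y hy,
      hnorm (x + y) (by rw [inner_add_left, hx, hy, add_zero]),
      hnorm (x - y) (by rw [inner_sub_left, hx, hy, sub_zero])]
    linear_combination p (T e) ^ 2 * parallelogram_law_with_norm ℝ x y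
  · rintro s _ ⟨y, hy, rfl⟩ _ ⟨y', hy', rfl⟩ hyy'
    rw [SetLike.mem_coe, mem_orthogonal_singleton_iff_inner_left] at hy hy'
    rw [hnorm y hy, hnorm y' hy'] at hyy'
    exact hrot s y y' hy hy' (mul_right_cancel₀ hTe hyy')
  · rw [← Set.image_singleton, ← map_span, ← Submodule.map_sup, sup_comm,
      sup_orthogonal_of_hasOrthogonalProjection, map_comp, Submodule.map_top, LinearEquiv.range,
      Submodule.map_top]
    exact H.range_subtype

/-- Sections on which the gauge satisfies the parallelogram law are ellipsoids. -/
theorem isEllipsoid_of_parallelogramOn [FiniteDimensional ℝ F] {B : Set F} (p : Seminorm ℝ F)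
    (hpB : ∀ x, p x ≤ 1 ↔ x ∈ B) (hp : ∀ x, p x = 0 → x = 0) {H : Submodule ℝ F}
    (h : ParallelogramOn p H) : IsEllipsoid {x : H | (x : F) ∈ B} := by
  obtain ⟨φ, hφ⟩ := h.exists_linearEquiv hp
  refine ⟨((stdOrthonormalBasis ℝ H).repr.toLinearEquiv.trans φ.symm).toAffineEquiv, ?_⟩
  ext x
  constructor
  · intro hx
    refine ⟨(stdOrthonormalBasis ℝ H).repr.symm (φ x), ?_, by simp⟩
    rw [mem_closedBall_zero_iff, LinearIsometryEquiv.norm_map, hφ]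
    exact (hpB x).mpr hx
  · rintro ⟨z, hz, rfl⟩
    rw [mem_closedBall_zero_iff] at hz
    refine (hpB _).mp ?_
    rw [← hφ]
    simpa using hz

end BodiesOfRevolution

/-- let `n ≥ 4` and let `B ⊆ ℝ^{n+1}` be a symmetric convex body with the
origin in its interior, all of whose hyperplane sections through the origin are affine
bodies of revolution (inside the respective hyperplane).  Then some hyperplane section of
`B` through the origin is an ellipsoid. -/
theorem sections_bodies_of_revolution_implies_elliptical_section
    (n : ℕ) (hn : 4 ≤ n)
    (B : Set (EuclideanSpace ℝ (Fin (n + 1))))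
    (hBcompact : IsCompact B) (hBconv : Convex ℝ B)
    (hBsym : B = -B)
    (hB0 : (0 : EuclideanSpace ℝ (Fin (n + 1))) ∈ interior B)
    (hsec : ∀ H : Submodule ℝ (EuclideanSpace ℝ (Fin (n + 1))), Module.finrank ℝ H = n →
      IsAffineBodyOfRevolution {x : H | (x : EuclideanSpace ℝ (Fin (n + 1))) ∈ B}) :
    ∃ H₀ : Submodule ℝ (EuclideanSpace ℝ (Fin (n + 1))), Module.finrank ℝ H₀ = n ∧
      IsEllipsoid {x : H₀ | (x : EuclideanSpace ℝ (Fin (n + 1))) ∈ B} := by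
  have hn₀ : B ∈ nhds 0 := mem_interior_iff_mem_nhds.mp hB0
  have hsym : ∀ x ∈ B, -x ∈ B := fun x hx => by
    rw [hBsym] at hx
    exact hx
  let p : Seminorm ℝ (EuclideanSpace ℝ (Fin (n + 1))) :=
    gaugeSeminorm (hBconv.balanced_of_neg_mem hsym) hBconv (absorbent_nhds_zero hn₀)
  have hp : ∀ x, p x = 0 → x = 0 := fun x hx =>
    (gauge_eq_zero (absorbent_nhds_zero hn₀)
      ((NormedSpace.isVonNBounded_iff ℝ).mpr hBcompact.isBounded)).mp hx
  obtain ⟨H, hH, hpar⟩ := exists_parallelogramOn_hyperplane hp hn (by simp) fun H hH =>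
    exists_isRevolutionPair p (fun _ => rfl) hp hBconv hsym hn₀ H (by omega) (hsec H hH)
  refine ⟨H, hH, isEllipsoid_of_parallelogramOn p (fun x => ?_) hp hpar⟩
  exact (gauge_le_one_iff_mem_closure hBconv hn₀).trans (by rw [hBcompact.isClosed.closure_eq])
end
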